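/- Suppose the smooth function p : ℝ² → ℝ admits a non-degenerate well along the closed curve γ = c(ℝ) with minimal value b₀, and that c is oriented so that I₀ := (1/(2π)) ∫₀^{2π} c₁(t) c₂'(t) dt > 0 (so 2π I₀ is the signed area enclosed by γ). Then there exist ε > 0, a smooth function g defined on a neighborhood of 0 in ℝ with g(0) = 0 and g'(0) ≠ 0, and a bijection σ : ℝ² → ℝ² such that: σ and σ⁻¹ are smooth; the Jacobian determinant of σ is identically 1 (σ is a symplectomorphism of ℝ² with its standard symplectic form); σ equals the identity outside some compact set; and for every (x, ξ) ∈ ℝ² with x² + ξ² ∈ (2I₀ − ε, 2I₀ + ε), one has p(σ(x, ξ)) = b₀ + g(x² + ξ² − 2I₀)². -/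

import Mathlib

open Real Set

/-- A smooth function `p : ℝ² → ℝ` admits a non-degenerate well along the closed curve
`γ = c(ℝ)` with minimal value `b₀`. -/
def NondegenerateWell (p : ℝ × ℝ → ℝ) (c : ℝ → ℝ × ℝ) (b₀ : ℝ) : Prop :=
  ContDiff ℝ (⊤ : ℕ∞) p ∧ ContDiff ℝ (⊤ : ℕ∞) c ∧
  (∀ t, c (t + 2 * π) = c t) ∧
  (∀ t, deriv c t ≠ 0) ∧
  Set.InjOn c (Set.Ico 0 (2 * π)) ∧
  (∃ Ω : Set (ℝ × ℝ), IsOpen Ω ∧ Set.range c ⊆ Ω ∧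
    (∀ m ∈ Set.range c, p m = b₀) ∧ (∀ m ∈ Ω \ Set.range c, b₀ < p m)) ∧
  (∀ t, ∀ ν : ℝ × ℝ, ν ≠ 0 → ν.1 * (deriv c t).1 + ν.2 * (deriv c t).2 = 0 →
    iteratedFDeriv ℝ 2 p (c t) ![ν, ν] ≠ 0)

namespace NormalForm
open Topology Filter MeasureTheory
open scoped ContDiff

abbrev Plane := ℝ × ℝ

theorem hasFDerivAt_intervalIntegral_param {H G : Type} [NormedAddCommGroup H] [NormedSpace ℝ H]
    [FiniteDimensional ℝ H] [NormedAddCommGroup G] [NormedSpace ℝ G] [CompleteSpace G]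
    {F : H × ℝ → G} (hF : ContDiff ℝ 1 F) (a b : ℝ) (x : H) :
    HasFDerivAt (fun z => ∫ t in a..b, F (z, t))
      (∫ t in a..b, (fderiv ℝ F (x, t)).comp (ContinuousLinearMap.inl ℝ H ℝ)) x := by
  have hc : Continuous F := hF.continuous
  have hF' : Continuous fun q : H × ℝ => (fderiv ℝ F q).comp (ContinuousLinearMap.inl ℝ H ℝ) :=
    (hF.continuous_fderiv one_ne_zero).clm_comp continuous_const
  obtain ⟨C, hC⟩ := ((isCompact_closedBall x 1).prod (isCompact_uIcc (a := a) (b := b))).exists_bound_of_continuousOn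
    hF'.continuousOn
  refine intervalIntegral.hasFDerivAt_integral_of_dominated_of_fderiv_le (𝕜 := ℝ)
    (F := fun z t => F (z, t)) (bound := fun _ => C)
    (F' := fun z t => (fderiv ℝ F (z, t)).comp (ContinuousLinearMap.inl ℝ H ℝ))
    (Metric.closedBall_mem_nhds x one_pos) ?_ ?_ ?_ ?_ ?_ ?_
  · exact Eventually.of_forall fun z => (hc.comp (by fun_prop)).aestronglyMeasurable
  · exact (hc.comp (by fun_prop)).intervalIntegrable _ _
  · exact (hF'.comp (by fun_prop : Continuous fun t : ℝ => (x, t))).aestronglyMeasurable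
  · exact Eventually.of_forall fun t ht z hz => hC (z, t) ⟨hz, uIoc_subset_uIcc ht⟩
  · exact intervalIntegrable_const
  · refine Eventually.of_forall fun t _ z _ => ?_
    have h1 : HasFDerivAt F (fderiv ℝ F (z, t)) (z, t) :=
      (hF.differentiable one_ne_zero (z, t)).hasFDerivAt
    exact h1.comp z (hasFDerivAt_prodMk_left z t)

theorem contDiff_intervalIntegral_param {H : Type} [NormedAddCommGroup H] [NormedSpace ℝ H]
    [FiniteDimensional ℝ H] {G : Type} [NormedAddCommGroup G] [NormedSpace ℝ G] [CompleteSpace G]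
    {F : H × ℝ → G} (hF : ContDiff ℝ ∞ F) (a b : ℝ) :
    ContDiff ℝ ∞ fun z => ∫ t in a..b, F (z, t) := by
  rw [contDiff_infty]
  intro n
  induction n generalizing G with
  | zero =>
    have := intervalIntegral.continuous_parametric_intervalIntegral_of_continuous'
      (μ := volume) (f := fun z t => F (z, t)) (by exact hF.continuous) a b
    exact contDiff_zero.2 this
  | succ n ih =>
    have h1 : ContDiff ℝ 1 F := hF.of_le (by exact_mod_cast le_top)
    push_cast
    rw [contDiff_succ_iff_hasFDerivAt]
    refine ⟨_, ih (F := fun q => (fderiv ℝ F q).comp (ContinuousLinearMap.inl ℝ H ℝ)) ?_,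
      hasFDerivAt_intervalIntegral_param h1 a b⟩
    exact (hF.fderiv_right (by simp)).clm_comp contDiff_const

theorem det_plane (A : Plane →L[ℝ] Plane) :
    A.det = (A (1, 0)).1 * (A (0, 1)).2 - (A (0, 1)).1 * (A (1, 0)).2 := by
  let b := Module.Basis.finTwoProd ℝ
  have : A.det = ((A : Plane →ₗ[ℝ] Plane).toMatrix b b).det := by
    rw [ContinuousLinearMap.det, LinearMap.det_toMatrix]
  rw [this, Matrix.det_fin_two]
  simp [LinearMap.toMatrix_apply, b]

/-- Diffeomorphisms of the plane that are the identity outside a compact set. -/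
def IsDiffeoC (Ψ : Plane ≃ Plane) : Prop :=
  ContDiff ℝ ∞ Ψ ∧ ContDiff ℝ ∞ Ψ.symm ∧ ∃ K, IsCompact K ∧ ∀ z ∉ K, Ψ z = z

theorem IsDiffeoC.refl : IsDiffeoC (Equiv.refl _) :=
  ⟨contDiff_id, contDiff_id, ∅, isCompact_empty, fun _ _ => rfl⟩

theorem IsDiffeoC.symm {Ψ : Plane ≃ Plane} (h : IsDiffeoC Ψ) : IsDiffeoC Ψ.symm := by
  obtain ⟨h1, h2, K, hK, h3⟩ := h
  refine ⟨h2, h1, K, hK, fun z hz => ?_⟩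
  rw [Equiv.symm_apply_eq, h3 z hz]

theorem IsDiffeoC.trans {Ψ Φ : Plane ≃ Plane} (h : IsDiffeoC Ψ) (h' : IsDiffeoC Φ) :
    IsDiffeoC (Ψ.trans Φ) := by
  obtain ⟨h1, h2, K, hK, h3⟩ := h
  obtain ⟨h1', h2', K', hK', h3'⟩ := h'
  refine ⟨h1'.comp h1, h2.comp h2', K ∪ K', hK.union hK', fun z hz => ?_⟩
  simp only [mem_union, not_or] at hz
  simp [h3 z hz.1, h3' z hz.2]

/-- An injective local diffeomorphism that is the identity outside a compact set is a
compactly supported diffeomorphism. -/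
theorem exists_isDiffeoC {f : Plane → Plane} (hf : ContDiff ℝ ∞ f) (hinj : Function.Injective f)
    (hdet : ∀ z, (fderiv ℝ f z).det ≠ 0) (hK : ∃ K, IsCompact K ∧ ∀ z ∉ K, f z = z) :
    ∃ Ψ : Plane ≃ Plane, IsDiffeoC Ψ ∧ ⇑Ψ = f := by
  obtain ⟨K, hK, hid⟩ := hK
  have hstrict : ∀ z, HasStrictFDerivAt f
      (((fderiv ℝ f z).toContinuousLinearEquivOfDetNeZero (hdet z) : Plane ≃L[ℝ] Plane) :
        Plane →L[ℝ] Plane) z := fun z => by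
    rw [ContinuousLinearMap.coe_toContinuousLinearEquivOfDetNeZero]
    exact hf.contDiffAt.hasStrictFDerivAt (by simp)
  have hopen : IsOpenMap f := isOpenMap_of_hasStrictFDerivAt_equiv hstrict
  have hcl : IsClosed (range f) := by
    have : range f = f '' K ∪ closure Kᶜ := by
      apply subset_antisymm
      · rintro _ ⟨z, rfl⟩
        by_cases hz : z ∈ K
        · exact Or.inl ⟨z, hz, rfl⟩
        · exact Or.inr (subset_closure (by rwa [hid z hz]))
      · rintro z (⟨y, _, rfl⟩ | hz)
        · exact ⟨y, rfl⟩
        · have : closure Kᶜ ⊆ {z | f z = z} :=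
            closure_minimal (fun z hz => hid z hz) (isClosed_eq hf.continuous continuous_id)
          exact ⟨z, this hz⟩
    rw [this]
    exact (hK.image hf.continuous).isClosed.union isClosed_closure
  have hsurj : Function.Surjective f := by
    rw [← range_eq_univ]
    exact IsClopen.eq_univ ⟨hcl, hopen.isOpen_range⟩ (range_nonempty f)
  let Ψ := Equiv.ofBijective f ⟨hinj, hsurj⟩
  have h2 : ContDiff ℝ ∞ Ψ.symm :=
    (Ψ.toHomeomorphOfContinuousOpen hf.continuous hopen).contDiff_symm
      (fun a => (hstrict a).hasFDerivAt) hf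
  exact ⟨Ψ, ⟨hf, h2, K, hK, hid⟩, rfl⟩

/-- Smoothly embedded loops, parametrized with period `1`. -/
def IsSmoothEmb (c : ℝ → Plane) : Prop :=
  ContDiff ℝ ∞ c ∧ (∀ t, c (t + 1) = c t) ∧ (∀ t, deriv c t ≠ 0) ∧
    ∀ s t, c s = c t → ∃ k : ℤ, s = t + k

/-- The linear functional `z ↦ ⟨d, z⟩`. -/
noncomputable def dotL (d : Plane) : Plane →L[ℝ] ℝ :=
  d.1 • ContinuousLinearMap.fst ℝ ℝ ℝ + d.2 • ContinuousLinearMap.snd ℝ ℝ ℝ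

@[simp] theorem dotL_apply (d z : Plane) : dotL d z = d.1 * z.1 + d.2 * z.2 := by
  simp [dotL]

theorem dotL_self_pos {d : Plane} (hd : d ≠ 0) : 0 < dotL d d := by
  rw [dotL_apply]
  by_contra! h
  apply hd
  ext
  · simp; nlinarith [mul_self_nonneg d.1, mul_self_nonneg d.2]
  · simp; nlinarith [mul_self_nonneg d.1, mul_self_nonneg d.2]

theorem periodic_add_int {α : Type*} {c : ℝ → α} (h : ∀ t, c (t + 1) = c t) (t : ℝ) (k : ℤ) :
    c (t + k) = c t := by
  have := (Function.Periodic.int_mul (f := c) (c := 1) h k) t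
  simpa using this

theorem IsSmoothEmb.exists_local_param {c : ℝ → Plane} (hc : IsSmoothEmb c) (t₀ : ℝ) :
    ∃ (U : Set Plane) (τ : Plane → ℝ), IsOpen U ∧ c t₀ ∈ U ∧ ContDiffOn ℝ ∞ τ U ∧
      ∀ t, c t ∈ U → ∃ k : ℤ, τ (c t) = t + k := by
  obtain ⟨hs, hper, hd, hinj⟩ := hc
  set φ := dotL (deriv c t₀)
  set h : ℝ → ℝ := fun t => φ (c t) with hh
  have hsm : ContDiff ℝ ∞ h := φ.contDiff.comp hs
  have hder : ∀ t, HasDerivAt h (φ (deriv c t)) t := fun t =>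
    φ.hasFDerivAt.comp_hasDerivAt t (hs.differentiable (by simp) t).hasDerivAt
  have hdc : Continuous fun t => φ (deriv c t) :=
    φ.continuous.comp (hs.continuous_deriv (by simp))
  have h0 : φ (deriv c t₀) ≠ 0 := (dotL_self_pos (hd t₀)).ne'
  set e := hsm.contDiffAt.toOpenPartialHomeomorph h (HasDerivAt.hasFDerivAt_equiv (hder t₀) h0) (by simp : (∞ : WithTop ℕ∞) ≠ 0)
  have he : ∀ t, e t = h t := fun t => rfl
  have hmem : t₀ ∈ e.source := ContDiffAt.mem_toOpenPartialHomeomorph_source _ _ _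
  have hN : e.source ∩ {t | φ (deriv c t) ≠ 0} ∈ 𝓝 t₀ :=
    inter_mem (e.open_source.mem_nhds hmem) ((isOpen_ne_fun hdc continuous_const).mem_nhds h0)
  obtain ⟨r', hr', hball'⟩ := Metric.mem_nhds_iff.1 hN
  set r := min r' (1/2)
  have hr : 0 < r := by positivity
  have hball : Ioo (t₀ - r) (t₀ + r) ⊆ e.source ∩ {t | φ (deriv c t) ≠ 0} := by
    rw [← Real.ball_eq_Ioo]
    exact (Metric.ball_subset_ball (min_le_left _ _)).trans hball'
  have hr2 : r ≤ 1/2 := min_le_right _ _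
  set V := e.target ∩ e.symm ⁻¹' Ioo (t₀ - r) (t₀ + r)
  have hV : IsOpen V := e.symm.isOpen_inter_preimage isOpen_Ioo
  refine ⟨φ ⁻¹' V \ c '' Icc (t₀ + r) (t₀ + 1 - r), fun z => e.symm (φ z), ?_, ?_, ?_, ?_⟩
  · exact (hV.preimage φ.continuous).sdiff (isCompact_Icc.image hs.continuous).isClosed
  · refine ⟨⟨e.map_source hmem, ?_⟩, ?_⟩
    · change e.symm (e t₀) ∈ Ioo (t₀ - r) (t₀ + r)
      rw [e.left_inv hmem]
      constructor <;> linarith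
    · rintro ⟨s, ⟨hs1, hs2⟩, hst⟩
      obtain ⟨k, hk⟩ := hinj _ _ hst
      have h1 : (0:ℝ) < k := by linarith
      have h2 : (k:ℝ) < 1 := by linarith
      norm_cast at h1 h2
      omega
  · intro z hz
    refine ContDiffAt.contDiffWithinAt ?_
    have : ContDiffAt ℝ ∞ e.symm (φ z) :=
      e.contDiffAt_symm_deriv (hball hz.1.2).2 hz.1.1 (hder _) hsm.contDiffAt
    exact this.comp z φ.contDiff.contDiffAt
  · rintro t ⟨⟨h1, h2⟩, h3⟩
    obtain ⟨k, hk, -⟩ := existsUnique_add_zsmul_mem_Ico (zero_lt_one' ℝ) t (t₀ - r)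
    simp only [zsmul_eq_mul, mul_one] at hk
    have hck : c (t + k) = c t := periodic_add_int hper t k
    have hlt : t + k < t₀ + r := by
      by_contra! hge
      exact h3 ⟨t + k, ⟨hge, by linarith [hk.2]⟩, hck⟩
    have hgt : t₀ - r < t + k := by
      rcases hk.1.lt_or_eq with h | h
      · exact h
      · refine absurd ?_ h3
        refine ⟨t + k + 1, ⟨by linarith, by linarith⟩, by rw [hper, hck]⟩
    refine ⟨k, ?_⟩
    have : φ (c t) = e (t + k) := by rw [he, hh]; simp only [hck]
    simp only [this]
    exact e.left_inv (hball ⟨hgt, hlt⟩).1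

theorem contDiff_smul_comp_bound {U : Set Plane} {τ χ : Plane → ℝ} (hU : IsOpen U)
    (hτ : ContDiffOn ℝ ∞ τ U) (hχ : ContDiff ℝ ∞ χ) (hsupp : HasCompactSupport χ)
    (hsub : tsupport χ ⊆ U) :
    ∃ C : ℝ, 0 ≤ C ∧ ∀ (w : ℝ → Plane) (η : ℝ), ContDiff ℝ ∞ w → (∀ t, ‖w t‖ ≤ η) →
      (∀ t, ‖deriv w t‖ ≤ η) →
      ContDiff ℝ ∞ (fun z => χ z • w (τ z)) ∧ ∀ z, ‖fderiv ℝ (fun z => χ z • w (τ z)) z‖ ≤ C * η := by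
  have hK : IsCompact (tsupport χ) := hsupp
  obtain ⟨C1, hC1⟩ := hK.exists_bound_of_continuousOn (f := fderiv ℝ χ)
    (hχ.continuous_fderiv (by simp)).continuousOn
  obtain ⟨C2, hC2⟩ := hK.exists_bound_of_continuousOn (f := χ) hχ.continuous.continuousOn
  obtain ⟨C3, hC3⟩ := hK.exists_bound_of_continuousOn (f := fderiv ℝ τ)
    ((hτ.continuousOn_fderiv_of_isOpen hU (by simp)).mono hsub)
  refine ⟨|C1| + |C2| * |C3|, by positivity, fun w η hw h1 h2 => ?_⟩
  have hη : 0 ≤ η := (norm_nonneg _).trans (h1 0)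
  have hzero : ∀ z ∉ tsupport χ, (fun z => χ z • w (τ z)) =ᶠ[𝓝 z] fun _ => 0 := by
    intro z hz
    have : (tsupport χ)ᶜ ∈ 𝓝 z := (isClosed_tsupport χ).isOpen_compl.mem_nhds hz
    filter_upwards [this] with y hy
    simp [image_eq_zero_of_notMem_tsupport hy]
  constructor
  · rw [contDiff_iff_contDiffAt]
    intro z
    by_cases hz : z ∈ tsupport χ
    · have hτz := hτ.contDiffAt (hU.mem_nhds (hsub hz))
      exact hχ.contDiffAt.smul (hw.contDiffAt.comp z hτz)
    · exact contDiffAt_const.congr_of_eventuallyEq (hzero z hz)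
  · intro z
    by_cases hz : z ∈ tsupport χ
    · have hτz : DifferentiableAt ℝ τ z :=
        (hτ.contDiffAt (hU.mem_nhds (hsub hz))).differentiableAt (by simp)
      have hwz : HasFDerivAt (fun z => w (τ z)) ((fderiv ℝ τ z).smulRight (deriv w (τ z))) z := by
        have := ((hw.differentiable (by simp) (τ z)).hasDerivAt).hasFDerivAt.comp z hτz.hasFDerivAt
        convert! this using 1
      have := (hχ.differentiable (by simp) z).hasFDerivAt.smul hwz
      have hf : fderiv ℝ (fun z => χ z • w (τ z)) z = _ := this.fderiv
      rw [hf]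
      refine (norm_add_le _ _).trans ?_
      rw [norm_smul, ContinuousLinearMap.norm_smulRight_apply, ContinuousLinearMap.norm_smulRight_apply]
      have e1 := (hC1 z hz).trans (le_abs_self C1)
      have e2 := (hC2 z hz).trans (le_abs_self C2)
      have e3 := (hC3 z hz).trans (le_abs_self C3)
      calc _ ≤ |C2| * (|C3| * η) + |C1| * η := by
            gcongr
            · exact h2 _
            · exact h1 _
        _ = _ := by ring
    · have := (hzero z hz).fderiv_eq (𝕜 := ℝ)
      rw [this]
      simp; positivity

theorem det_ne_zero_of_injective {A : Plane →L[ℝ] Plane} (h : ∀ v, A v = 0 → v = 0) :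
    A.det ≠ 0 := by
  intro hd
  have := LinearMap.bot_lt_ker_of_det_eq_zero (f := (A : Plane →ₗ[ℝ] Plane)) hd
  exact this.ne' ((LinearMap.ker_eq_bot').2 h)

/-- Every loop that is `C¹`-close to a smoothly embedded loop is its image under a compactly
supported diffeomorphism of the plane. -/
theorem IsSmoothEmb.exists_isDiffeoC {c : ℝ → Plane} (hc : IsSmoothEmb c) :
    ∃ η > 0, ∀ c' : ℝ → Plane, ContDiff ℝ ∞ c' → (∀ t, c' (t + 1) = c' t) →
      (∀ t, ‖c' t - c t‖ ≤ η) → (∀ t, ‖deriv c' t - deriv c t‖ ≤ η) →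
      ∃ Ψ : Plane ≃ Plane, IsDiffeoC Ψ ∧ ∀ t, c' t = Ψ (c t) := by
  choose U₀ τ hU₀ hmem hτ₀ hτc using hc.exists_local_param
  have hcont := hc.1.continuous
  have hrange : range c = c '' Icc 0 1 := by
    apply subset_antisymm
    · rintro _ ⟨t, rfl⟩
      refine ⟨Int.fract t, ⟨Int.fract_nonneg t, (Int.fract_lt_one t).le⟩, ?_⟩
      have := periodic_add_int hc.2.1 (Int.fract t) ⌊t⌋
      rw [← this, Int.fract_add_floor]
    · exact image_subset_range _ _
  have hcpt : IsCompact (range c) := hrange ▸ isCompact_Icc.image hcont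
  obtain ⟨R, hR⟩ := hcpt.isBounded.subset_ball 0
  set U := fun t => U₀ t ∩ Metric.ball 0 R
  have hU : ∀ t, IsOpen (U t) := fun t => (hU₀ t).inter Metric.isOpen_ball
  have hτ : ∀ t, ContDiffOn ℝ ∞ (τ t) (U t) := fun t => (hτ₀ t).mono inter_subset_left
  obtain ⟨T, hT⟩ := hcpt.elim_finite_subcover U hU (by
    rintro _ ⟨t, rfl⟩
    exact mem_iUnion.2 ⟨t, hmem t, hR ⟨t, rfl⟩⟩)
  obtain ⟨χ, hχ⟩ := SmoothPartitionOfUnity.exists_isSubordinate (ι := T) (modelWithCornersSelf ℝ Plane)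
    hcpt.isClosed (fun i => U i) (fun i => hU i) (by
      intro z hz
      obtain ⟨t, ht, hz⟩ := mem_iUnion₂.1 (hT hz)
      exact mem_iUnion.2 ⟨⟨t, ht⟩, hz⟩)
  have hχs : ∀ i, ContDiff ℝ ∞ (χ i) := fun i => (χ i).contMDiff.contDiff
  have hχc : ∀ i, HasCompactSupport (χ i) := fun i =>
    HasCompactSupport.of_support_subset_isCompact (isCompact_closedBall (0 : Plane) R)
      ((subset_tsupport _).trans ((hχ i).trans (inter_subset_right.trans Metric.ball_subset_closedBall)))
  have hb := fun i : T => contDiff_smul_comp_bound (hU i) (hτ i) (hχs i) (hχc i) (hχ i)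
  choose C hC0 hC using hb
  set S := ∑ i, C i
  have hS : 0 ≤ S := Finset.sum_nonneg fun i _ => hC0 i
  refine ⟨1 / (2 * (S + 1)), by positivity, fun c' hc' hper' h1 h2 => ?_⟩
  set w := fun t => c' t - c t
  have hw : ContDiff ℝ ∞ w := hc'.sub hc.1
  have hdw : ∀ t, deriv w t = deriv c' t - deriv c t := fun t =>
    deriv_sub (hc'.differentiable (by simp) t) (hc.1.differentiable (by simp) t)
  have hwper : ∀ t, w (t + 1) = w t := fun t => by simp only [w, hper', hc.2.1]
  have hbd := fun i => hC i w _ hw h1 (fun t => by rw [hdw]; exact h2 t)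
  set u : Plane → Plane := fun z => ∑ i, χ i z • w (τ i z) with hu
  have hus : ContDiff ℝ ∞ u := ContDiff.sum fun i _ => (hbd i).1
  have hud : ∀ z, ‖fderiv ℝ u z‖ ≤ 1 / 2 := by
    intro z
    have : fderiv ℝ u z = ∑ i, fderiv ℝ (fun z => χ i z • w (τ i z)) z :=
      fderiv_fun_sum fun i _ => (hbd i).1.differentiable (by simp) z
    rw [this]
    refine (norm_sum_le _ _).trans ((Finset.sum_le_sum fun i _ => (hbd i).2 z).trans ?_)
    rw [← Finset.sum_mul, mul_one_div, div_le_div_iff₀ (by positivity) (by positivity)]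
    linarith
  have hul : LipschitzWith (1/2) u := by
    apply lipschitzWith_of_nnnorm_fderiv_le (𝕜 := ℝ) (hus.differentiable (by simp))
    intro z
    rw [← NNReal.coe_le_coe]
    simpa using hud z
  obtain ⟨Ψ, hΨ, hΨe⟩ := NormalForm.exists_isDiffeoC (f := fun z => z + u z) (contDiff_id.add hus) (by
    intro x y hxy
    have h := hul.dist_le_mul x y
    rw [dist_eq_norm, dist_eq_norm] at h
    have h3 : u x - u y = -(x - y) := by
      have : x + u x = y + u y := hxy
      linear_combination (exp := 1) this
    rw [h3, norm_neg] at h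
    push_cast at h
    have : ‖x - y‖ = 0 := by linarith [norm_nonneg (x - y)]
    exact sub_eq_zero.1 (norm_eq_zero.1 this)) (by
    intro z
    apply det_ne_zero_of_injective
    intro v hv
    have hd : fderiv ℝ (fun z => z + u z) z = ContinuousLinearMap.id ℝ Plane + fderiv ℝ u z :=
      ((hasFDerivAt_id z).add (hus.differentiable (by simp) z).hasFDerivAt).fderiv
    rw [hd] at hv
    have h3 : fderiv ℝ u z v = -v := by
      have : v + fderiv ℝ u z v = 0 := hv
      linear_combination (exp := 1) this
    have h4 := (fderiv ℝ u z).le_opNorm v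
    rw [h3, norm_neg] at h4
    have h5 := hud z
    have : ‖v‖ = 0 := by nlinarith [norm_nonneg v]
    exact norm_eq_zero.1 this) ⟨Metric.closedBall 0 R, isCompact_closedBall _ _, fun z hz => by
      have : u z = 0 := by
        refine Finset.sum_eq_zero fun i _ => ?_
        have : χ i z = 0 := by
          apply image_eq_zero_of_notMem_tsupport
          intro h
          exact hz (Metric.ball_subset_closedBall (hχ i h).2)
        simp [this]
      simp [this]⟩
  refine ⟨Ψ, hΨ, fun t => ?_⟩
  rw [hΨe]
  have hsum : ∑ i, χ i (c t) = 1 := by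
    have := χ.sum_eq_one (x := c t) ⟨t, rfl⟩
    rwa [finsum_eq_sum_of_fintype] at this
  have : u (c t) = w t := by
    have : ∀ i ∈ Finset.univ, χ i (c t) • w (τ i (c t)) = χ i (c t) • w t := by
      intro i _
      by_cases h : c t ∈ tsupport (χ i)
      · obtain ⟨k, hk⟩ := hτc i t (hχ i h).1
        rw [hk, periodic_add_int hwper]
      · simp [image_eq_zero_of_notMem_tsupport h]
    rw [hu]
    simp only
    rw [Finset.sum_congr rfl this, ← Finset.sum_smul, hsum, one_smul]
  simp only [this, w]
  abel

/-- An isotopy of smoothly embedded loops is induced by a compactly supported diffeomorphism. -/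
theorem exists_isDiffeoC_of_isotopy {C : ℝ → ℝ → Plane}
    (hC : ∀ s ∈ Icc (0:ℝ) 1, IsSmoothEmb (C s))
    (hcont : ∀ s₀ ∈ Icc (0:ℝ) 1, ∀ η > 0, ∀ᶠ s in 𝓝[Icc 0 1] s₀, ∀ t,
      ‖C s t - C s₀ t‖ ≤ η ∧ ‖deriv (C s) t - deriv (C s₀) t‖ ≤ η) :
    ∃ Ψ : Plane ≃ Plane, IsDiffeoC Ψ ∧ ∀ t, C 1 t = Ψ (C 0 t) := by
  refine IsPreconnected.induction₂ (isPreconnected_Icc : IsPreconnected (Icc (0:ℝ) 1))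
    (fun x y => ∃ Ψ : Plane ≃ Plane, IsDiffeoC Ψ ∧ ∀ t, C y t = Ψ (C x t)) ?_ ?_ ?_
    (left_mem_Icc.2 zero_le_one) (right_mem_Icc.2 zero_le_one)
  · intro s₀ hs₀
    obtain ⟨η, hη, h⟩ := (hC s₀ hs₀).exists_isDiffeoC
    filter_upwards [hcont s₀ hs₀ η hη, self_mem_nhdsWithin] with s hs hs'
    exact h (C s) (hC s hs').1 (hC s hs').2.1 (fun t => (hs t).1) fun t => (hs t).2
  · rintro x y z - - - ⟨Ψ, hΨ, h⟩ ⟨Φ, hΦ, h'⟩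
    exact ⟨Ψ.trans Φ, hΨ.trans hΦ, fun t => by simp [h', h]⟩
  · rintro x y - - ⟨Ψ, hΨ, h⟩
    exact ⟨Ψ.symm, hΨ.symm, fun t => by simp [h]⟩

/-- A smooth even probability density supported in `[-δ, δ]` (zero unless `0 < δ`). -/
noncomputable def mollKer (δ : ℝ) : ℝ → ℝ :=
  if h : 0 < δ then (⟨δ / 2, δ, by linarith, by linarith⟩ : ContDiffBump (0:ℝ)).normed volume else 0

/-- Mollification of a curve. -/
noncomputable def moll (δ : ℝ) (P : ℝ → Plane) (t : ℝ) : Plane :=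
  ∫ u, mollKer δ u • P (t - u)

section
variable {δ : ℝ} (hδ : 0 < δ)
include hδ

theorem mollKer_eq : mollKer δ =
    (⟨δ / 2, δ, by linarith, by linarith⟩ : ContDiffBump (0:ℝ)).normed volume := by
  simp [mollKer, hδ]

theorem mollKer_nonneg (u : ℝ) : 0 ≤ mollKer δ u := by
  rw [mollKer_eq hδ]; exact ContDiffBump.nonneg_normed _ _

theorem mollKer_contDiff : ContDiff ℝ ∞ (mollKer δ) := by
  rw [mollKer_eq hδ]; exact ContDiffBump.contDiff_normed _

theorem mollKer_hasCompactSupport : HasCompactSupport (mollKer δ) := by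
  rw [mollKer_eq hδ]; exact ContDiffBump.hasCompactSupport_normed _

theorem integral_mollKer : ∫ u, mollKer δ u = 1 := by
  rw [mollKer_eq hδ]; exact ContDiffBump.integral_normed _

theorem mollKer_neg (u : ℝ) : mollKer δ (-u) = mollKer δ u := by
  rw [mollKer_eq hδ]; exact ContDiffBump.normed_neg _ _

theorem mollKer_eq_zero {u : ℝ} (hu : δ ≤ |u|) : mollKer δ u = 0 := by
  rw [mollKer_eq hδ]
  apply Function.notMem_support.1
  rw [ContDiffBump.support_normed_eq]
  simpa using hu

theorem integrable_mollKer : Integrable (mollKer δ) :=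
  (mollKer_contDiff hδ).continuous.integrable_of_hasCompactSupport (mollKer_hasCompactSupport hδ)

variable {P Q : ℝ → Plane}

theorem integrable_mollKer_smul {E : Type*} [NormedAddCommGroup E] [NormedSpace ℝ E]
    {P : ℝ → E} (hP : Continuous P) (t : ℝ) :
    Integrable fun u => mollKer δ u • P (t - u) :=
  ((mollKer_contDiff hδ).continuous.smul (by fun_prop)).integrable_of_hasCompactSupport
    (mollKer_hasCompactSupport hδ).smul_right

theorem moll_contDiff (hP : Continuous P) : ContDiff ℝ ∞ (moll δ P) :=
  (mollKer_hasCompactSupport hδ).contDiff_convolution_left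
    (n := ⊤) (ContinuousLinearMap.lsmul ℝ ℝ) (mollKer_contDiff hδ) (μ := volume) hP.locallyIntegrable

theorem moll_hasDerivAt (hP : Continuous P) (t : ℝ) :
    HasDerivAt (moll δ P) (∫ u, deriv (mollKer δ) u • P (t - u)) t :=
  (mollKer_hasCompactSupport hδ).hasDerivAt_convolution_left
    (ContinuousLinearMap.lsmul ℝ ℝ) ((mollKer_contDiff hδ).of_le (by exact_mod_cast le_top)) (μ := volume)
    hP.locallyIntegrable t

theorem norm_moll_sub_le (hP : Continuous P) (hQ : Continuous Q) {t η : ℝ}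
    (h : ∀ u, |u| ≤ δ → ‖P (t - u) - Q (t - u)‖ ≤ η) : ‖moll δ P t - moll δ Q t‖ ≤ η := by
  rw [moll, moll, ← integral_sub (integrable_mollKer_smul hδ hP t) (integrable_mollKer_smul hδ hQ t)]
  have : ∫ u, mollKer δ u * η = η := by
    rw [integral_mul_const, integral_mollKer hδ, one_mul]
  rw [← this]
  refine norm_integral_le_of_norm_le ((integrable_mollKer hδ).mul_const η) (Eventually.of_forall fun u => ?_)
  rw [← smul_sub, norm_smul, Real.norm_of_nonneg (mollKer_nonneg hδ u)]
  by_cases hu : |u| ≤ δ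
  · exact mul_le_mul_of_nonneg_left (h u hu) (mollKer_nonneg hδ u)
  · rw [mollKer_eq_zero hδ (not_le.1 hu).le]; simp

theorem norm_moll_sub_self_le (hP : Continuous P) {t η : ℝ}
    (h : ∀ u, |u| ≤ δ → ‖P (t - u) - P t‖ ≤ η) : ‖moll δ P t - P t‖ ≤ η := by
  have h1 := norm_moll_sub_le hδ hP (continuous_const (y := P t)) (t := t) h
  have : moll δ (fun _ => P t) t = P t := by
    rw [moll, integral_smul_const, integral_mollKer hδ, one_smul]
  rwa [this] at h1

theorem clm_moll (hP : Continuous P) {E : Type*} [NormedAddCommGroup E] [NormedSpace ℝ E] [CompleteSpace E]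
    (φ : Plane →L[ℝ] E) (t : ℝ) :
    φ (moll δ P t) = ∫ u, mollKer δ u • φ (P (t - u)) := by
  rw [moll, ← φ.integral_comp_comm (integrable_mollKer_smul hδ hP t)]
  simp

theorem norm_deriv_moll_sub_le (hP : Continuous P) (hQ : Continuous Q) {t η : ℝ}
    (h : ∀ u, ‖P u - Q u‖ ≤ η) :
    ‖deriv (moll δ P) t - deriv (moll δ Q) t‖ ≤ (∫ u, ‖deriv (mollKer δ) u‖) * η := by
  have hc : Continuous (deriv (mollKer δ)) := (mollKer_contDiff hδ).continuous_deriv (by simp)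
  have hs : HasCompactSupport (deriv (mollKer δ)) := (mollKer_hasCompactSupport hδ).deriv
  have hi : ∀ {R : ℝ → Plane}, Continuous R → Integrable fun u => deriv (mollKer δ) u • R (t - u) :=
    fun hR => (hc.smul (by fun_prop)).integrable_of_hasCompactSupport hs.smul_right
  rw [(moll_hasDerivAt hδ hP t).deriv, (moll_hasDerivAt hδ hQ t).deriv, ← integral_sub (hi hP) (hi hQ),
    ← integral_mul_const]
  refine norm_integral_le_of_norm_le ?_ (Eventually.of_forall fun u => ?_)
  · exact ((hc.integrable_of_hasCompactSupport hs).norm).mul_const η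
  · rw [← smul_sub, norm_smul]
    exact mul_le_mul_of_nonneg_left (h _) (norm_nonneg _)

omit hδ in
theorem moll_periodic (h : ∀ t, P (t + 1) = P t) (t : ℝ) : moll δ P (t + 1) = moll δ P t := by
  simp only [moll]
  congr 1
  ext1 u
  rw [show t + 1 - u = (t - u) + 1 by ring, h]

omit hδ in
theorem moll_comp_add (s t : ℝ) : moll δ (fun t => P (t + s)) t = moll δ P (t + s) := by
  simp only [moll]
  congr 1
  ext1 u
  rw [show t - u + s = t + s - u by ring]

theorem moll_comp_neg (t : ℝ) : moll δ (fun t => P (-t)) t = moll δ P (-t) := by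
  simp only [moll]
  rw [← integral_neg_eq_self]
  congr 1
  ext1 u
  rw [mollKer_neg hδ, show -(t - -u) = -t - u by ring]

theorem moll_clm (hP : Continuous P) (A : Plane →L[ℝ] Plane) (t : ℝ) :
    moll δ (fun t => A (P t)) t = A (moll δ P t) := by
  rw [clm_moll hδ hP A t, moll]

theorem le_clm_moll_sub (hP : Continuous P) (φ : Plane →L[ℝ] ℝ) {a b κ : ℝ}
    (h : ∀ u, |u| ≤ δ → κ ≤ φ (P (b - u) - P (a - u))) :
    κ ≤ φ (moll δ P b - moll δ P a) := by
  have hi : ∀ x, Integrable fun u => mollKer δ u • φ (P (x - u)) := fun x =>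
    integrable_mollKer_smul hδ (φ.continuous.comp hP) x
  rw [map_sub, clm_moll hδ hP, clm_moll hδ hP, ← integral_sub (hi b) (hi a)]
  have : ∫ u, mollKer δ u * κ = κ := by
    rw [integral_mul_const, integral_mollKer hδ, one_mul]
  rw [← this]
  refine integral_mono ((integrable_mollKer hδ).mul_const κ) ((hi b).sub (hi a)) fun u => ?_
  simp only [← smul_sub]
  rw [smul_eq_mul]
  by_cases hu : |u| ≤ δ
  · refine mul_le_mul_of_nonneg_left ?_ (mollKer_nonneg hδ u)
    have := h u hu
    rwa [map_sub] at this
  · rw [mollKer_eq_zero hδ (not_le.1 hu).le]; simp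

/-- Quantitatively embedded loops have smoothly embedded mollifications. -/
theorem moll_isSmoothEmb (hQ : Continuous Q) (hper : ∀ t, Q (t + 1) = Q t) {ρ m : ℝ}
    (hρ : δ < ρ / 2) (hm : 0 < m)
    (hφ : ∀ t, ∃ φ : Plane →L[ℝ] ℝ, ∀ a ∈ Ioo (t - ρ) (t + ρ), ∀ b ∈ Ioo (t - ρ) (t + ρ),
      a ≤ b → b - a ≤ φ (Q b - Q a))
    (hfar : ∀ a d, d ∈ Icc (ρ / 2) (1 - ρ / 2) → m ≤ ‖Q a - Q (a + d)‖)
    (hunif : ∀ t t', |t - t'| ≤ δ → ‖Q t - Q t'‖ ≤ m / 3) : IsSmoothEmb (moll δ Q) := by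
  have hφ' : ∀ t, ∃ φ : Plane →L[ℝ] ℝ, ∀ a b, |a - t| < ρ / 2 → |b - t| < ρ / 2 → a ≤ b →
      b - a ≤ φ (moll δ Q b - moll δ Q a) := by
    intro t
    obtain ⟨φ, h⟩ := hφ t
    refine ⟨φ, fun a b ha hb hab => le_clm_moll_sub hδ hQ φ fun u hu => ?_⟩
    rw [abs_lt] at ha hb
    rw [abs_le] at hu
    have := h (a - u) ⟨by linarith, by linarith⟩ (b - u) ⟨by linarith, by linarith⟩ (by linarith)
    linarith
  have hclose : ∀ t, ‖moll δ Q t - Q t‖ ≤ m / 3 := fun t =>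
    norm_moll_sub_self_le hδ hQ fun u hu => hunif _ _ (by
      rw [show t - u - t = -u by ring, abs_neg]; exact hu)
  have hnear : ∀ a b, a ≤ b → b - a < ρ / 2 → moll δ Q a = moll δ Q b → b ≤ a := by
    intro a b hab h1 h2
    obtain ⟨φ, h⟩ := hφ' a
    have := h a b (by simp; linarith) (by rw [abs_lt]; constructor <;> linarith) hab
    rw [h2, sub_self, map_zero] at this
    linarith
  refine ⟨moll_contDiff hδ hQ, moll_periodic hper, fun t h0 => ?_, fun s t hst => ?_⟩
  · obtain ⟨φ, h⟩ := hφ' t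
    have hd : HasDerivAt (fun x => φ (moll δ Q x)) 0 t := by
      have := φ.hasFDerivAt.comp_hasDerivAt t ((moll_contDiff hδ hQ).differentiable (by simp) t).hasDerivAt
      rwa [h0, map_zero] at this
    have hd2 : HasDerivAt (fun x => φ (moll δ Q x) - x) (0 - 1) t := hd.sub (hasDerivAt_id t)
    have hev : ∀ᶠ x in 𝓝[>] t, 0 ≤ slope (fun x => φ (moll δ Q x) - x) t x := by
      have hN : Ioo t (t + ρ / 2) ∈ 𝓝[>] t := Ioo_mem_nhdsGT (by linarith)
      filter_upwards [hN] with x hx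
      rw [slope_def_field]
      apply div_nonneg _ (by linarith [hx.1])
      have := h t x (by simp; linarith) (by rw [abs_lt]; constructor <;> linarith [hx.1, hx.2]) hx.1.le
      rw [map_sub] at this
      linarith
    have ht := (hasDerivAt_iff_tendsto_slope.1 hd2).mono_left
      (nhdsWithin_mono t (fun x (hx : x ∈ Ioi t) => ne_of_gt hx))
    have := ge_of_tendsto ht hev
    linarith
  · obtain ⟨k, hk, -⟩ := existsUnique_add_zsmul_mem_Ico (zero_lt_one' ℝ) t s
    simp only [zsmul_eq_mul, mul_one] at hk
    have e : moll δ Q s = moll δ Q (t + k) := by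
      rw [hst, periodic_add_int (moll_periodic hper)]
    rcases lt_or_ge (t + k - s) (ρ / 2) with h | h
    · exact ⟨k, by linarith [hnear _ _ hk.1 h e, hk.1]⟩
    rcases lt_or_ge (1 - ρ / 2) (t + k - s) with h' | h'
    · have := hnear (t + k) (s + 1) hk.2.le (by linarith) (by rw [moll_periodic hper, e])
      exact absurd hk.2 (not_lt.2 this)
    · exfalso
      have h1 := hfar s (t + k - s) ⟨h, h'⟩
      rw [show s + (t + k - s) = t + k by ring] at h1
      have h2 := hclose s
      have h3 := hclose (t + k)
      rw [← e] at h3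
      have : Q s - Q (t + k) = (moll δ Q s - Q (t + k)) - (moll δ Q s - Q s) := by abel
      rw [this] at h1
      linarith [norm_sub_le (moll δ Q s - Q (t + k)) (moll δ Q s - Q s)]

end

/-- Isotopies of embedded loops that are locally uniformly monotone in some direction. -/
def TameFamily (P : ℝ → ℝ → Plane) : Prop :=
  Continuous (Function.uncurry P) ∧ (∀ s t, P s (t + 1) = P s t) ∧
    (∀ s ∈ Icc (0:ℝ) 1, ∀ a b, P s a = P s b → ∃ k : ℤ, a = b + k) ∧
    ∀ s₀ ∈ Icc (0:ℝ) 1, ∀ t₀, ∃ φ : Plane →L[ℝ] ℝ, ∃ r > 0, ∀ s ∈ Icc (0:ℝ) 1, |s - s₀| < r →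
      ∀ a b, |a - t₀| < r → |b - t₀| < r → a ≤ b → b - a ≤ φ (P s b - P s a)

theorem TameFamily.exists_uniform {P : ℝ → ℝ → Plane} (h : TameFamily P) :
    ∃ ρ > 0, ∃ m > 0, ∃ δ₁ > 0, ρ ≤ 1 / 2 ∧ ∀ s ∈ Icc (0:ℝ) 1,
      (∀ t, ∃ φ : Plane →L[ℝ] ℝ, ∀ a ∈ Ioo (t - ρ) (t + ρ), ∀ b ∈ Ioo (t - ρ) (t + ρ),
        a ≤ b → b - a ≤ φ (P s b - P s a)) ∧
      (∀ a d, d ∈ Icc (ρ / 2) (1 - ρ / 2) → m ≤ ‖P s a - P s (a + d)‖) ∧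
      (∀ t t', |t - t'| ≤ δ₁ → ‖P s t - P s t'‖ ≤ m / 3) := by
  obtain ⟨hc, hper, hinj, hloc⟩ := h
  have hfl : ∀ s t x, P s (t + x) = P s (Int.fract t + x) := by
    intro s t x
    have := periodic_add_int (hper s) (Int.fract t + x) ⌊t⌋
    rw [← this]
    congr 1
    linarith [Int.fract_add_floor t]
  have hfr : ∀ t : ℝ, Int.fract t ∈ Icc (0:ℝ) 1 := fun t =>
    ⟨Int.fract_nonneg t, (Int.fract_lt_one t).le⟩
  choose! φ r hr hφ using hloc
  obtain ⟨ρ', hρ', hleb⟩ := lebesgue_number_lemma_of_metric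
    ((isCompact_Icc (a := (0:ℝ)) (b := 1)).prod (isCompact_Icc (a := (0:ℝ)) (b := 1)))
    (c := fun i : Icc (0:ℝ) 1 × ℝ => Metric.ball ((i.1 : ℝ), i.2) (r i.1 i.2))
    (fun i => Metric.isOpen_ball) (by
      rintro ⟨s, t⟩ ⟨hs, -⟩
      exact mem_iUnion.2 ⟨(⟨s, hs⟩, t), Metric.mem_ball_self (hr s hs t)⟩)
  set ρ := min ρ' (1 / 2) with hρdef
  have hρ : 0 < ρ := by positivity
  have hρ2 : ρ ≤ 1 / 2 := min_le_right _ _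
  have hρ1 : ρ ≤ ρ' := min_le_left _ _
  have hcomp1 : IsCompact (Icc (0:ℝ) 1 ×ˢ (Icc (0:ℝ) 1 ×ˢ Icc (ρ / 2) (1 - ρ / 2))) :=
    isCompact_Icc.prod (isCompact_Icc.prod isCompact_Icc)
  have hcont1 : Continuous fun q : ℝ × ℝ × ℝ => ‖P q.1 q.2.1 - P q.1 (q.2.1 + q.2.2)‖ := by
    have h1 : Continuous fun q : ℝ × ℝ × ℝ => P q.1 q.2.1 :=
      hc.comp (f := fun q : ℝ × ℝ × ℝ => (q.1, q.2.1)) (by fun_prop)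
    have h2 : Continuous fun q : ℝ × ℝ × ℝ => P q.1 (q.2.1 + q.2.2) :=
      hc.comp (f := fun q : ℝ × ℝ × ℝ => (q.1, q.2.1 + q.2.2)) (by fun_prop)
    exact (h1.sub h2).norm
  obtain ⟨q, hq, hmin⟩ := hcomp1.exists_isMinOn
    ⟨(0, 0, 1 / 2), ⟨by simp, by simp, by constructor <;> simp <;> linarith⟩⟩ hcont1.continuousOn
  set m := ‖P q.1 q.2.1 - P q.1 (q.2.1 + q.2.2)‖
  have hm : 0 < m := by
    apply norm_pos_iff.2
    intro h0
    obtain ⟨k, hk⟩ := hinj q.1 hq.1 _ _ (sub_eq_zero.1 h0)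
    have h1 := hq.2.2.1
    have h2 := hq.2.2.2
    have h3 : (k:ℝ) < 0 := by linarith
    have h4 : (-1:ℝ) < k := by linarith
    norm_cast at h3
    have h4' : (-1:ℤ) < k := by exact_mod_cast h4
    omega
  have hcomp2 : IsCompact (Icc (0:ℝ) 1 ×ˢ Icc (-1:ℝ) 2) := isCompact_Icc.prod isCompact_Icc
  obtain ⟨δ, hδ, hunif⟩ := Metric.uniformContinuousOn_iff.1
    (hcomp2.uniformContinuousOn_of_continuous hc.continuousOn) (m / 3) (by positivity)
  refine ⟨ρ, hρ, m, hm, min (δ / 2) (1 / 2), by positivity, hρ2, fun s hs => ⟨fun t => ?_, fun a d hd => ?_, fun t t' ht => ?_⟩⟩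
  · obtain ⟨i, hi⟩ := hleb (s, Int.fract t) ⟨hs, hfr t⟩
    refine ⟨φ i.1 i.2, fun a ha b hb hab => ?_⟩
    have key : ∀ x ∈ Ioo (t - ρ) (t + ρ), |s - i.1| < r i.1 i.2 ∧ |x - ⌊t⌋ - i.2| < r i.1 i.2 := by
      intro x hx
      have : (s, x - ⌊t⌋) ∈ Metric.ball (s, Int.fract t) ρ' := by
        rw [Metric.mem_ball, Prod.dist_eq, max_lt_iff]
        refine ⟨by simpa using hρ', ?_⟩
        simp only [Real.dist_eq]
        rw [show x - ⌊t⌋ - Int.fract t = x - t by linarith [Int.fract_add_floor t], abs_lt]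
        constructor <;> linarith [hx.1, hx.2]
      have := hi this
      rw [Metric.mem_ball, Prod.dist_eq, max_lt_iff] at this
      exact this
    have e : ∀ x, P s x = P s (x - ⌊t⌋) := fun x => by
      conv_lhs => rw [show x = (x - ⌊t⌋) + ⌊t⌋ by ring]
      exact periodic_add_int (hper s) _ _
    rw [e a, e b]
    have := hφ i.1 i.1.2 i.2 s hs (key a ha).1 _ _ (key a ha).2 (key b hb).2 (by linarith)
    linarith
  · have := hmin (show (s, Int.fract a, d) ∈ _ from ⟨hs, hfr a, hd⟩)
    simp only [Set.mem_ofPred_eq] at this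
    rw [hfl s a d, show P s a = P s (Int.fract a) by simpa using hfl s a 0]
    exact this
  · have h1 : t' = t + (t' - t) := by ring
    have h2 := le_min_iff.1 ht
    rw [h1, hfl s t, show P s t = P s (Int.fract t) by simpa using hfl s t 0]
    have h3 := hfr t
    have h4 := abs_le.1 h2.2
    have := hunif (s, Int.fract t) ⟨hs, by linarith [h3.1], by linarith [h3.2]⟩
      (s, Int.fract t + (t' - t)) ⟨hs, by dsimp; linarith [h3.1], by dsimp; linarith [h3.2]⟩ (by
        rw [Prod.dist_eq, max_lt_iff]
        refine ⟨by simpa using hδ, ?_⟩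
        simp only [Real.dist_eq]
        rw [show Int.fract t - (Int.fract t + (t' - t)) = t - t' by ring]
        linarith [h2.1])
    rw [dist_eq_norm] at this
    exact this.le

theorem TameFamily.exists_moll {P : ℝ → ℝ → Plane} (h : TameFamily P) :
    ∃ δ₀ > 0, ∀ δ ∈ Ioo 0 δ₀, (∀ s ∈ Icc (0:ℝ) 1, IsSmoothEmb (moll δ (P s))) ∧
      ∃ Ψ : Plane ≃ Plane, IsDiffeoC Ψ ∧ ∀ t, moll δ (P 1) t = Ψ (moll δ (P 0) t) := by
  obtain ⟨ρ, hρ, m, hm, δ₁, hδ₁, -, hU⟩ := h.exists_uniform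
  obtain ⟨hc, hper, -, -⟩ := h
  have hcs : ∀ s, Continuous (P s) := fun s => hc.comp (f := fun t => (s, t)) (by fun_prop)
  refine ⟨min (ρ / 2) δ₁, by positivity, fun δ hδ => ?_⟩
  have hd := lt_min_iff.1 hδ.2
  have hemb : ∀ s ∈ Icc (0:ℝ) 1, IsSmoothEmb (moll δ (P s)) := fun s hs => by
    obtain ⟨h1, h2, h3⟩ := hU s hs
    exact moll_isSmoothEmb hδ.1 (hcs s) (hper s) hd.1 hm h1 h2 fun t t' ht =>
      h3 t t' (ht.trans hd.2.le)
  refine ⟨hemb, exists_isDiffeoC_of_isotopy (C := fun s => moll δ (P s)) hemb ?_⟩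
  intro s₀ hs₀ η hη
  set B := ∫ u, ‖deriv (mollKer δ) u‖
  have hB : 0 ≤ B := integral_nonneg fun _ => norm_nonneg _
  have hev : ∀ᶠ s in 𝓝 s₀, ∀ t ∈ Icc (0:ℝ) 1, ‖P s t - P s₀ t‖ < η / (B + 1) := by
    apply isCompact_Icc.eventually_forall_of_forall_eventually
    intro t ht
    have hcc : Continuous fun q : ℝ × ℝ => ‖P q.1 q.2 - P s₀ q.2‖ :=
      ((show Continuous fun q : ℝ × ℝ => P q.1 q.2 from hc).sub ((hcs s₀).comp continuous_snd)).norm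
    have := hcc.tendsto (s₀, t)
    simp only [sub_self, norm_zero] at this
    have hp : (0:ℝ) < η / (B + 1) := by positivity
    exact this.eventually (gt_mem_nhds hp)
  filter_upwards [nhdsWithin_le_nhds hev] with s hs t
  have hall : ∀ t, ‖P s t - P s₀ t‖ ≤ η / (B + 1) := by
    intro t
    have := hs (Int.fract t) ⟨Int.fract_nonneg t, (Int.fract_lt_one t).le⟩
    have e : ∀ s, P s t = P s (Int.fract t) := fun s => by
      rw [← periodic_add_int (hper s) (Int.fract t) ⌊t⌋, Int.fract_add_floor]
    rw [e, e]
    exact this.le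
  constructor
  · refine (norm_moll_sub_le hδ.1 (hcs s) (hcs s₀) fun u _ => hall (t - u)).trans ?_
    exact div_le_self hη.le (by linarith)
  · refine (norm_deriv_moll_sub_le hδ.1 (hcs s) (hcs s₀) hall).trans ?_
    rw [mul_div_assoc', div_le_iff₀ (by positivity)]
    nlinarith

/-- Two loops agree up to a compactly supported diffeomorphism and an isometric
reparametrization. -/
def LoopEquiv (c c' : ℝ → Plane) : Prop :=
  ∃ Ψ : Plane ≃ Plane, IsDiffeoC Ψ ∧ ∃ ε : ℝ, (ε = 1 ∨ ε = -1) ∧ ∃ s, ∀ t, c' t = Ψ (c (ε * t + s))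

theorem LoopEquiv.refl (c : ℝ → Plane) : LoopEquiv c c :=
  ⟨_, .refl, 1, Or.inl rfl, 0, fun t => by simp⟩

theorem LoopEquiv.symm {c c' : ℝ → Plane} (h : LoopEquiv c c') : LoopEquiv c' c := by
  obtain ⟨Ψ, hΨ, ε, hε, s, h⟩ := h
  refine ⟨_, hΨ.symm, ε, hε, -ε * s, fun t => ?_⟩
  rw [h, Equiv.symm_apply_apply]
  congr 1
  rcases hε with rfl | rfl <;> ring

theorem LoopEquiv.trans {c c' c'' : ℝ → Plane} (h : LoopEquiv c c') (h' : LoopEquiv c' c'') :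
    LoopEquiv c c'' := by
  obtain ⟨Ψ, hΨ, ε, hε, s, h⟩ := h
  obtain ⟨Φ, hΦ, ε', hε', s', h'⟩ := h'
  refine ⟨_, hΨ.trans hΦ, ε * ε', ?_, ε * s' + s, fun t => ?_⟩
  · rcases hε with rfl | rfl <;> rcases hε' with rfl | rfl <;> simp
  · rw [h', h, Equiv.trans_apply]
    congr 3
    ring

theorem LoopEquiv.of_diffeo {c c' : ℝ → Plane} {Ψ : Plane ≃ Plane} (hΨ : IsDiffeoC Ψ)
    (h : ∀ t, c' t = Ψ (c t)) : LoopEquiv c c' :=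
  ⟨Ψ, hΨ, 1, Or.inl rfl, 0, fun t => by simp [h]⟩

/-- Fine mollifications of the two loops are equivalent. -/
def SmoothingEquiv (P Q : ℝ → Plane) : Prop :=
  ∃ δ₀ > 0, ∀ δ ∈ Ioo 0 δ₀, LoopEquiv (moll δ P) (moll δ Q)

theorem SmoothingEquiv.refl (P : ℝ → Plane) : SmoothingEquiv P P :=
  ⟨1, one_pos, fun _ _ => .refl _⟩

theorem SmoothingEquiv.symm {P Q : ℝ → Plane} (h : SmoothingEquiv P Q) : SmoothingEquiv Q P := by
  obtain ⟨δ, hδ, h⟩ := h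
  exact ⟨δ, hδ, fun x hx => (h x hx).symm⟩

theorem SmoothingEquiv.trans {P Q R : ℝ → Plane} (h : SmoothingEquiv P Q)
    (h' : SmoothingEquiv Q R) : SmoothingEquiv P R := by
  obtain ⟨δ, hδ, h⟩ := h
  obtain ⟨δ', hδ', h'⟩ := h'
  exact ⟨min δ δ', lt_min hδ hδ', fun x hx =>
    (h x ⟨hx.1, hx.2.trans_le (min_le_left _ _)⟩).trans (h' x ⟨hx.1, hx.2.trans_le (min_le_right _ _)⟩)⟩

theorem TameFamily.smoothingEquiv {P : ℝ → ℝ → Plane} (h : TameFamily P) :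
    SmoothingEquiv (P 0) (P 1) := by
  obtain ⟨δ, hδ, h⟩ := h.exists_moll
  refine ⟨δ, hδ, fun x hx => ?_⟩
  obtain ⟨Ψ, hΨ, h⟩ := (h x hx).2
  exact .of_diffeo hΨ h

theorem SmoothingEquiv.comp_add (P : ℝ → Plane) (s : ℝ) : SmoothingEquiv P fun t => P (t + s) :=
  ⟨1, one_pos, fun δ _ => ⟨_, .refl, 1, Or.inl rfl, s, fun t => by simp [moll_comp_add]⟩⟩

theorem SmoothingEquiv.comp_neg (P : ℝ → Plane) : SmoothingEquiv P fun t => P (-t) :=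
  ⟨1, one_pos, fun δ hδ => ⟨_, .refl, -1, Or.inr rfl, 0, fun t => by simp [moll_comp_neg hδ.1]⟩⟩

theorem SmoothingEquiv.comp_clm {P Q : ℝ → Plane} (hP : Continuous P) (hQ : Continuous Q)
    (A : Plane ≃L[ℝ] Plane) (h : SmoothingEquiv P Q) :
    SmoothingEquiv (fun t => A (P t)) fun t => A (Q t) := by
  obtain ⟨δ₀, hδ₀, h⟩ := h
  refine ⟨δ₀, hδ₀, fun δ hδ => ?_⟩
  obtain ⟨Ψ, ⟨h1, h2, K, hK, h3⟩, ε, hε, s, h⟩ := h δ hδ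
  refine ⟨(A.symm.toEquiv.trans Ψ).trans A.toEquiv, ⟨?_, ?_, A '' K, hK.image A.continuous, ?_⟩, ε, hε, s, fun t => ?_⟩
  · exact A.contDiff.comp (h1.comp A.symm.contDiff)
  · exact A.contDiff.comp (h2.comp A.symm.contDiff)
  · intro z hz
    have : A.symm z ∉ K := fun hk => hz ⟨_, hk, by simp⟩
    simp [h3 _ this]
  · have e1 := moll_clm hδ.1 hP (A : Plane →L[ℝ] Plane)
    have e2 := moll_clm hδ.1 hQ (A : Plane →L[ℝ] Plane)
    simp only [ContinuousLinearEquiv.coe_coe] at e1 e2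
    rw [e1, e2, h]
    simp

theorem TameFamily.smoothingEquiv_comp {P : ℝ → Plane} (h : TameFamily fun _ => P) {ψ : ℝ → ℝ}
    (hψ : Continuous ψ) (hψ1 : ∀ t, ψ (t + 1) = ψ t + 1) {κ : ℝ} (hκ : 0 < κ)
    (hmono : ∀ a b, a ≤ b → κ * (b - a) ≤ ψ b - ψ a) :
    SmoothingEquiv P fun t => P (ψ t) := by
  obtain ⟨hc, hper, hinj, hloc⟩ := h
  have hcP : Continuous P := hc.comp (f := fun t => ((0:ℝ), t)) (by fun_prop)
  set Φ : ℝ → ℝ → ℝ := fun s t => (1 - s) * t + s * ψ t with hΦ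
  set κ' := min κ 1
  have hκ' : 0 < κ' := by positivity
  have hΦc : Continuous fun q : ℝ × ℝ => Φ q.1 q.2 := by fun_prop
  have hΦm : ∀ s ∈ Icc (0:ℝ) 1, ∀ a b, a ≤ b → κ' * (b - a) ≤ Φ s b - Φ s a := by
    intro s hs a b hab
    have h1 := hmono a b hab
    have h2 : κ' * (b - a) ≤ κ * (b - a) := mul_le_mul_of_nonneg_right (min_le_left _ _) (by linarith)
    have h3 : κ' * (b - a) ≤ 1 * (b - a) := mul_le_mul_of_nonneg_right (min_le_right _ _) (by linarith)
    simp only [hΦ]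
    nlinarith [hs.1, hs.2, mul_le_mul_of_nonneg_left (h2.trans h1) hs.1,
      mul_le_mul_of_nonneg_left h3 (sub_nonneg.2 hs.2)]
  have hΦ1 : ∀ s t, Φ s (t + 1) = Φ s t + 1 := fun s t => by simp only [hΦ, hψ1]; ring
  have hΦk : ∀ s t, ∀ k : ℤ, Φ s (t + k) = Φ s t + k := by
    intro s t k
    have := periodic_add_int (c := fun t => Φ s t - t) (fun t => by rw [hΦ1]; ring) t k
    linarith
  have htame : TameFamily fun s t => P (Φ s t) := by
    refine ⟨hcP.comp hΦc, fun s t => ?_, fun s hs a b hab => ?_, fun s₀ hs₀ t₀ => ?_⟩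
    · change P (Φ s (t + 1)) = _
      rw [hΦ1]; exact hper 0 _
    · obtain ⟨k, hk⟩ := hinj s hs _ _ hab
      refine ⟨k, ?_⟩
      rw [← hΦk] at hk
      rcases le_total a (b + k) with h | h
      · have := hΦm s hs _ _ h
        rw [hk, sub_self] at this
        have : b + k - a ≤ 0 := by
          by_contra! h'
          have := mul_pos hκ' h'
          linarith
        linarith
      · have := hΦm s hs _ _ h
        rw [hk, sub_self] at this
        have : a - (b + k) ≤ 0 := by
          by_contra! h'
          have := mul_pos hκ' h'
          linarith
        linarith
    · obtain ⟨φ, r, hr, hφ⟩ := hloc s₀ hs₀ (Φ s₀ t₀)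
      obtain ⟨r', hr', hball⟩ := Metric.continuousAt_iff.1 (hΦc.continuousAt (x := (s₀, t₀))) r hr
      refine ⟨κ'⁻¹ • φ, r', hr', fun s hs hss a b ha hb hab => ?_⟩
      have key : ∀ x, |x - t₀| < r' → |Φ s x - Φ s₀ t₀| < r := fun x hx =>
        hball (x := (s, x)) (by rw [Prod.dist_eq, max_lt_iff]; exact ⟨hss, hx⟩)
      have h1 := hΦm s hs a b hab
      have h2 := hφ s₀ hs₀ (by simpa using hr) _ _ (key a ha) (key b hb) (by
        have := mul_nonneg hκ'.le (sub_nonneg.2 hab)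
        linarith)
      rw [smul_apply, smul_eq_mul, inv_mul_eq_div, le_div_iff₀ hκ', mul_comm]
      exact h1.trans h2
  have := htame.smoothingEquiv
  simpa [hΦ] using this

/-- Piecewise linear interpolation of a two-sided sequence. -/
noncomputable def interp {E : Type*} [AddCommGroup E] [Module ℝ E] (v : ℤ → E) (x : ℝ) : E :=
  (1 - Int.fract x) • v ⌊x⌋ + Int.fract x • v (⌊x⌋ + 1)

section
variable {E : Type*} [AddCommGroup E] [Module ℝ E]

theorem interp_eq (v : ℤ → E) {k : ℤ} {x : ℝ} (h1 : k ≤ x) (h2 : x ≤ k + 1) :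
    interp v x = (1 - (x - k)) • v k + (x - k) • v (k + 1) := by
  rcases h2.lt_or_eq with h | rfl
  · have : ⌊x⌋ = k := Int.floor_eq_iff.2 ⟨h1, h⟩
    rw [interp, ← Int.self_sub_floor, this]
  · have : ⌊(k:ℝ) + 1⌋ = k + 1 := by exact_mod_cast Int.floor_intCast (R := ℝ) (k + 1)
    rw [interp, ← Int.self_sub_floor, this]
    simp

theorem interp_int (v : ℤ → E) (k : ℤ) : interp v k = v k := by
  rw [interp_eq v le_rfl (by linarith)]
  simp

theorem interp_shift (v : ℤ → E) (j : ℤ) (x : ℝ) :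
    interp (fun i => v (i + j)) x = interp v (x + j) := by
  rw [interp, interp, Int.fract_add_intCast, Int.floor_add_intCast]
  congr 3
  ring

theorem interp_neg (v : ℤ → E) (x : ℝ) : interp (fun i => v (-i)) x = interp v (-x) := by
  have h1 := Int.floor_le x
  have h2 := (Int.lt_floor_add_one x).le
  rw [interp_eq (fun i => v (-i)) h1 h2, interp_eq v (k := -⌊x⌋ - 1) (by push_cast; linarith) (by push_cast; linarith)]
  rw [show -⌊x⌋ - 1 + 1 = -⌊x⌋ by ring, show -(⌊x⌋ + 1) = -⌊x⌋ - 1 by ring, add_comm]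
  push_cast
  congr 2 <;> ring

theorem interp_map {F : Type*} [AddCommGroup F] [Module ℝ F] (A : E →ₗ[ℝ] F) (v : ℤ → E) (x : ℝ) :
    interp (fun i => A (v i)) x = A (interp v x) := by
  simp [interp]

theorem interp_eq_max (v : ℤ → E) {k : ℤ} {x : ℝ} (h1 : k - 1 ≤ x) (h2 : x ≤ k + 1) :
    interp v x = v k + max (x - k) 0 • (v (k + 1) - v k) - max (k - x) 0 • (v k - v (k - 1)) := by
  rcases le_total (k:ℝ) x with h | h
  · rw [interp_eq v h h2, max_eq_left (by linarith), max_eq_right (by linarith)]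
    module
  · rw [interp_eq v (k := k - 1) (by push_cast; linarith) (by push_cast; linarith),
      max_eq_right (by linarith), max_eq_left (by linarith), sub_add_cancel]
    push_cast
    module

theorem interp_periodic {v : ℤ → E} {n : ℕ} (hv : ∀ i, v (i + n) = v i) (x : ℝ) :
    interp v (x + n) = interp v x := by
  have := interp_shift v n x
  rw [Int.cast_natCast] at this
  rw [← this]
  congr 1
  ext1 i
  exact hv i

end

theorem interp_mono {u : ℤ → ℝ} (hu : Monotone u) : Monotone (interp u) := by
  intro x y hxy
  have hx := Int.fract_nonneg x
  have hx1 := (Int.fract_lt_one x).le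
  have hy := Int.fract_nonneg y
  have hy1 := (Int.fract_lt_one y).le
  have hux := hu (Int.le_add_one (le_refl ⌊x⌋))
  have huy := hu (Int.le_add_one (le_refl ⌊y⌋))
  rcases (Int.floor_le_floor hxy).eq_or_lt with h | h
  · simp only [interp, ← Int.self_sub_floor, ← h, smul_eq_mul]
    nlinarith
  · have h1 : interp u x ≤ u (⌊x⌋ + 1) := by simp only [interp, smul_eq_mul]; nlinarith
    have h2 : u ⌊y⌋ ≤ interp u y := by simp only [interp, smul_eq_mul]; nlinarith
    exact h1.trans ((hu h).trans h2)

theorem interp_sub_ge {w : ℤ → ℝ} {κ : ℝ} (hw : ∀ i, κ ≤ w (i + 1) - w i) {a b : ℝ} (hab : a ≤ b) :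
    κ * (b - a) ≤ interp w b - interp w a := by
  have hm : Monotone fun i : ℤ => w i - κ * i := monotone_int_of_le_succ fun i => by
    push_cast; linarith [hw i]
  have key : ∀ x, interp (fun i : ℤ => w i - κ * i) x = interp w x - κ * x := by
    intro x
    simp only [interp, smul_eq_mul]
    push_cast
    have := Int.fract_add_floor x
    linear_combination -κ * this
  have := interp_mono hm hab
  rw [key, key] at this
  linarith

theorem continuous_interp_family {V : ℝ → ℤ → Plane} (hV : ∀ i, Continuous fun s => V s i) :
    Continuous fun q : ℝ × ℝ => interp (V q.1) q.2 := by
  rw [continuous_iff_continuousAt]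
  rintro ⟨s, x⟩
  have hc : Continuous fun q : ℝ × ℝ => V q.1 ⌊x⌋ + max (q.2 - ⌊x⌋) 0 • (V q.1 (⌊x⌋ + 1) - V q.1 ⌊x⌋) -
      max (⌊x⌋ - q.2) 0 • (V q.1 ⌊x⌋ - V q.1 (⌊x⌋ - 1)) := by
    have := fun i => (hV i).comp (continuous_fst (X := ℝ) (Y := ℝ))
    simp only [Function.comp_def] at this
    fun_prop
  refine hc.continuousAt.congr ?_
  have h1 : Int.fract x < 1 := Int.fract_lt_one x
  have h0 := Int.fract_nonneg x
  rw [← Int.self_sub_floor] at h1 h0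
  have : Ioo ((⌊x⌋:ℝ) - 1) (⌊x⌋ + 1) ∈ 𝓝 x := Ioo_mem_nhds (by linarith) (by linarith)
  filter_upwards [continuous_snd.continuousAt.preimage_mem_nhds this] with q hq
  exact (interp_eq_max (V q.1) hq.1.le hq.2.le).symm

theorem continuous_interp (w : ℤ → ℝ) : Continuous (interp w) := by
  have := continuous_interp_family (V := fun _ i => (w i, 0)) fun i => continuous_const
  have h2 : Continuous fun x : ℝ => (interp (fun i => ((w i, 0) : Plane)) x).1 :=
    continuous_fst.comp (this.comp (f := fun x : ℝ => ((0:ℝ), x)) (by fun_prop))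
  convert h2 using 2 with x
  simp [interp]

/-- Simple closed polygons with `n` vertices. -/
def IsSimple (n : ℕ) (v : ℤ → Plane) : Prop :=
  (∀ i, v (i + n) = v i) ∧ ∀ x y, interp v x = interp v y → ∃ k : ℤ, x = y + k * n

/-- The closed polygon with vertices `v`, parametrized with period `1`. -/
noncomputable def poly (n : ℕ) (v : ℤ → Plane) (t : ℝ) : Plane := interp v (n * t)

theorem continuous_poly (n : ℕ) (v : ℤ → Plane) : Continuous (poly n v) := by
  have := continuous_interp_family (V := fun _ => v) fun i => continuous_const
  exact this.comp (f := fun t : ℝ => ((0:ℝ), n * t)) (by fun_prop)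

theorem IsSimple.shift {n : ℕ} {v : ℤ → Plane} (h : IsSimple n v) (j : ℤ) :
    IsSimple n fun i => v (i + j) := by
  refine ⟨fun i => by beta_reduce; rw [show i + n + j = i + j + n by ring, h.1], fun x y hxy => ?_⟩
  rw [interp_shift, interp_shift] at hxy
  obtain ⟨k, hk⟩ := h.2 _ _ hxy
  exact ⟨k, by linarith⟩

theorem IsSimple.neg {n : ℕ} {v : ℤ → Plane} (h : IsSimple n v) :
    IsSimple n fun i => v (-i) := by
  refine ⟨fun i => by beta_reduce; rw [← h.1]; congr 1; ring, fun x y hxy => ?_⟩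
  rw [interp_neg, interp_neg] at hxy
  obtain ⟨k, hk⟩ := h.2 _ _ hxy
  exact ⟨-k, by push_cast; linarith⟩

theorem IsSimple.map {n : ℕ} {v : ℤ → Plane} (h : IsSimple n v) (A : Plane ≃L[ℝ] Plane) :
    IsSimple n fun i => A (v i) := by
  refine ⟨fun i => by beta_reduce; rw [h.1], fun x y hxy => ?_⟩
  have e := fun x => interp_map (A : Plane →ₗ[ℝ] Plane) v x
  simp only [LinearEquiv.coe_coe, ContinuousLinearEquiv.coe_toLinearEquiv] at e
  rw [e, e] at hxy
  exact h.2 _ _ (A.injective hxy)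

theorem smoothingEquiv_shift {n : ℕ} (hn : n ≠ 0) (v : ℤ → Plane) (j : ℤ) :
    SmoothingEquiv (poly n v) (poly n fun i => v (i + j)) := by
  have := SmoothingEquiv.comp_add (poly n v) (j / n)
  convert this using 2 with t
  rw [poly, poly, interp_shift]
  congr 1
  field_simp

theorem smoothingEquiv_neg {n : ℕ} (v : ℤ → Plane) :
    SmoothingEquiv (poly n v) (poly n fun i => v (-i)) := by
  have := SmoothingEquiv.comp_neg (poly n v)
  convert this using 2 with t
  rw [poly, poly, interp_neg]
  congr 1
  ring

theorem SmoothingEquiv.map_poly {n m : ℕ} {v w : ℤ → Plane} (A : Plane ≃L[ℝ] Plane)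
    (h : SmoothingEquiv (poly n v) (poly m w)) :
    SmoothingEquiv (poly n fun i => A (v i)) (poly m fun i => A (w i)) := by
  have := h.comp_clm (continuous_poly _ _) (continuous_poly _ _) A
  have e := fun v x => interp_map (A : Plane →ₗ[ℝ] Plane) v x
  simp only [LinearEquiv.coe_coe, ContinuousLinearEquiv.coe_toLinearEquiv] at e
  convert this using 2 with t t
  · rw [poly, e]; rfl
  · rw [poly, e]; rfl

theorem IsSimple.sub_ne_zero {n : ℕ} {v : ℤ → Plane} (h : IsSimple n v) (hn : 2 ≤ n) (i : ℤ) :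
    v (i + 1) - v i ≠ 0 := by
  intro h0
  obtain ⟨k, hk⟩ := h.2 (i + 1 : ℤ) i (by rw [interp_int, interp_int]; exact sub_eq_zero.1 h0)
  push_cast at hk
  have hk' : (1:ℝ) = k * n := by linarith
  have : (1:ℤ) = k * n := by exact_mod_cast hk'
  have hd : (n:ℤ) ∣ 1 := ⟨k, by linarith⟩
  have := Int.le_of_dvd one_pos hd
  omega

theorem IsSimple.not_opposite {n : ℕ} {v : ℤ → Plane} (h : IsSimple n v) (hn : 2 ≤ n) (i : ℤ)
    {c : ℝ} (hc : 0 < c) : v (i + 1) - v i ≠ -c • (v i - v (i - 1)) := by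
  intro h0
  set τ := min 1 (1 / c) / 2 with hτ
  have hτ0 : 0 < τ := by positivity
  have hτ1 : τ ≤ 1 / 2 := by linarith [min_le_left 1 (1 / c)]
  have hτ2 : c * τ ≤ 1 / 2 := by
    have : c * min 1 (1 / c) ≤ c * (1 / c) := mul_le_mul_of_nonneg_left (min_le_right _ _) hc.le
    rw [mul_one_div_cancel hc.ne'] at this
    rw [hτ]; linarith
  have hcτ : 0 < c * τ := by positivity
  obtain ⟨k, hk⟩ := h.2 (i + τ) (i - c * τ) (by
    rw [interp_eq_max v (k := i) (by linarith) (by linarith),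
      interp_eq_max v (k := i) (x := i - c * τ) (by linarith) (by linarith), h0,
      max_eq_left (by linarith), max_eq_right (by linarith), max_eq_right (by linarith),
      max_eq_left (by linarith)]
    module)
  have h1 : (k:ℝ) * n = τ + c * τ := by linarith
  have h2 : (0:ℝ) < k * n := by linarith
  have h3 : (k:ℝ) * n < 2 := by linarith
  have h2' : (0:ℤ) < k * n := by exact_mod_cast h2
  have h3' : (k:ℤ) * n < 2 := by exact_mod_cast h3
  have hk0 : 0 < k := pos_of_mul_pos_left h2' (by positivity)
  nlinarith [(by exact_mod_cast hn : (2:ℤ) ≤ n)]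

/-- The determinant of two plane vectors. -/
def cross (u v : Plane) : ℝ := u.1 * v.2 - u.2 * v.1

theorem exists_clm_pos {p q : Plane} (hp : p ≠ 0) (hq : q ≠ 0) (h : ∀ c : ℝ, 0 < c → q ≠ -c • p) :
    ∃ φ : Plane →L[ℝ] ℝ, 0 < φ p ∧ 0 < φ q := by
  by_cases hc : cross p q = 0
  · have hpp := dotL_self_pos hp
    refine ⟨dotL p, hpp, ?_⟩
    by_contra! hle
    rw [dotL_apply] at hpp hle
    simp only [cross] at hc
    have e : q = ((p.1 * q.1 + p.2 * q.2) / (p.1 * p.1 + p.2 * p.2)) • p := by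
      ext
      · simp only [Prod.smul_fst, smul_eq_mul]; rw [div_mul_eq_mul_div, eq_div_iff hpp.ne']; linear_combination p.2 * (-hc)
      · simp only [Prod.smul_snd, smul_eq_mul]; rw [div_mul_eq_mul_div, eq_div_iff hpp.ne']; linear_combination p.1 * hc
    rcases hle.eq_or_lt with h0 | h0
    · rw [h0] at e; simp at e; exact hq e
    · refine h (-((p.1 * q.1 + p.2 * q.2) / (p.1 * p.1 + p.2 * p.2))) ?_ (by rw [neg_neg]; exact e)
      rw [neg_pos]
      exact div_neg_of_neg_of_pos h0 hpp
  · refine ⟨(cross p q)⁻¹ • ((q.2 - p.2) • ContinuousLinearMap.fst ℝ ℝ ℝ -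
      (q.1 - p.1) • ContinuousLinearMap.snd ℝ ℝ ℝ), ?_, ?_⟩
    all_goals
      simp only [smul_apply, sub_apply, smul_eq_mul,
        ContinuousLinearMap.coe_fst', ContinuousLinearMap.coe_snd']
      have : (0:ℝ) < (cross p q)⁻¹ * cross p q := by rw [inv_mul_cancel₀ hc]; exact one_pos
      convert this using 2
      simp only [cross]; ring

theorem tameFamily_poly {n : ℕ} (hn : 2 ≤ n) {V : ℝ → ℤ → Plane}
    (hV : ∀ i, Continuous fun s => V s i) (hper : ∀ s i, V s (i + n) = V s i)
    (hs : ∀ s ∈ Icc (0:ℝ) 1, IsSimple n (V s)) : TameFamily fun s => poly n (V s) := by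
  have hn0 : (0:ℝ) < n := by exact_mod_cast (by omega : 0 < n)
  have hn1 : (1:ℝ) ≤ n := by exact_mod_cast (by omega : 1 ≤ n)
  refine ⟨(continuous_interp_family hV).comp (f := fun q : ℝ × ℝ => (q.1, n * q.2)) (by fun_prop),
    fun s t => ?_, fun s hs' a b hab => ?_, fun s₀ hs₀ t₀ => ?_⟩
  · beta_reduce; rw [poly, mul_add, mul_one, interp_periodic (hper s)]; rfl
  · obtain ⟨k, hk⟩ := (hs s hs').2 _ _ hab
    exact ⟨k, mul_left_cancel₀ hn0.ne' (by linarith)⟩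
  · set k := ⌊n * t₀⌋ with hk
    have h1 : Int.fract (n * t₀) < 1 := Int.fract_lt_one _
    have h0 := Int.fract_nonneg (n * t₀)
    rw [← Int.self_sub_floor] at h1 h0
    have hS := hs s₀ hs₀
    have hp := hS.sub_ne_zero hn (k - 1)
    rw [sub_add_cancel] at hp
    obtain ⟨φ, hφp, hφq⟩ := exists_clm_pos hp (hS.sub_ne_zero hn k) fun c hc => hS.not_opposite hn k hc
    set c := min (φ (V s₀ k - V s₀ (k - 1))) (φ (V s₀ (k + 1) - V s₀ k)) / 2 with hcdef
    have hc : 0 < c := by positivity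
    have hc1 : c < φ (V s₀ k - V s₀ (k - 1)) := by
      have := min_le_left (φ (V s₀ k - V s₀ (k - 1))) (φ (V s₀ (k + 1) - V s₀ k)); linarith
    have hc2 : c < φ (V s₀ (k + 1) - V s₀ k) := by
      have := min_le_right (φ (V s₀ k - V s₀ (k - 1))) (φ (V s₀ (k + 1) - V s₀ k)); linarith
    have e1 : ∀ᶠ s in 𝓝 s₀, c < φ (V s k - V s (k - 1)) :=
      (φ.continuous.comp ((hV k).sub (hV (k - 1)))).continuousAt.eventually (lt_mem_nhds hc1)
    have e2 : ∀ᶠ s in 𝓝 s₀, c < φ (V s (k + 1) - V s k) :=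
      (φ.continuous.comp ((hV (k + 1)).sub (hV k))).continuousAt.eventually (lt_mem_nhds hc2)
    have e3 : ∀ᶠ t : ℝ in 𝓝 t₀, (n:ℝ) * t ∈ Ioo ((k:ℝ) - 1) (k + 1) := by
      have : Continuous fun t : ℝ => n * t := by fun_prop
      exact this.continuousAt.eventually (Ioo_mem_nhds (by linarith) (by linarith))
    obtain ⟨r1, hr1, hr1'⟩ := Metric.eventually_nhds_iff.1 (e1.and e2)
    obtain ⟨r2, hr2, hr2'⟩ := Metric.eventually_nhds_iff.1 e3
    refine ⟨c⁻¹ • φ, min r1 r2, by positivity, fun s _ hss a b ha hb hab => ?_⟩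
    obtain ⟨g1, g2⟩ := hr1' (y := s) (by rw [Real.dist_eq]; exact hss.trans_le (min_le_left _ _))
    have ga := hr2' (y := a) (by rw [Real.dist_eq]; exact ha.trans_le (min_le_right _ _))
    have gb := hr2' (y := b) (by rw [Real.dist_eq]; exact hb.trans_le (min_le_right _ _))
    rw [smul_apply, smul_eq_mul, inv_mul_eq_div, le_div_iff₀ hc]
    simp only [poly]
    rw [interp_eq_max (V s) ga.1.le ga.2.le, interp_eq_max (V s) gb.1.le gb.2.le]
    have hnab : n * a ≤ n * b := mul_le_mul_of_nonneg_left hab hn0.le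
    set A := n * a
    set B := n * b
    have hAB : b - a ≤ B - A := by simp only [A, B]; nlinarith
    simp only [map_sub, map_add, map_smul, smul_eq_mul] at g1 g2 ⊢
    have m1 : 0 ≤ max (B - k) 0 - max (A - k) 0 := sub_nonneg.2 (max_le_max_right _ (by linarith))
    have m2 : 0 ≤ max (k - A) 0 - max (k - B) 0 := sub_nonneg.2 (max_le_max_right _ (by linarith))
    have m3 : max (B - k) 0 - max (A - k) 0 + (max (k - A) 0 - max (k - B) 0) = B - A := by
      have : ∀ x : ℝ, max (x - k) 0 - max (k - x) 0 = x - k := by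
        intro x
        rcases le_total x k with h | h
        · rw [max_eq_right (by linarith), max_eq_left (by linarith)]; ring
        · rw [max_eq_left (by linarith), max_eq_right (by linarith)]; ring
      linarith [this A, this B]
    calc (b - a) * c ≤ (B - A) * c := by gcongr
      _ = (max (B - k) 0 - max (A - k) 0) * c + (max (k - A) 0 - max (k - B) 0) * c := by rw [← m3]; ring
      _ ≤ (max (B - k) 0 - max (A - k) 0) * (φ (V s (k + 1)) - φ (V s k)) +
          (max (k - A) 0 - max (k - B) 0) * (φ (V s k) - φ (V s (k - 1))) := by gcongr
      _ = _ := by ring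

theorem smoothingEquiv_of_linear {n : ℕ} (hn : 2 ≤ n) {v w : ℤ → Plane}
    (hv : ∀ i, v (i + n) = v i) (hw : ∀ i, w (i + n) = w i)
    (h : ∀ s ∈ Icc (0:ℝ) 1, IsSimple n fun i => v i + s • (w i - v i)) :
    SmoothingEquiv (poly n v) (poly n w) := by
  have := (tameFamily_poly hn (V := fun s i => v i + s • (w i - v i)) (fun i => by fun_prop)
    (fun s i => by rw [hv, hw]) h).smoothingEquiv
  simpa using this

theorem IsSimple.smoothingEquiv_reparam {n m : ℕ} (hn : 2 ≤ n) (hm : 2 ≤ m) {v v' : ℤ → Plane}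
    (h : IsSimple m v) (hv' : ∀ i, v' (i + n) = v' i) {w : ℤ → ℝ} (hw : ∀ i, w (i + m) = w i + n)
    (hstep : ∀ i, 1 / 2 ≤ w (i + 1) - w i) (heq : ∀ x, interp v x = interp v' (interp w x)) :
    IsSimple n v' ∧ SmoothingEquiv (poly m v) (poly n v') := by
  have hn0 : (0:ℝ) < n := by exact_mod_cast (by omega : 0 < n)
  have hm0 : (0:ℝ) < m := by exact_mod_cast (by omega : 0 < m)
  have hmono := fun a b (hab : a ≤ b) => interp_sub_ge hstep hab
  have hadd : ∀ x, interp w (x + m) = interp w x + n := by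
    intro x
    have h1 : interp w (x + (m:ℤ)) = interp w x + n := by
      rw [← interp_shift]
      simp only [interp, hw, smul_eq_mul]
      ring
    simpa using h1
  have haddk : ∀ x, ∀ k : ℤ, interp w (x + k * m) = interp w x + k * n := by
    intro x k
    have := periodic_add_int (c := fun t => interp w (m * t) - n * t) (fun t => by
      rw [mul_add, mul_one, hadd]; ring) (x / m) k
    rw [mul_add, mul_div_cancel₀ _ hm0.ne'] at this
    rw [mul_comm (k:ℝ) (m:ℝ)]
    linarith
  have hsurj : Function.Surjective (interp w) := by
    refine (continuous_interp w).surjective ?_ ?_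
    · refine tendsto_atTop_mono' _ (f₁ := fun x => interp w 0 + 1 / 2 * x) ?_ ?_
      · filter_upwards [eventually_ge_atTop 0] with x hx
        linarith [hmono 0 x hx]
      · exact tendsto_atTop_add_const_left _ _ (tendsto_id.const_mul_atTop (by norm_num))
    · refine tendsto_atBot_mono' _ (f₁ := fun x => interp w 0 + 1 / 2 * x) ?_ ?_
      · filter_upwards [eventually_le_atBot 0] with x hx
        linarith [hmono x 0 hx]
      · exact tendsto_atBot_add_const_left _ _ (tendsto_id.const_mul_atBot (by norm_num))
  have hsimple : IsSimple n v' := by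
    refine ⟨hv', fun x y hxy => ?_⟩
    obtain ⟨x, rfl⟩ := hsurj x
    obtain ⟨y, rfl⟩ := hsurj y
    rw [← heq, ← heq] at hxy
    obtain ⟨k, rfl⟩ := h.2 _ _ hxy
    exact ⟨k, haddk y k⟩
  refine ⟨hsimple, ?_⟩
  have htame : TameFamily fun _ => poly n v' :=
    tameFamily_poly hn (V := fun _ => v') (fun i => continuous_const) (fun _ => hv') fun _ _ => hsimple
  have := htame.smoothingEquiv_comp (ψ := fun t => interp w (m * t) / n)
    (((continuous_interp w).comp (by fun_prop)).div_const _)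
    (fun t => by rw [mul_add, mul_one, hadd]; field_simp) (κ := m / (2 * n)) (by positivity)
    (fun a b hab => by
      have := hmono (m * a) (m * b) (by gcongr)
      rw [← sub_div, le_div_iff₀ hn0]
      calc _ = 1 / 2 * (m * b - m * a) := by field_simp
        _ ≤ _ := this)
  refine SmoothingEquiv.symm ?_
  convert this using 2 with t
  rw [poly, poly, heq]
  congr 1
  field_simp

theorem IsSimple.eq_or {n : ℕ} {v : ℤ → Plane} (h : IsSimple n v) (hn : 0 < n) {x y : ℝ}
    (hxy : x ≤ y) (hyx : y ≤ x + n) (e : interp v x = interp v y) : y = x ∨ y = x + n := by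
  obtain ⟨k, rfl⟩ := h.2 y x e.symm
  have hn' : (0:ℝ) < n := by exact_mod_cast hn
  have h0 : (0:ℝ) ≤ k := by
    by_contra! hk
    nlinarith
  have h1 : (k:ℝ) ≤ 1 := by
    by_contra! hk
    nlinarith
  have h0' : 0 ≤ k := by exact_mod_cast h0
  have h1' : k ≤ 1 := by exact_mod_cast h1
  obtain rfl | rfl : k = 0 ∨ k = 1 := by omega
  · left; simp
  · right; simp

theorem periodic_add_mul {E : Type*} {n : ℕ} {v : ℤ → E} (hv : ∀ i, v (i + n) = v i) (i k : ℤ) :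
    v (i + k * n) = v i := by
  have : Function.Periodic v n := hv
  simpa using this.int_mul k i

theorem interp_add_mul {n : ℕ} {v : ℤ → Plane} (hv : ∀ i, v (i + n) = v i) (x : ℝ) (k : ℤ) :
    interp v (x + k * n) = interp v x := by
  have : Function.Periodic (interp v) (n:ℝ) := interp_periodic hv
  simpa using this.int_mul k x

theorem isSimple_of_path {n : ℕ} (hn : 3 ≤ n) {w : ℤ → Plane} (hw : ∀ i, w (i + n) = w i)
    (h1 : ∀ x ∈ Icc (1:ℝ) (n - 1), ∀ y ∈ Icc (1:ℝ) (n - 1), interp w x = interp w y → x = y)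
    (h2 : ∀ x ∈ Ioo (-1:ℝ) 1, ∀ y ∈ Icc (1:ℝ) (n - 1), interp w x ≠ interp w y)
    (h3 : ∀ x ∈ Ioo (-1:ℝ) 1, ∀ y ∈ Ioo (-1:ℝ) 1, interp w x = interp w y → x = y) :
    IsSimple n w := by
  have hn' : (0:ℝ) < n := by exact_mod_cast (by omega : 0 < n)
  have key : ∀ x ∈ Ioc (-1:ℝ) (-1 + n), ∀ y ∈ Ioc (-1:ℝ) (-1 + n), interp w x = interp w y → x = y := by
    intro x hx y hy e
    rcases lt_or_ge x 1 with hx1 | hx1 <;> rcases lt_or_ge y 1 with hy1 | hy1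
    · exact h3 x ⟨hx.1, hx1⟩ y ⟨hy.1, hy1⟩ e
    · exact absurd e (h2 x ⟨hx.1, hx1⟩ y ⟨hy1, by linarith [hy.2]⟩)
    · exact absurd e.symm (h2 y ⟨hy.1, hy1⟩ x ⟨hx1, by linarith [hx.2]⟩)
    · exact h1 x ⟨hx1, by linarith [hx.2]⟩ y ⟨hy1, by linarith [hy.2]⟩ e
  refine ⟨hw, fun x y e => ?_⟩
  obtain ⟨k, hk, -⟩ := existsUnique_sub_zsmul_mem_Ioc hn' x (-1)
  obtain ⟨l, hl, -⟩ := existsUnique_sub_zsmul_mem_Ioc hn' y (-1)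
  rw [zsmul_eq_mul] at hk hl
  have := key _ hk _ hl (by
    rw [← interp_add_mul hw _ k, ← interp_add_mul hw (y - l * n) l, sub_add_cancel, sub_add_cancel, e])
  exact ⟨k - l, by push_cast; linarith⟩

/-- Replace the vertices of index divisible by `n`. -/
def setVertex (n : ℕ) (v : ℤ → Plane) (b : Plane) (i : ℤ) : Plane := if (n:ℤ) ∣ i then b else v i

theorem setVertex_zero (n : ℕ) (v : ℤ → Plane) (b : Plane) : setVertex n v b 0 = b := by
  simp [setVertex]

theorem setVertex_periodic {n : ℕ} {v : ℤ → Plane} (hv : ∀ i, v (i + n) = v i) (b : Plane) (i : ℤ) :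
    setVertex n v b (i + n) = setVertex n v b i := by
  simp [setVertex, hv]

theorem setVertex_of_mem {n : ℕ} (v : ℤ → Plane) (b : Plane) {i : ℤ} (h0 : 0 < i) (h1 : i < n) :
    setVertex n v b i = v i := by
  rw [setVertex, if_neg fun h => absurd (Int.le_of_dvd h0 h) (by omega)]

theorem setVertex_neg_one {n : ℕ} (hn : 2 ≤ n) (v : ℤ → Plane) (b : Plane) :
    setVertex n v b (-1) = v (-1) := by
  rw [setVertex, if_neg fun h => absurd (Int.le_of_dvd one_pos ((dvd_neg).1 h)) (by omega)]

theorem interp_setVertex {n : ℕ} (v : ℤ → Plane) (b : Plane) {y : ℝ}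
    (hy : y ∈ Icc (1:ℝ) (n - 1)) : interp (setVertex n v b) y = interp v y := by
  rcases hy.2.lt_or_eq with h | h
  · have h1 : 1 ≤ ⌊y⌋ := Int.le_floor.2 (by exact_mod_cast hy.1)
    have h2 : ⌊y⌋ < n - 1 := Int.floor_lt.2 (by push_cast; exact h)
    rw [interp, interp, setVertex_of_mem _ _ (by omega) (by omega),
      setVertex_of_mem _ _ (by omega) (by omega)]
  · have h0 : ((n - 1 : ℤ) : ℝ) = y := by push_cast; exact h.symm
    have h1 : (1:ℤ) ≤ n - 1 := by exact_mod_cast (h0 ▸ hy.1 : (1:ℝ) ≤ ((n - 1 : ℤ) : ℝ))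
    rw [← h0, interp_int, interp_int, setVertex_of_mem _ _ (by omega) (by omega)]

theorem interp_neg_part (w : ℤ → Plane) {x : ℝ} (h1 : -1 ≤ x) (h2 : x ≤ 0) :
    interp w x = w (-1) + (x + 1) • (w 0 - w (-1)) := by
  rw [interp_eq w (k := -1) (by simpa using h1) (by push_cast; linarith), show (-1:ℤ) + 1 = 0 by ring]
  push_cast
  module

theorem interp_pos_part (w : ℤ → Plane) {x : ℝ} (h1 : 0 ≤ x) (h2 : x ≤ 1) :
    interp w x = w 1 + (1 - x) • (w 0 - w 1) := by
  rw [interp_eq w (k := 0) (by simpa using h1) (by push_cast; linarith), show (0:ℤ) + 1 = 1 by ring]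
  push_cast
  module

theorem IsSimple.slide {n : ℕ} (hn : 3 ≤ n) {v : ℤ → Plane} (h : IsSimple n v) {b : Plane}
    {φ : Plane →L[ℝ] ℝ} (hφ1 : φ (v (-1)) < φ (v 0)) (hφ2 : φ (v 0) < φ (v 1))
    (hφ3 : φ (v (-1)) < φ b) (hφ4 : φ b < φ (v 1))
    (hK : ∀ s ∈ Icc (0:ℝ) 1, ∀ τ ∈ Ioc (0:ℝ) 1, ∀ y ∈ Icc (1:ℝ) (n - 1),
      interp v y ≠ v (-1) + τ • (v 0 + s • (b - v 0) - v (-1)) ∧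
      interp v y ≠ v 1 + τ • (v 0 + s • (b - v 0) - v 1)) :
    IsSimple n (setVertex n v b) ∧ SmoothingEquiv (poly n v) (poly n (setVertex n v b)) := by
  have hs : ∀ s ∈ Icc (0:ℝ) 1, IsSimple n (setVertex n v (v 0 + s • (b - v 0))) := by
    intro s hs
    set q := v 0 + s • (b - v 0) with hq
    have hφq : φ q = (1 - s) * φ (v 0) + s * φ b := by
      rw [hq, map_add, map_smul, map_sub, smul_eq_mul]; ring
    have hq1 : φ (v (-1)) < φ q := by
      rw [hφq]
      rcases hs.1.eq_or_lt with h0 | h0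
      · rw [← h0]; linarith
      · nlinarith [hs.2]
    have hq2 : φ q < φ (v 1) := by
      rw [hφq]
      rcases hs.1.eq_or_lt with h0 | h0
      · rw [← h0]; linarith
      · nlinarith [hs.2]
    have hmon : StrictMonoOn (fun x => φ (interp (setVertex n v q) x)) (Icc (-1) 1) := by
      have e1 : StrictMonoOn (fun x => φ (interp (setVertex n v q) x)) (Icc (-1) 0) := by
        intro x hx y hy hxy
        simp only [interp_neg_part _ hx.1 hx.2, interp_neg_part _ hy.1 hy.2, setVertex_zero,
          setVertex_neg_one (by omega : 2 ≤ n), map_add, map_smul, map_sub, smul_eq_mul]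
        nlinarith
      have e2 : StrictMonoOn (fun x => φ (interp (setVertex n v q) x)) (Icc 0 1) := by
        intro x hx y hy hxy
        simp only [interp_pos_part _ hx.1 hx.2, interp_pos_part _ hy.1 hy.2, setVertex_zero,
          setVertex_of_mem v q one_pos (by omega : (1:ℤ) < n), map_add, map_smul, map_sub, smul_eq_mul]
        nlinarith
      have := e1.union e2 (c := 0) (isGreatest_Icc (by norm_num)) (isLeast_Icc (by norm_num))
      rwa [Icc_union_Icc_eq_Icc (by norm_num) (by norm_num)] at this
    refine isSimple_of_path hn (setVertex_periodic h.1 _) (fun x hx y hy e => ?_)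
      (fun x hx y hy e => ?_) (fun x hx y hy e => ?_)
    · rw [interp_setVertex _ _ hx, interp_setVertex _ _ hy] at e
      have hn' : (3:ℝ) ≤ n := by exact_mod_cast hn
      rcases le_total x y with hxy | hxy
      · rcases h.eq_or (by omega) hxy (by linarith [hx.1, hy.2]) e with h' | h'
        · exact h'.symm
        · linarith [hx.1, hy.2]
      · rcases h.eq_or (by omega) hxy (by linarith [hy.1, hx.2]) e.symm with h' | h'
        · exact h'
        · linarith [hy.1, hx.2]
    · rw [interp_setVertex _ _ hy] at e
      rcases le_total x 0 with h0 | h0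
      · rw [interp_neg_part _ hx.1.le h0, setVertex_zero, setVertex_neg_one (by omega)] at e
        exact (hK s hs (x + 1) ⟨by linarith [hx.1], by linarith⟩ y hy).1 e.symm
      · rw [interp_pos_part _ h0 hx.2.le, setVertex_zero,
          setVertex_of_mem v q one_pos (by omega : (1:ℤ) < n)] at e
        exact (hK s hs (1 - x) ⟨by linarith [hx.2], by linarith⟩ y hy).2 e.symm
    · exact hmon.injOn ⟨hx.1.le, hx.2.le⟩ ⟨hy.1.le, hy.2.le⟩ (congrArg φ e)
  have e : ∀ s : ℝ, (fun i => v i + s • (setVertex n v b i - v i)) =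
      setVertex n v (v 0 + s • (b - v 0)) := by
    intro s
    ext1 i
    by_cases hi : (n:ℤ) ∣ i
    · obtain ⟨k, rfl⟩ := hi
      have : v (n * k) = v 0 := by
        have := periodic_add_mul h.1 0 k
        rwa [zero_add, mul_comm] at this
      simp [setVertex, this]
    · simp [setVertex, hi]
  refine ⟨?_, smoothingEquiv_of_linear (by omega) h.1 (setVertex_periodic h.1 b) fun s hs' => ?_⟩
  · simpa using hs 1 ⟨by norm_num, le_rfl⟩
  · rw [e]; exact hs s hs'

/-- A vertex which is the midpoint of its neighbours can be removed. -/
theorem IsSimple.remove {n : ℕ} (hn : 3 ≤ n) {v v' : ℤ → Plane} (h : IsSimple (n + 1) v)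
    (hmid : v n = (1 / 2 : ℝ) • (v (n - 1) + v 0)) (hv' : ∀ i, v' (i + n) = v' i)
    (hvv : ∀ i : ℤ, 0 ≤ i → i < n → v' i = v i) :
    IsSimple n v' ∧ SmoothingEquiv (poly (n + 1) v) (poly n v') := by
  set w : ℤ → ℝ := fun i => if i % (n + 1) = n then n * (i / (n + 1) : ℤ) + (n - 1 / 2) else
    n * (i / (n + 1) : ℤ) + (i % (n + 1) : ℤ) with hw
  have hn1 : ((n:ℤ) + 1) ≠ 0 := by omega
  have hwper : ∀ i, w (i + (n + 1 : ℕ)) = w i + n := by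
    intro i
    simp only [hw]
    push_cast
    rw [Int.add_emod_right, Int.add_ediv_of_dvd_right dvd_rfl, Int.ediv_self hn1]
    push_cast
    split_ifs <;> ring
  have hw0 : ∀ i : ℤ, 0 ≤ i → i < n → w i = i := by
    intro i h0 h1
    simp only [hw]
    rw [Int.emod_eq_of_lt h0 (by omega), Int.ediv_eq_zero_of_lt h0 (by omega), if_neg (by omega)]
    simp
  have hwn : w n = n - 1 / 2 := by
    simp only [hw]
    rw [Int.emod_eq_of_lt (by omega) (by omega), Int.ediv_eq_zero_of_lt (by omega) (by omega), if_pos rfl]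
    simp
  have hwn1 : w (n + 1) = n := by
    have := hwper 0
    rw [hw0 0 le_rfl (by omega)] at this
    simpa using this
  have hperiod : ∀ i k : ℤ, w (i + k * (n + 1)) = w i + k * n := by
    intro i k
    have : Function.Periodic (fun i : ℤ => w i - n * ((i:ℝ) / (n + 1))) ((n:ℤ) + 1) := by
      intro i
      have := hwper i
      push_cast at this ⊢
      rw [this]
      field_simp
      ring
    have := this.int_mul k i
    push_cast at this
    have e : (n:ℝ) * ((i + k * (n + 1)) / (n + 1)) = n * (i / (n + 1)) + k * n := by field_simp
    rw [e] at this
    linarith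
  have hred : ∀ i : ℤ, ∃ r k : ℤ, 0 ≤ r ∧ r ≤ n ∧ i = r + k * (n + 1) := fun i =>
    ⟨i % (n + 1), i / (n + 1), Int.emod_nonneg _ hn1, by
      have := Int.emod_lt_of_pos i (by omega : (0:ℤ) < n + 1); omega, by
      rw [mul_comm]; exact (Int.emod_add_mul_ediv i _).symm⟩
  refine h.smoothingEquiv_reparam (by omega) (by omega) hv' (w := w) hwper (fun i => ?_) fun x => ?_
  · obtain ⟨r, k, h0, h1, rfl⟩ := hred i
    rw [show r + k * ((n:ℤ) + 1) + 1 = r + 1 + k * (n + 1) by ring, hperiod, hperiod]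
    rcases h1.eq_or_lt with rfl | h1
    · rw [hwn, hwn1]; linarith
    · rcases (show r + 1 ≤ n by omega).eq_or_lt with h2 | h2
      · rw [h2, hwn, hw0 r h0 h1]
        have : (r:ℝ) + 1 = n := by exact_mod_cast h2
        linarith
      · rw [hw0 r h0 h1, hw0 (r + 1) (by omega) h2]
        push_cast; linarith
  · have hsh : ∀ (k : ℤ) x, interp w (x + k * (n + 1)) = interp w x + k * n := by
      intro k x
      have h1 : interp w (x + ((k * (n + 1) : ℤ) : ℝ)) = interp w x + k * n := by
        rw [← interp_shift]
        simp only [interp, hperiod, smul_eq_mul]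
        ring
      push_cast at h1
      exact h1
    have hn' : (0:ℝ) < n + 1 := by positivity
    obtain ⟨k, hk, -⟩ := existsUnique_sub_zsmul_mem_Ico hn' x 0
    rw [zsmul_eq_mul, zero_add] at hk
    obtain ⟨y, rfl⟩ : ∃ y, x = y + k * (n + 1) := ⟨x - k * (n + 1), by ring⟩
    rw [add_sub_cancel_right] at hk
    have := interp_add_mul h.1 y k
    push_cast at this
    rw [this, hsh, interp_add_mul hv']
    have hv'n : v' n = v 0 := by
      have := hv' 0
      rw [zero_add] at this
      rw [this, hvv 0 le_rfl (by omega)]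
    have hvn1 : v (n + 1) = v 0 := by
      have := h.1 0
      push_cast at this
      rwa [zero_add] at this
    have hl : (⌊y⌋:ℝ) ≤ y := Int.floor_le y
    have hu : y ≤ ⌊y⌋ + 1 := (Int.lt_floor_add_one y).le
    have h0 : 0 ≤ ⌊y⌋ := Int.floor_nonneg.2 hk.1
    have h1 : ⌊y⌋ < n + 1 := Int.floor_lt.2 (by exact_mod_cast hk.2)
    generalize ⌊y⌋ = r at *
    rw [interp_eq v hl hu, interp_eq w hl hu]
    rcases lt_trichotomy (r + 1) n with h2 | h2 | h2
    · rw [hw0 _ h0 (by omega), hw0 _ (by omega) h2, smul_eq_mul, smul_eq_mul,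
        show (1 - (y - r)) * r + (y - r) * ((r + 1 : ℤ) : ℝ) = y by push_cast; ring, interp_eq v' hl hu,
        hvv _ h0 (by omega), hvv _ (by omega) h2]
    · have h2' : (r:ℝ) = n - 1 := by have : (r:ℝ) + 1 = n := by exact_mod_cast h2
                                     linarith
      rw [h2, hw0 _ h0 (by omega), hwn, smul_eq_mul, smul_eq_mul, interp_eq v' (k := r) (by nlinarith) (by nlinarith),
        h2, hv'n, hmid, hvv r h0 (by omega), show (n:ℤ) - 1 = r by omega, h2']
      module
    · obtain rfl : r = n := by omega
      rw [hwn, hwn1, hvn1, smul_eq_mul, smul_eq_mul, hmid]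
      push_cast at hl hu ⊢
      rw [interp_eq v' (k := n - 1) (by push_cast; nlinarith) (by push_cast; nlinarith),
        show (n:ℤ) - 1 + 1 = n by ring, hv'n, hvv _ (by omega) (by omega)]
      push_cast
      module

/-- The vertex `v i` is strictly higher than its neighbours. -/
def LocMax (v : ℤ → Plane) (i : ℤ) : Prop := (v (i - 1)).2 < (v i).2 ∧ (v (i + 1)).2 < (v i).2

theorem locMax_of_eventually {v : ℤ → Plane} (hadj : ∀ i, (v i).2 ≠ (v (i + 1)).2) {x : ℝ}
    (hx : ∀ᶠ y in 𝓝 x, (interp v y).2 ≤ (interp v x).2) : ∃ k : ℤ, x = k ∧ LocMax v k := by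
  have hl : (⌊x⌋:ℝ) ≤ x := Int.floor_le x
  have hu : x < ⌊x⌋ + 1 := Int.lt_floor_add_one x
  generalize ⌊x⌋ = k at *
  have h1 := hadj k
  have h2 := hadj (k - 1)
  rw [sub_add_cancel] at h2
  obtain ⟨δ, hδ, hb⟩ := Metric.eventually_nhds_iff.1 hx
  simp only [Real.dist_eq] at hb
  rcases hl.eq_or_lt with h | h
  · refine ⟨k, h.symm, ?_⟩
    rw [← h, interp_int] at hb
    set t := min δ 1 / 2 with ht
    have ht0 : 0 < t := by positivity
    have htδ : t < δ := by linarith [min_le_left δ 1]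
    have ht1 : t < 1 := by linarith [min_le_right δ 1]
    have b1 := hb (y := k + t) (by rw [add_sub_cancel_left, abs_of_pos ht0]; exact htδ)
    have b2 := hb (y := k - t) (by rw [sub_sub_cancel_left, abs_neg, abs_of_pos ht0]; exact htδ)
    rw [interp_eq_max v (k := k) (by linarith) (by linarith), add_sub_cancel_left, max_eq_left ht0.le,
      max_eq_right (by linarith)] at b1
    rw [interp_eq_max v (k := k) (by linarith) (by linarith), sub_sub_cancel, max_eq_right (by linarith),
      max_eq_left ht0.le] at b2
    simp only [zero_smul, sub_zero, add_zero, Prod.snd_add, Prod.smul_snd, Prod.snd_sub,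
      smul_eq_mul] at b1 b2
    refine ⟨lt_of_le_of_ne ?_ h2, lt_of_le_of_ne ?_ h1.symm⟩
    · by_contra! h'
      nlinarith
    · by_contra! h'
      nlinarith
  · exfalso
    set t := min δ (min (x - k) (k + 1 - x)) / 2 with ht
    have ht0 : 0 < t := by
      have : 0 < x - k := by linarith
      have : 0 < k + 1 - x := by linarith
      positivity
    have htδ : t < δ := by linarith [min_le_left δ (min (x - k) (k + 1 - x))]
    have ht1 : t < x - k := by
      linarith [min_le_right δ (min (x - k) (k + 1 - x)), min_le_left (x - k) (k + 1 - x)]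
    have ht2 : t < k + 1 - x := by
      linarith [min_le_right δ (min (x - k) (k + 1 - x)), min_le_right (x - k) (k + 1 - x)]
    have b1 := hb (y := x + t) (by rw [add_sub_cancel_left, abs_of_pos ht0]; exact htδ)
    have b2 := hb (y := x - t) (by rw [sub_sub_cancel_left, abs_neg, abs_of_pos ht0]; exact htδ)
    rw [interp_eq v (x := x + t) (k := k) (by linarith) (by linarith), interp_eq v hl hu.le] at b1
    rw [interp_eq v (x := x - t) (k := k) (by linarith) (by linarith), interp_eq v hl hu.le] at b2
    simp only [Prod.snd_add, Prod.smul_snd, smul_eq_mul] at b1 b2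
    rcases h1.lt_or_gt with h' | h' <;> nlinarith

theorem path_avoids_region {v : ℤ → Plane} (hadj : ∀ i, (v i).2 ≠ (v (i + 1)).2) {α β : ℤ}
    {L G : Plane → ℝ} (hL : Continuous L) (hG : Continuous G) {m M : ℝ} {Q : ℝ → Prop}
    (hQ : ∀ x, Q x → (interp v x).2 = m)
    (hbd : ∀ x ∈ Icc (α:ℝ) β, 0 ≤ L (interp v x) → 0 ≤ G (interp v x) → m ≤ (interp v x).2 →
      (interp v x).2 ≤ M → (L (interp v x) = 0 ∨ G (interp v x) = 0 ∨ (interp v x).2 = M ∨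
        x = α ∨ x = β) → Q x)
    (hmax : ∀ k : ℤ, α < k → k < β → LocMax v k → M ≤ (v k).2) :
    ∀ x ∈ Icc (α:ℝ) β, 0 ≤ L (interp v x) → 0 ≤ G (interp v x) → m ≤ (interp v x).2 →
      (interp v x).2 ≤ M → Q x := by
  by_contra! hcon
  obtain ⟨x₀, hx₀, hL₀, hG₀, hm₀, hM₀, hQ₀⟩ := hcon
  have hc : Continuous (interp v) := by
    have := continuous_interp_family (V := fun _ => v) fun i => continuous_const
    exact this.comp (f := fun x : ℝ => ((0:ℝ), x)) (by fun_prop)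
  set S : Set ℝ := {x | x ∈ Icc (α:ℝ) β ∧ 0 ≤ L (interp v x) ∧ 0 ≤ G (interp v x) ∧
    m ≤ (interp v x).2 ∧ (interp v x).2 ≤ M} with hS
  have hcl : IsClosed {x | 0 ≤ L (interp v x) ∧ 0 ≤ G (interp v x) ∧
      m ≤ (interp v x).2 ∧ (interp v x).2 ≤ M} :=
    (isClosed_le continuous_const (hL.comp hc)).inter ((isClosed_le continuous_const (hG.comp hc)).inter
      ((isClosed_le continuous_const (continuous_snd.comp hc)).inter
        (isClosed_le (continuous_snd.comp hc) continuous_const)))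
  have hcomp : IsCompact S := isCompact_Icc.inter_right hcl
  obtain ⟨x, hxS, hxmax, hxQ⟩ : ∃ x ∈ S, (∀ y ∈ S, (interp v y).2 ≤ (interp v x).2) ∧ ¬ Q x := by
    obtain ⟨x, hxS, hx⟩ := hcomp.exists_isMaxOn ⟨x₀, hx₀, hL₀, hG₀, hm₀, hM₀⟩
      (continuous_snd.comp hc).continuousOn
    by_cases h : Q x
    · refine ⟨x₀, ⟨hx₀, hL₀, hG₀, hm₀, hM₀⟩, fun y hy => ?_, hQ₀⟩
      have h1 : (interp v y).2 ≤ (interp v x).2 := hx hy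
      rw [hQ x h] at h1
      linarith
    · exact ⟨x, hxS, fun y hy => hx hy, h⟩
  obtain ⟨hx, hLx, hGx, hmx, hMx⟩ := hxS
  have hne : ¬ (L (interp v x) = 0 ∨ G (interp v x) = 0 ∨ (interp v x).2 = M ∨ x = α ∨ x = β) :=
    fun h => hxQ (hbd x hx hLx hGx hmx hMx h)
  push Not at hne
  obtain ⟨n1, n2, n3, n4, n5⟩ := hne
  have e1 := (hL.comp hc).continuousAt.eventually (lt_mem_nhds (lt_of_le_of_ne hLx n1.symm))
  have e2 := (hG.comp hc).continuousAt.eventually (lt_mem_nhds (lt_of_le_of_ne hGx n2.symm))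
  have e3 := (continuous_snd.comp hc).continuousAt.eventually (gt_mem_nhds (lt_of_le_of_ne hMx n3))
  have hα : (α:ℝ) < x := lt_of_le_of_ne hx.1 n4.symm
  have hβ : x < β := lt_of_le_of_ne hx.2 n5
  have e4 : ∀ᶠ y in 𝓝 x, y ∈ Ioo (α:ℝ) β := Ioo_mem_nhds hα hβ
  obtain ⟨k, rfl, hk⟩ := locMax_of_eventually hadj (x := x) (by
    filter_upwards [e1, e2, e3, e4] with y h1 h2 h3 h4
    rcases lt_or_ge (interp v y).2 m with h | h
    · linarith
    · exact hxmax y ⟨⟨h4.1.le, h4.2.le⟩, h1.le, h2.le, h, h3.le⟩)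
  have := hmax k (by exact_mod_cast hα) (by exact_mod_cast hβ) hk
  rw [interp_int] at n3 hMx
  exact n3 (le_antisymm hMx this)

/-- Positive when `z` lies to the right of the line from `p` up to `q`. -/
def rt (p q z : Plane) : ℝ := cross (z - p) (q - p)

theorem continuous_rt (p q : Plane) : Continuous (rt p q) := by
  unfold rt cross
  fun_prop

theorem rt_lerp (p q x y : Plane) (t : ℝ) :
    rt p q (x + t • (y - x)) = (1 - t) * rt p q x + t * rt p q y := by
  simp only [rt, cross, Prod.fst_add, Prod.fst_sub, Prod.smul_fst, Prod.snd_add, Prod.snd_sub,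
    Prod.smul_snd, smul_eq_mul]
  ring

theorem rt_left (p q : Plane) : rt p q p = 0 := by simp [rt, cross]

theorem rt_right (p q : Plane) : rt p q q = 0 := by simp only [rt, cross]; ring

theorem rt_swap (a b c : Plane) : rt a b c = -rt c b a := by
  simp only [rt, cross, Prod.fst_sub, Prod.snd_sub]; ring

theorem rt_of_snd_eq {p q z w : Plane} (hz : rt p q w = 0) (h : z.2 = w.2) :
    rt p q z = (z.1 - w.1) * (q.2 - p.2) := by
  simp only [rt, cross, Prod.fst_sub, Prod.snd_sub, h] at *
  linear_combination hz

theorem snd_lerp (x y : Plane) (t : ℝ) : (x + t • (y - x)).2 = (1 - t) * x.2 + t * y.2 := by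
  simp only [Prod.snd_add, Prod.snd_sub, Prod.smul_snd, smul_eq_mul]
  ring

theorem exists_lerp_of_rt {p q z : Plane} (hpq : p.2 < q.2) (h0 : rt p q z = 0) (h1 : p.2 ≤ z.2)
    (h2 : z.2 ≤ q.2) : ∃ τ ∈ Icc (0:ℝ) 1, z = p + τ • (q - p) := by
  have h : 0 < q.2 - p.2 := by linarith
  refine ⟨(z.2 - p.2) / (q.2 - p.2), ⟨div_nonneg (by linarith) h.le, (div_le_one h).2 (by linarith)⟩, ?_⟩
  simp only [rt, cross, Prod.fst_sub, Prod.snd_sub] at h0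
  ext
  · simp only [Prod.fst_add, Prod.fst_sub, Prod.smul_fst, smul_eq_mul]
    rw [← sub_eq_iff_eq_add', div_mul_eq_mul_div, eq_div_iff h.ne']
    linear_combination h0
  · simp only [Prod.snd_add, Prod.snd_sub, Prod.smul_snd, smul_eq_mul]
    field_simp
    ring

/-- The lowest local maximum is `v 0`, its higher neighbour is `v (-1)`, lying on the left of the
edge from `v 1` to `v 0`. -/
structure LowestMax (n : ℕ) (v : ℤ → Plane) : Prop where
  four_le : 4 ≤ n
  simple : IsSimple n v
  adj : ∀ i, (v i).2 ≠ (v (i + 1)).2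
  lt_top : (v (-1)).2 < (v 0).2
  lt_left : (v 1).2 < (v (-1)).2
  lowest : ∀ k, LocMax v k → (v 0).2 ≤ (v k).2
  left : rt (v 1) (v 0) (v (-1)) < 0

theorem IsSimple.exists_clm {n : ℕ} {v : ℤ → Plane} (h : IsSimple n v) (hn : 2 ≤ n) :
    ∃ φ : Plane →L[ℝ] ℝ, φ (v (-1)) < φ (v 0) ∧ φ (v 0) < φ (v 1) := by
  have hp := h.sub_ne_zero hn (-1)
  have hq := h.sub_ne_zero hn 0
  have ho := fun c (hc : 0 < c) => h.not_opposite hn 0 (c := c) hc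
  simp only [neg_add_cancel, zero_add, zero_sub] at hp hq ho
  obtain ⟨φ, h1, h2⟩ := exists_clm_pos hp hq ho
  rw [map_sub, sub_pos] at h1 h2
  exact ⟨φ, h1, h2⟩

theorem lerp_of_rt_eq {a b c : Plane} {σ : ℝ} (h : a = c + σ • (b - c)) : rt c b a = 0 := by
  rw [h, rt_lerp, rt_left, rt_right]; ring

namespace LowestMax
variable {n : ℕ} {v : ℤ → Plane} (H : LowestMax n v)
include H

theorem le_cast : (4:ℝ) ≤ n := by exact_mod_cast H.four_le

theorem edge_left {y τ : ℝ} (hy : y ∈ Icc (1:ℝ) (n - 1)) (hτ : τ ∈ Icc (0:ℝ) 1)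
    (e : interp v y = v (-1) + τ • (v 0 - v (-1))) : y = n - 1 ∧ τ = 0 := by
  have hx := interp_neg_part v (x := τ - 1) (by linarith [hτ.1]) (by linarith [hτ.2])
  rw [sub_add_cancel, ← e] at hx
  have hn := H.le_cast
  rcases H.simple.eq_or (by have := H.four_le; omega) (by linarith [hy.1, hτ.2])
    (by linarith [hy.2, hτ.1]) hx with h | h
  · linarith [hy.1, hτ.2]
  · constructor <;> linarith [hy.2, hτ.1]

theorem edge_right {y τ : ℝ} (hy : y ∈ Icc (1:ℝ) (n - 1)) (hτ : τ ∈ Icc (0:ℝ) 1)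
    (e : interp v y = v 1 + τ • (v 0 - v 1)) : y = 1 ∧ τ = 0 := by
  have hx := interp_pos_part v (x := 1 - τ) (by linarith [hτ.2]) (by linarith [hτ.1])
  rw [sub_sub_cancel, ← e] at hx
  have hn := H.le_cast
  rcases H.simple.eq_or (by have := H.four_le; omega) (by linarith [hy.1, hτ.1])
    (by linarith [hy.2, hτ.2]) hx with h | h
  · constructor <;> linarith [hy.1, hτ.1]
  · linarith [hy.2, hτ.2]

omit H in
theorem interp_far_part (v : ℤ → Plane) {τ : ℝ} (hτ : τ ∈ Icc (0:ℝ) 1) :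
    interp v (τ - 2) = v (-2) + τ • (v (-1) - v (-2)) := by
  rw [interp_eq v (k := -2) (by push_cast; linarith [hτ.1]) (by push_cast; linarith [hτ.2]),
    show (-2:ℤ) + 1 = -1 by ring]
  push_cast
  module

theorem edge_far {y τ : ℝ} (hy : y ∈ Icc (1:ℝ) (n - 2)) (hτ : τ ∈ Icc (0:ℝ) 1)
    (e : interp v y = v (-2) + τ • (v (-1) - v (-2))) : y = n - 2 ∧ τ = 0 := by
  have hx := interp_far_part v hτ
  rw [← e] at hx
  have hn := H.le_cast
  rcases H.simple.eq_or (by have := H.four_le; omega) (by linarith [hy.1, hτ.2])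
    (by linarith [hy.2, hτ.1]) hx with h | h
  · linarith [hy.1, hτ.2]
  · constructor <;> linarith [hy.2, hτ.1]

theorem edges_disjoint {τ τ' : ℝ} (hτ : τ ∈ Icc (0:ℝ) 1) (hτ' : τ' ∈ Icc (0:ℝ) 1) :
    v 1 + τ • (v 0 - v 1) ≠ v (-2) + τ' • (v (-1) - v (-2)) := by
  intro e
  have hx := interp_pos_part v (x := 1 - τ) (by linarith [hτ.2]) (by linarith [hτ.1])
  rw [sub_sub_cancel, e, ← interp_far_part v hτ'] at hx
  have hn := H.le_cast
  rcases H.simple.eq_or (by have := H.four_le; omega) (by linarith [hτ.2, hτ'.2])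
    (by linarith [hτ.1, hτ'.1]) hx.symm with h | h <;>
  linarith [hτ.1, hτ'.1, hτ.2, hτ'.2]

theorem rt_left_pos : 0 < rt (v (-1)) (v 0) (v 1) := by
  rw [rt_swap]
  linarith [H.left]

theorem interp_last : interp v (n - 1 : ℝ) = v (-1) := by
  have := interp_add_mul H.simple.1 (-1) 1
  rw [Int.cast_one, one_mul, show (-1:ℝ) + n = n - 1 by ring] at this
  rw [this]
  exact_mod_cast interp_int v (-1)

theorem interp_second_last : interp v (n - 2 : ℝ) = v (-2) := by
  have := interp_add_mul H.simple.1 (-2) 1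
  rw [Int.cast_one, one_mul, show (-2:ℝ) + n = n - 2 by ring] at this
  rw [this]
  exact_mod_cast interp_int v (-2)

theorem upper_empty {y : ℝ} (hy : y ∈ Icc (1:ℝ) (n - 1)) (h1 : 0 ≤ rt (v (-1)) (v 0) (interp v y))
    (h2 : rt (v 1) (v 0) (interp v y) ≤ 0) (h3 : (v (-1)).2 ≤ (interp v y).2)
    (h4 : (interp v y).2 ≤ (v 0).2) : y = n - 1 := by
  have hcast : ((n - 1 : ℤ) : ℝ) = n - 1 := by push_cast; ring
  have hcb : (v 1).2 < (v 0).2 := H.lt_left.trans H.lt_top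
  have := path_avoids_region H.adj (α := 1) (β := n - 1) (L := rt (v (-1)) (v 0))
    (G := fun z => -rt (v 1) (v 0) z) (continuous_rt _ _) (continuous_rt _ _).neg (m := (v (-1)).2)
    (M := (v 0).2) (Q := fun x => x = n - 1) (fun x hx => by rw [hx, H.interp_last]) ?_
    (fun k _ _ hk => H.lowest k hk)
  · exact this y (by rw [hcast, Int.cast_one]; exact hy) h1 (by linarith) h3 h4
  · rw [hcast, Int.cast_one]
    intro x hx g1 g2 g3 g4 hor
    have hleft : ∀ z, z = interp v x → rt (v (-1)) (v 0) z = 0 → x = n - 1 := by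
      rintro z rfl hz
      obtain ⟨τ, hτ, e⟩ := exists_lerp_of_rt H.lt_top hz g3 g4
      exact (H.edge_left hx hτ e).1
    have hright : rt (v 1) (v 0) (interp v x) = 0 → x = n - 1 := by
      intro hz
      obtain ⟨τ, hτ, e⟩ := exists_lerp_of_rt hcb hz (by linarith [H.lt_left]) g4
      obtain ⟨rfl, rfl⟩ := H.edge_right hx hτ e
      rw [zero_smul, add_zero] at e
      rw [e] at g3
      linarith [H.lt_left]
    rcases hor with h | h | h | h | h
    · exact hleft _ rfl h
    · exact hright (by linarith)
    · have e1 := rt_of_snd_eq (rt_right (v (-1)) (v 0)) h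
      have e2 := rt_of_snd_eq (rt_right (v 1) (v 0)) h
      have e3 : (interp v x).1 - (v 0).1 ≤ 0 ∨ 0 ≤ (interp v x).1 - (v 0).1 := le_total _ _
      apply hleft _ rfl
      rw [e1]
      rw [e1] at g1
      rw [e2] at g2
      have p1 : 0 < (v 0).2 - (v (-1)).2 := by linarith [H.lt_top]
      have p2 : 0 < (v 0).2 - (v 1).2 := by linarith
      have q1 : 0 ≤ (interp v x).1 - (v 0).1 := nonneg_of_mul_nonneg_left g1 p1
      have q2 : (interp v x).1 - (v 0).1 ≤ 0 := by
        by_contra! hc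
        have := mul_pos hc p2
        linarith
      rw [le_antisymm q2 q1, zero_mul]
    · rw [h] at g3
      have := interp_int v 1
      rw [Int.cast_one] at this
      rw [this] at g3
      linarith [H.lt_left]
    · exact h

/-- In the case where `v (-2)` is below `v (-1)`, points of the edge from `v 1` to `v 0` at heights
between those of the lower neighbours and that of `v (-1)` lie right of the edge from `v (-2)`. -/
theorem rt_far_pos (hda : (v (-2)).2 < (v (-1)).2) {τ : ℝ} (hτ : τ ∈ Icc (0:ℝ) 1)
    (h1 : (v (-2)).2 ≤ (v 1 + τ • (v 0 - v 1)).2) (h2 : (v 1 + τ • (v 0 - v 1)).2 ≤ (v (-1)).2) :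
    0 < rt (v (-2)) (v (-1)) (v 1 + τ • (v 0 - v 1)) := by
  by_contra! hle
  have hcb : 0 < (v 0).2 - (v 1).2 := by linarith [H.lt_left, H.lt_top]
  obtain ⟨lam, hlam, hlam2⟩ : ∃ lam ∈ Icc (0:ℝ) 1, (v 1 + lam • (v 0 - v 1)).2 = (v (-1)).2 := by
    refine ⟨((v (-1)).2 - (v 1).2) / ((v 0).2 - (v 1).2),
      ⟨div_nonneg (by linarith [H.lt_left]) hcb.le, (div_le_one hcb).2 (by linarith [H.lt_top])⟩, ?_⟩
    simp only [Prod.snd_add, Prod.snd_sub, Prod.smul_snd, smul_eq_mul]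
    field_simp
    ring
  have hpos : 0 < rt (v (-2)) (v (-1)) (v 1 + lam • (v 0 - v 1)) := by
    rw [rt_of_snd_eq (rt_right _ _) hlam2]
    have h3 := H.left
    rw [rt_of_snd_eq (lerp_of_rt_eq rfl) hlam2.symm] at h3
    have h4 : (v (-1)).1 - (v 1 + lam • (v 0 - v 1)).1 < 0 := by
      by_contra! hc
      have := mul_nonneg hc hcb.le
      linarith
    exact mul_pos (by linarith) (by linarith)
  have hτlam : τ ≤ lam := by
    rw [snd_lerp] at h2 hlam2
    by_contra! hc
    nlinarith
  have hcont : ContinuousOn (fun τ : ℝ => rt (v (-2)) (v (-1)) (v 1 + τ • (v 0 - v 1))) (Icc τ lam) :=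
    ((continuous_rt _ _).comp (by fun_prop)).continuousOn
  obtain ⟨κ, hκ, h0⟩ := intermediate_value_Icc hτlam hcont ⟨hle, hpos.le⟩
  simp only at h0
  have hκ01 : κ ∈ Icc (0:ℝ) 1 := ⟨hτ.1.trans hκ.1, hκ.2.trans hlam.2⟩
  obtain ⟨τ', hτ', e⟩ := exists_lerp_of_rt hda h0
    (by rw [snd_lerp] at h1 ⊢; nlinarith [hκ.1]) (by rw [← hlam2, snd_lerp, snd_lerp]; nlinarith [hκ.2])
  exact H.edges_disjoint hκ01 hτ' e

theorem lower_empty (hda : (v (-2)).2 < (v (-1)).2) {m : ℝ} (hm : m = max (v 1).2 (v (-2)).2)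
    {y : ℝ} (hy : y ∈ Icc (1:ℝ) (n - 2)) (h1 : 0 ≤ rt (v (-2)) (v (-1)) (interp v y))
    (h2 : rt (v 1) (v 0) (interp v y) ≤ 0) (h3 : m ≤ (interp v y).2)
    (h4 : (interp v y).2 ≤ (v (-1)).2) :
    (interp v y = v (-2) ∨ interp v y = v 1) ∧ (interp v y).2 = m := by
  have hcast : ((n - 2 : ℤ) : ℝ) = n - 2 := by push_cast; ring
  have hcb : (v 1).2 < (v 0).2 := H.lt_left.trans H.lt_top
  have hm1 : (v 1).2 ≤ m := hm ▸ le_max_left _ _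
  have hm2 : (v (-2)).2 ≤ m := hm ▸ le_max_right _ _
  have := path_avoids_region H.adj (α := 1) (β := n - 2) (L := rt (v (-2)) (v (-1)))
    (G := fun z => -rt (v 1) (v 0) z) (continuous_rt _ _) (continuous_rt _ _).neg (m := m)
    (M := (v (-1)).2) (Q := fun x => (interp v x = v (-2) ∨ interp v x = v 1) ∧ (interp v x).2 = m)
    (fun x hx => hx.2) ?_ (fun k _ _ hk => H.lt_top.le.trans (H.lowest k hk))
  · exact this y (by rw [hcast, Int.cast_one]; exact hy) h1 (by linarith) h3 h4
  · rw [hcast, Int.cast_one]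
    intro x hx g1 g2 g3 g4 hor
    have hleft : rt (v (-2)) (v (-1)) (interp v x) = 0 →
        (interp v x = v (-2) ∨ interp v x = v 1) ∧ (interp v x).2 = m := by
      intro hz
      obtain ⟨τ, hτ, e⟩ := exists_lerp_of_rt hda hz (by linarith) g4
      have := (H.edge_far hx hτ e).2
      rw [this, zero_smul, add_zero] at e
      exact ⟨Or.inl e, le_antisymm (by rw [e]; exact hm2) g3⟩
    have hx' : x ∈ Icc (1:ℝ) (n - 1) := ⟨hx.1, by linarith [hx.2]⟩
    rcases hor with h | h | h | h | h
    · exact hleft h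
    · obtain ⟨τ, hτ, e⟩ := exists_lerp_of_rt hcb (by linarith) (by linarith) (by linarith [H.lt_top])
      have := (H.edge_right hx' hτ e).2
      rw [this, zero_smul, add_zero] at e
      exact ⟨Or.inr e, le_antisymm (by rw [e]; exact hm1) g3⟩
    · exfalso
      have e1 := rt_of_snd_eq (rt_right (v (-2)) (v (-1))) h
      rw [e1] at g1
      have := H.upper_empty hx' (by
        rw [rt_of_snd_eq (rt_left (v (-1)) (v 0)) h]
        exact mul_nonneg (nonneg_of_mul_nonneg_left g1 (by linarith)) (by linarith [H.lt_top]))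
        (by linarith) h.ge (by linarith [H.lt_top])
      linarith [hx.2]
    · have := interp_int v 1
      rw [Int.cast_one, ← h] at this
      exact ⟨Or.inr this, le_antisymm (by rw [this]; exact hm1) g3⟩
    · have := H.interp_second_last
      rw [← h] at this
      exact ⟨Or.inl this, le_antisymm (by rw [this]; exact hm2) g3⟩

/-- A segment from `v (-1)` to a point of the edge `v 1`, `v 0` avoids the rest of the polygon. -/
theorem segment_avoids (hda : (v (-2)).2 < (v (-1)).2) {m : ℝ} (hm : m = max (v 1).2 (v (-2)).2)
    {σ t : ℝ} (hσ : σ ∈ Icc (0:ℝ) 1) (ht : t ∈ Icc (0:ℝ) 1) {e z : Plane}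
    (he : e = v 1 + σ • (v 0 - v 1)) (hz : z = v (-1) + t • (e - v (-1))) (hem : m ≤ e.2)
    {y : ℝ} (hy : y ∈ Icc (1:ℝ) (n - 1)) (hyz : interp v y = z) :
    z = v (-1) ∨ (z = v (-2) ∨ z = v 1) ∧ z.2 = m := by
  have hm2 : (v (-2)).2 ≤ m := hm ▸ le_max_right _ _
  have hrt0 : rt (v 1) (v 0) e = 0 := lerp_of_rt_eq he
  have hG : rt (v 1) (v 0) z ≤ 0 := by
    rw [hz, rt_lerp, hrt0]
    nlinarith [H.left, ht.2]
  have hz2 : z.2 = (1 - t) * (v (-1)).2 + t * e.2 := by rw [hz, snd_lerp]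
  have he2 : e.2 = (1 - σ) * (v 1).2 + σ * (v 0).2 := by rw [he, snd_lerp]
  have hcb : (v 1).2 < (v 0).2 := H.lt_left.trans H.lt_top
  rcases lt_or_ge e.2 (v (-1)).2 with h | h
  · rcases ht.1.eq_or_lt with h0 | h0
    · left; rw [hz, ← h0]; simp
    have hpos : 0 < rt (v (-2)) (v (-1)) z := by
      rw [hz, rt_lerp, rt_right, he]
      have := H.rt_far_pos hda hσ (by rw [← he]; linarith) (by rw [← he]; exact h.le)
      nlinarith
    rcases le_or_gt y (n - 2) with hy2 | hy2
    · right
      have := H.lower_empty hda hm ⟨hy.1, hy2⟩ (by rw [hyz]; exact hpos.le) (by rw [hyz]; exact hG)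
        (by rw [hyz, hz2]; nlinarith [ht.2]) (by rw [hyz, hz2]; nlinarith [ht.2])
      rwa [hyz] at this
    · exfalso
      have h1 := interp_far_part v (τ := y - n + 2) ⟨by linarith, by linarith [hy.2]⟩
      have h2 := interp_add_mul H.simple.1 (y - n) 1
      rw [Int.cast_one, one_mul, sub_add_cancel, hyz] at h2
      rw [add_sub_cancel_right, ← h2] at h1
      rw [lerp_of_rt_eq h1] at hpos
      exact lt_irrefl _ hpos
  · left
    have := H.upper_empty hy (by
      rw [hyz, hz, rt_lerp, rt_left, he, rt_lerp, rt_right]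
      have := H.rt_left_pos
      have := mul_nonneg ht.1 (mul_nonneg (sub_nonneg.2 hσ.2) this.le)
      linarith) (by rw [hyz]; exact hG) (by rw [hyz, hz2]; nlinarith [ht.1])
      (by
        rw [hyz, hz2]
        have : e.2 ≤ (v 0).2 := by rw [he2]; nlinarith [hσ.2]
        nlinarith [ht.1, ht.2, H.lt_top])
    rw [← hyz, this, H.interp_last]

end LowestMax

/-- Deleting the vertex `u 0` when it is the midpoint of its neighbours. -/
theorem IsSimple.exists_remove {n : ℕ} (hn : 3 ≤ n) {u : ℤ → Plane} (h : IsSimple (n + 1) u)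
    (hmid : u 0 = (1 / 2 : ℝ) • (u (-1) + u 1)) :
    ∃ w, IsSimple n w ∧ SmoothingEquiv (poly (n + 1) u) (poly n w) ∧
      ∀ i : ℤ, 0 ≤ i → i < n → w i = u (i + 1) := by
  have hper := h.1
  push_cast at hper
  have hw : ∀ i : ℤ, 0 ≤ i → i < n → (fun i : ℤ => u (i % n + 1)) i = u (i + 1) := by
    intro i h0 h1
    beta_reduce
    rw [Int.emod_eq_of_lt h0 h1]
  obtain ⟨h1, h2⟩ := (h.shift 1).remove hn (v' := fun i => u (i % n + 1)) (by
    rw [show (n:ℤ) + 1 = 0 + (n + 1) by ring, hper, show (n:ℤ) - 1 + 1 = -1 + (n + 1) by ring, hper]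
    simpa using hmid) (fun i => by simp) hw
  exact ⟨_, h1, (smoothingEquiv_shift (by omega) u 1).trans h2, hw⟩

namespace LowestMax
variable {n : ℕ} {v : ℤ → Plane} (H : LowestMax n v)
include H

/-- Sliding `v 0` along the edge towards `v 1`. -/
theorem slide_along {lam : ℝ} (h0 : 0 < lam) (h1 : lam ≤ 1)
    (hav : ∀ κ ∈ Icc lam 1, ∀ τ ∈ Ioc (0:ℝ) 1, ∀ y ∈ Icc (1:ℝ) (n - 1),
      interp v y = v (-1) + τ • (v 1 + κ • (v 0 - v 1) - v (-1)) →
        interp v y = v (-1) ∨ interp v y = v 1) :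
    IsSimple n (setVertex n v (v 1 + lam • (v 0 - v 1))) ∧
      SmoothingEquiv (poly n v) (poly n (setVertex n v (v 1 + lam • (v 0 - v 1)))) := by
  have hn := H.four_le
  obtain ⟨φ, f1, f2⟩ := H.simple.exists_clm (by omega)
  have hφ : ∀ κ ∈ Icc lam 1, φ (v (-1)) < φ (v 1 + κ • (v 0 - v 1)) ∧
      φ (v 1 + κ • (v 0 - v 1)) < φ (v 1) := by
    intro κ hκ
    simp only [map_add, map_smul, map_sub, smul_eq_mul]
    have := mul_pos (h0.trans_le hκ.1) (sub_pos.2 f2)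
    have := mul_nonneg (sub_nonneg.2 hκ.2) (sub_pos.2 f2).le
    constructor <;> nlinarith
  refine H.simple.slide (by omega) f1 f2 (hφ lam ⟨le_rfl, h1⟩).1 (hφ lam ⟨le_rfl, h1⟩).2 ?_
  intro s hs τ hτ y hy
  have hκ : (1 - s * (1 - lam)) ∈ Icc lam 1 := by
    constructor <;> nlinarith [hs.1, hs.2]
  have e : v 0 + s • (v 1 + lam • (v 0 - v 1) - v 0) = v 1 + (1 - s * (1 - lam)) • (v 0 - v 1) := by
    module
  rw [e]
  obtain ⟨p1, p2⟩ := hφ _ hκ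
  constructor
  · intro hz
    rcases hav _ hκ τ hτ y hy hz with h | h <;> rw [h] at hz <;> have := congrArg φ hz <;>
      rw [map_add, map_smul, map_sub, smul_eq_mul] at this <;> nlinarith [hτ.1, hτ.2]
  · rw [add_sub_cancel_left, smul_smul]
    intro hz
    have hp : 0 < τ * (1 - s * (1 - lam)) := mul_pos hτ.1 (h0.trans_le hκ.1)
    have := (H.edge_right hy ⟨hp.le, mul_le_one₀ hτ.2 (h0.le.trans hκ.1) hκ.2⟩ hz).2
    exact hp.ne' this

omit H in
theorem exists_level (hcb : 0 < (v 0).2 - (v 1).2) {x : ℝ} (hx1 : (v 1).2 < x) (hx2 : x < (v 0).2) :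
    ∃ lam : ℝ, 0 < lam ∧ lam ≤ 1 ∧ (v 1 + lam • (v 0 - v 1)).2 = x := by
  refine ⟨(x - (v 1).2) / ((v 0).2 - (v 1).2), div_pos (by linarith) hcb,
    (div_le_one hcb).2 (by linarith), ?_⟩
  simp only [Prod.snd_add, Prod.snd_sub, Prod.smul_snd, smul_eq_mul]
  field_simp
  ring

theorem lt_of_level {z : Plane} (hz : rt (v 1) (v 0) z < 0) {lam : ℝ}
    (h : (v 1 + lam • (v 0 - v 1)).2 = z.2) : z.1 < (v 1 + lam • (v 0 - v 1)).1 := by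
  rw [rt_of_snd_eq (lerp_of_rt_eq rfl) h.symm] at hz
  by_contra! hc
  have := mul_nonneg (sub_nonneg.2 hc) (sub_pos.2 (H.lt_left.trans H.lt_top)).le
  linarith

/-- Lowering the lowest local maximum to the height of its higher neighbour. -/
theorem exists_lower : ∃ q : Plane, q.2 = (v (-1)).2 ∧ (v (-1)).1 < q.1 ∧
    IsSimple n (setVertex n v q) ∧ SmoothingEquiv (poly n v) (poly n (setVertex n v q)) := by
  obtain ⟨lam, h0, h1, h2⟩ := exists_level (sub_pos.2 (H.lt_left.trans H.lt_top)) H.lt_left H.lt_top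
  refine ⟨_, h2, H.lt_of_level H.left h2, H.slide_along h0 h1 ?_⟩
  intro κ hκ τ hτ y hy hz
  left
  have hcb := sub_pos.2 (H.lt_left.trans H.lt_top)
  have hk1 : (v (-1)).2 ≤ (v 1 + κ • (v 0 - v 1)).2 := by
    rw [← h2, snd_lerp, snd_lerp]; nlinarith [hκ.1]
  have hk2 : (v 1 + κ • (v 0 - v 1)).2 ≤ (v 0).2 := by
    rw [snd_lerp]; nlinarith [hκ.2]
  have := H.upper_empty hy (by
      rw [hz, rt_lerp, rt_left, rt_lerp, rt_right]
      have := mul_nonneg hτ.1.le (mul_nonneg (sub_nonneg.2 hκ.2) H.rt_left_pos.le)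
      linarith) (by
      rw [hz, rt_lerp, lerp_of_rt_eq rfl]
      nlinarith [H.left, hτ.2]) (by rw [hz, snd_lerp]; nlinarith [hτ.1])
      (by rw [hz, snd_lerp]; nlinarith [hτ.1, hτ.2, H.lt_top])
  rw [this, H.interp_last]

/-- Cutting off the vertex `v 0` when `v (-2)` lies below `v 1`. -/
theorem exists_cut_apex (hdc : (v (-2)).2 < (v 1).2) :
    IsSimple n (setVertex n v ((1 / 2 : ℝ) • (v (-1) + v 1))) ∧
      SmoothingEquiv (poly n v) (poly n (setVertex n v ((1 / 2 : ℝ) • (v (-1) + v 1)))) := by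
  have hn := H.four_le
  obtain ⟨φ, f1, f2⟩ := H.simple.exists_clm (by omega)
  have fm : φ ((1 / 2 : ℝ) • (v (-1) + v 1)) = (φ (v (-1)) + φ (v 1)) / 2 := by
    rw [map_smul, map_add, smul_eq_mul]; ring
  refine H.simple.slide (by omega) f1 f2 (by rw [fm]; linarith) (by rw [fm]; linarith) ?_
  intro s hs τ hτ y hy
  have hφs : φ (v (-1)) < φ (v 0 + s • ((1 / 2 : ℝ) • (v (-1) + v 1) - v 0)) ∧
      φ (v 0 + s • ((1 / 2 : ℝ) • (v (-1) + v 1) - v 0)) < φ (v 1) := by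
    simp only [map_add, map_smul _ s, map_sub, fm, smul_eq_mul]
    constructor <;> rcases hs.2.eq_or_lt with rfl | h <;> nlinarith [hs.1]
  have key : ∀ z : Plane, φ (v (-1)) < φ z → φ z < φ (v 1) → ∀ σ ∈ Icc (0:ℝ) 1, ∀ t ∈ Icc (0:ℝ) 1,
      z = v (-1) + t • (v 1 - v (-1)) + (t * σ) • (v 0 - v 1) → interp v y ≠ z := by
    intro z hz1 hz2 σ hσ t ht hz hyz
    rw [show v (-1) + t • (v 1 - v (-1)) + (t * σ) • (v 0 - v 1) =
      v (-1) + t • (v 1 + σ • (v 0 - v 1) - v (-1)) by module] at hz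
    rcases H.segment_avoids (hdc.trans H.lt_left) rfl hσ ht rfl hz (by
      rw [max_eq_left hdc.le, snd_lerp]
      nlinarith [hσ.1, H.lt_left, H.lt_top]) hy hyz with h | ⟨h | h, h'⟩
    · rw [h] at hz1; exact lt_irrefl _ hz1
    · rw [max_eq_left hdc.le, h] at h'; exact hdc.ne h'
    · rw [h] at hz2; exact lt_irrefl _ hz2
  constructor
  · have ht0 : 0 < 1 - s / 2 := by linarith [hs.2]
    refine key _ ?_ ?_ ((1 - s) / (1 - s / 2)) ⟨div_nonneg (by linarith [hs.2]) ht0.le,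
      (div_le_one ht0).2 (by linarith [hs.1])⟩ (τ * (1 - s / 2)) ⟨by nlinarith [hτ.1],
      mul_le_one₀ hτ.2 ht0.le (by linarith [hs.1])⟩ ?_
    · rw [map_add, map_smul, map_sub, smul_eq_mul]; nlinarith [hτ.1]
    · rw [map_add, map_smul, map_sub, smul_eq_mul]; nlinarith [hτ.1, hτ.2]
    · have : τ * (1 - s / 2) * ((1 - s) / (1 - s / 2)) = τ * (1 - s) := by
        rw [mul_assoc, mul_div_cancel₀ _ ht0.ne']
      rw [this]
      module
  · have ht0 : 0 < 1 - τ * s / 2 := by nlinarith [hs.2, hτ.2, hs.1, hτ.1]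
    refine key _ ?_ ?_ (τ * (1 - s) / (1 - τ * s / 2)) ⟨div_nonneg (mul_nonneg hτ.1.le
      (by linarith [hs.2])) ht0.le, (div_le_one ht0).2 (by nlinarith [hs.1, hτ.1, hτ.2])⟩
      (1 - τ * s / 2) ⟨ht0.le, by nlinarith [hs.1, hτ.1]⟩ ?_
    · rw [map_add, map_smul, map_sub, smul_eq_mul]; nlinarith [hτ.1, hτ.2]
    · rw [map_add, map_smul, map_sub, smul_eq_mul]; nlinarith [hτ.1]
    · have : (1 - τ * s / 2) * (τ * (1 - s) / (1 - τ * s / 2)) = τ * (1 - s) := by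
        rw [mul_div_cancel₀ _ ht0.ne']
      rw [this]
      module

theorem rt_far_neg (hda : (v (-2)).2 < (v (-1)).2) (hcd : (v 1).2 < (v (-2)).2) :
    rt (v 1) (v 0) (v (-2)) < 0 := by
  obtain ⟨lam, h0, h1, h2⟩ := exists_level (sub_pos.2 (H.lt_left.trans H.lt_top)) hcd (hda.trans H.lt_top)
  have h3 := H.rt_far_pos hda ⟨h0.le, h1⟩ h2.ge (by rw [h2]; exact hda.le)
  rw [rt_of_snd_eq (rt_left _ _) h2] at h3
  rw [rt_of_snd_eq (lerp_of_rt_eq rfl) h2.symm]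
  have := pos_of_mul_pos_left h3 (sub_pos.2 hda).le
  exact mul_neg_of_neg_of_pos (by linarith) (sub_pos.2 (H.lt_left.trans H.lt_top))

/-- Sliding `v 0` down to a point `q` between the heights of `v (-2)` and `v (-1)`, when `v (-2)`
is above `v 1`, and then cutting off `v (-1)`. -/
theorem exists_cut_left (hda : (v (-2)).2 < (v (-1)).2) (hcd : (v 1).2 < (v (-2)).2) {x : ℝ}
    (hx1 : (v (-2)).2 < x) (hx2 : x < (v (-1)).2) :
    ∃ u q, q.2 = x ∧ IsSimple n u ∧ SmoothingEquiv (poly n v) (poly n u) ∧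
      u 0 = (1 / 2 : ℝ) • (v (-2) + q) ∧ u 1 = q ∧ ∀ i : ℤ, 1 < i → i < n → u i = v (i - 1) := by
  have hn := H.four_le
  obtain ⟨lam, h0, h1, h2⟩ := exists_level (sub_pos.2 (H.lt_left.trans H.lt_top)) (hcd.trans hx1) (hx2.trans H.lt_top)
  have hcb := sub_pos.2 (H.lt_left.trans H.lt_top)
  obtain ⟨s1, e1⟩ := H.slide_along h0 h1 (by
    intro κ hκ τ hτ y hy hz
    have hk : x ≤ (v 1 + κ • (v 0 - v 1)).2 := by
      rw [← h2, snd_lerp, snd_lerp]; nlinarith [hκ.1]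
    rcases H.segment_avoids hda rfl (σ := κ) ⟨h0.le.trans hκ.1, hκ.2⟩ (t := τ) ⟨hτ.1.le, hτ.2⟩ rfl hz
      (by rw [max_eq_right hcd.le]; linarith) hy rfl with h | ⟨h, h'⟩
    · exact Or.inl h
    · rw [max_eq_right hcd.le, hz, snd_lerp] at h'
      nlinarith [hτ.1, hτ.2])
  set q := v 1 + lam • (v 0 - v 1) with hq
  set v1 := setVertex n v q with hv1
  set u := fun i => v1 (i + -1) with hu
  have hu0 : u 0 = v (-1) := by simp [hu, hv1, setVertex_neg_one (show 2 ≤ n by omega)]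
  have hu1 : u 1 = q := by simp [hu, hv1, setVertex_zero]
  have hum : u (-1) = v (-2) := by
    simp only [hu]
    rw [← s1.1, hv1, setVertex_of_mem _ _ (by omega) (by omega)]
    exact H.simple.1 (-2)
  have hus : IsSimple n u := s1.shift (-1)
  have hue : SmoothingEquiv (poly n v) (poly n u) :=
    e1.trans (smoothingEquiv_shift (by omega) _ _)
  obtain ⟨φ, f1, f2⟩ := hus.exists_clm (by omega)
  rw [hu0, hum] at f1
  rw [hu0, hu1] at f2
  have fm : φ ((1 / 2 : ℝ) • (v (-2) + q)) = (φ (v (-2)) + φ q) / 2 := by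
    rw [map_smul, map_add, smul_eq_mul]; ring
  have rd := H.rt_far_neg hda hcd
  have ra := H.left
  have rq : rt (v 1) (v 0) q = 0 := lerp_of_rt_eq hq
  have rq' : 0 < rt (v (-2)) (v (-1)) q :=
    H.rt_far_pos hda ⟨h0.le, h1⟩ (by rw [← hq, h2]; exact hx1.le) (by rw [← hq, h2]; exact hx2.le)
  have key : ∀ α β γ : ℝ, 0 ≤ α → 0 ≤ β → 0 ≤ γ → α + β + γ = 1 → 0 < α + β → 
      φ (v (-2)) < φ (α • v (-2) + β • v (-1) + γ • q) → ∀ y ∈ Icc (1:ℝ) (n - 1),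
      interp u y ≠ α • v (-2) + β • v (-1) + γ • q := by
    intro α β γ hα hβ hγ hs hab hφ y hy hyz
    obtain rfl : α = 1 - β - γ := by linarith
    have hrt : ∀ p p', rt p p' ((1 - β - γ) • v (-2) + β • v (-1) + γ • q) =
        (1 - β - γ) * rt p p' (v (-2)) + β * rt p p' (v (-1)) + γ * rt p p' q := by
      intro p p'
      simp only [rt, cross, Prod.fst_add, Prod.fst_sub, Prod.smul_fst, Prod.snd_add, Prod.snd_sub,
        Prod.smul_snd, smul_eq_mul]
      ring
    have hneg : rt (v 1) (v 0) ((1 - β - γ) • v (-2) + β • v (-1) + γ • q) < 0 := by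
      rw [hrt, rq]
      rcases hα.eq_or_lt with h | h
      · rw [← h] at hab ⊢
        nlinarith
      · nlinarith
    have hpos : 0 ≤ rt (v (-2)) (v (-1)) ((1 - β - γ) • v (-2) + β • v (-1) + γ • q) := by
      rw [hrt, rt_left, rt_right]
      nlinarith
    have hht : ((1 - β - γ) • v (-2) + β • v (-1) + γ • q).2 =
        (1 - β - γ) * (v (-2)).2 + β * (v (-1)).2 + γ * x := by
      simp only [Prod.snd_add, Prod.smul_snd, smul_eq_mul, h2]
    have hyu : interp v1 (y - 1) = (1 - β - γ) • v (-2) + β • v (-1) + γ • q := by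
      rw [← hyz, hu, interp_shift]
      push_cast
      rfl
    rcases le_or_gt (y - 1) 1 with h | h
    · rw [interp_pos_part v1 (by linarith [hy.1]) h, hv1, setVertex_of_mem _ _ one_pos (by omega),
        setVertex_zero] at hyu
      rw [← hyu, rt_lerp, rt_left, rq] at hneg
      linarith
    · have hy' : y - 1 ∈ Icc (1:ℝ) (n - 2) := ⟨h.le, by linarith [hy.2]⟩
      rw [hv1, interp_setVertex _ _ ⟨hy'.1, by linarith [hy'.2]⟩] at hyu
      obtain ⟨g1, g2⟩ := H.lower_empty hda rfl hy' (by rw [hyu]; exact hpos)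
        (by rw [hyu]; exact hneg.le) (by rw [max_eq_right hcd.le, hyu, hht]; nlinarith)
        (by rw [hyu, hht]; nlinarith)
      rcases g1 with g | g
      · rw [← hyu, g] at hφ
        exact lt_irrefl _ hφ
      · rw [g, max_eq_right hcd.le] at g2
        exact hcd.ne g2
  obtain ⟨s2, e2⟩ := hus.slide (b := (1 / 2 : ℝ) • (v (-2) + q)) (φ := φ) (by omega)
    (by rw [hu0, hum]; exact f1) (by rw [hu0, hu1]; exact f2) (by rw [hum, fm]; linarith)
    (by rw [hu1, fm]; linarith) (by
      intro s hs τ hτ y hy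
      have i1 := mul_nonneg hτ.1.le hs.1
      have i2 := mul_nonneg hτ.1.le (sub_nonneg.2 hs.2)
      have i3 := hτ.1
      have i4 := hτ.2
      have fs : φ (v (-2)) < φ (v (-1) + s • ((1 / 2 : ℝ) • (v (-2) + q) - v (-1))) ∧
          φ (v (-1) + s • ((1 / 2 : ℝ) • (v (-2) + q) - v (-1))) < φ q := by
        simp only [map_add, map_smul _ s, map_sub, fm, smul_eq_mul]
        constructor <;> rcases hs.2.eq_or_lt with rfl | h <;> nlinarith [hs.1]
      rw [hu0, hum, hu1]
      have p1 : v (-2) + τ • (v (-1) + s • ((1 / 2 : ℝ) • (v (-2) + q) - v (-1)) - v (-2)) =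
          (1 - τ * s / 2 - τ * (1 - s)) • v (-2) + (τ * (1 - s)) • v (-1) + (τ * s / 2) • q := by
        module
      have p2 : q + τ • (v (-1) + s • ((1 / 2 : ℝ) • (v (-2) + q) - v (-1)) - q) =
          (τ * s / 2) • v (-2) + (τ * (1 - s)) • v (-1) + (1 - τ * s / 2 - τ * (1 - s)) • q := by
        module
      constructor
      · rw [p1]
        refine key _ _ _ (by nlinarith) i2 (by linarith) (by ring) (by nlinarith [hs.2]) ?_ y hy
        rw [← p1, map_add, map_smul, map_sub, smul_eq_mul]
        nlinarith
      · rw [p2]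
        refine key _ _ _ (by linarith) i2 (by nlinarith) (by ring) (by nlinarith [hs.2]) ?_ y hy
        rw [← p2, map_add, map_smul, map_sub, smul_eq_mul]
        nlinarith)
  refine ⟨_, q, h2, s2, hue.trans e2, setVertex_zero _ _ _, ?_, ?_⟩
  · rw [setVertex_of_mem _ _ one_pos (by omega), hu1]
  · intro i hi hi'
    rw [setVertex_of_mem _ _ (by omega) hi', hu]
    beta_reduce
    rw [hv1, setVertex_of_mem _ _ (by omega) (by omega)]
    rfl

end LowestMax

/-- Distinct vertices of the closed polygon have distinct heights. -/
def GenericHeights (n : ℕ) (v : ℤ → Plane) : Prop :=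
  ∀ i j, (v i).2 = (v j).2 → (n : ℤ) ∣ i - j

/-- The closed polygon has at most `N` local maxima. -/
def LocMaxBound (n : ℕ) (v : ℤ → Plane) (N : ℕ) : Prop :=
  ∃ S : Finset ℤ, S.card ≤ N ∧ ∀ i, LocMax v i → ∃ s ∈ S, (n : ℤ) ∣ i - s

/-- The smoothings of the closed polygon are equivalent to those of a triangle. -/
def ToTriangle (n : ℕ) (v : ℤ → Plane) : Prop :=
  ∃ w, IsSimple 3 w ∧ SmoothingEquiv (poly n v) (poly 3 w)

theorem eq_of_dvd_sub {E : Type*} {n : ℕ} {v : ℤ → E} (hv : ∀ i, v (i + n) = v i) {i j : ℤ}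
    (h : (n : ℤ) ∣ i - j) : v i = v j := by
  obtain ⟨k, hk⟩ := h
  rw [← periodic_add_mul hv j k]
  congr 1
  linarith

theorem locMax_congr {n : ℕ} {v : ℤ → Plane} (hv : ∀ i, v (i + n) = v i) {i j : ℤ}
    (h : (n : ℤ) ∣ i - j) (hi : LocMax v i) : LocMax v j := by
  have h1 : v (i - 1) = v (j - 1) := eq_of_dvd_sub hv (by simpa using h)
  have h2 : v (i + 1) = v (j + 1) := eq_of_dvd_sub hv (by simpa using h)
  rw [LocMax, h1, h2, eq_of_dvd_sub hv h] at hi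
  exact hi

theorem IsSimple.dvd_of_eq {n : ℕ} {v : ℤ → Plane} (h : IsSimple n v) {i j : ℤ} (e : v i = v j) :
    (n : ℤ) ∣ i - j := by
  obtain ⟨k, hk⟩ := h.2 i j (by rw [interp_int, interp_int, e])
  refine ⟨k, ?_⟩
  have : (i:ℝ) - j = n * k := by rw [hk]; ring
  exact_mod_cast this

/-- The shear `(x, y) ↦ (x, y - ε x)`. -/
noncomputable def shear (ε : ℝ) : Plane ≃L[ℝ] Plane :=
  LinearEquiv.toContinuousLinearEquiv
    { toFun := fun z => (z.1, z.2 - ε * z.1)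
      invFun := fun z => (z.1, z.2 + ε * z.1)
      map_add' := fun x y => by ext <;> simp; ring
      map_smul' := fun x y => by ext <;> simp; ring
      left_inv := fun x => by simp
      right_inv := fun x => by simp }

theorem shear_apply (ε : ℝ) (z : Plane) : shear ε z = (z.1, z.2 - ε * z.1) := rfl

/-- The reflection `(x, y) ↦ (-x, y)`. -/
noncomputable def reflect : Plane ≃L[ℝ] Plane :=
  LinearEquiv.toContinuousLinearEquiv
    { toFun := fun z => (-z.1, z.2)
      invFun := fun z => (-z.1, z.2)
      map_add' := fun x y => by ext <;> simp; ring
      map_smul' := fun x y => by ext <;> simp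
      left_inv := fun x => by simp
      right_inv := fun x => by simp }

theorem reflect_apply (z : Plane) : reflect z = (-z.1, z.2) := rfl

theorem ToTriangle.of_map {n : ℕ} {v : ℤ → Plane} (A : Plane ≃L[ℝ] Plane)
    (h : ToTriangle n fun i => A (v i)) : ToTriangle n v := by
  obtain ⟨w, h1, h2⟩ := h
  refine ⟨_, h1.map A.symm, ?_⟩
  simpa using h2.map_poly A.symm

theorem IsSimple.exists_shear {n : ℕ} (hn : 0 < n) {v : ℤ → Plane} (h : IsSimple n v) :
    ∃ ε > 0, (∀ i j, (v i).2 < (v j).2 → (shear ε (v i)).2 < (shear ε (v j)).2) ∧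
      GenericHeights n fun i => shear ε (v i) := by
  have hmod : ∀ i : ℤ, v i = v (i % n) := fun i => eq_of_dvd_sub h.1 (Int.dvd_self_sub_emod)
  have hmem : ∀ i : ℤ, i % n ∈ Finset.Ico (0:ℤ) n := fun i =>
    Finset.mem_Ico.2 ⟨Int.emod_nonneg _ (by omega), Int.emod_lt_of_pos _ (by omega)⟩
  have key : ∀ i j : ℤ, ∀ᶠ ε : ℝ in 𝓝[>] 0,
      ((v i).2 < (v j).2 → (shear ε (v i)).2 < (shear ε (v j)).2) ∧
      ((shear ε (v i)).2 = (shear ε (v j)).2 → v i = v j) := by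
    intro i j
    simp only [shear_apply]
    have c1 : ∀ z : Plane, Tendsto (fun ε : ℝ => z.2 - ε * z.1) (𝓝[>] 0) (𝓝 z.2) := by
      intro z
      have : Tendsto (fun ε : ℝ => z.2 - ε * z.1) (𝓝 0) (𝓝 (z.2 - 0 * z.1)) :=
        Continuous.tendsto (by fun_prop) 0
      rw [zero_mul, sub_zero] at this
      exact this.mono_left nhdsWithin_le_nhds
    rcases lt_trichotomy (v i).2 (v j).2 with hlt | heq | hgt
    · filter_upwards [(c1 (v i)).eventually_lt (c1 (v j)) hlt] with ε hε
      exact ⟨fun _ => hε, fun h => absurd h hε.ne⟩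
    · filter_upwards [self_mem_nhdsWithin] with ε hε
      refine ⟨fun h => absurd heq h.ne, fun h => ?_⟩
      rw [heq] at h
      have : ε * ((v i).1 - (v j).1) = 0 := by linarith
      rcases mul_eq_zero.1 this with h' | h'
      · exact absurd h' (ne_of_gt hε)
      · exact Prod.ext (by linarith) heq
    · filter_upwards [(c1 (v j)).eventually_lt (c1 (v i)) hgt] with ε hε
      exact ⟨fun h => absurd h hgt.not_gt, fun h => absurd h hε.ne'⟩
  have hall : ∀ᶠ ε : ℝ in 𝓝[>] 0, ∀ i ∈ Finset.Ico (0:ℤ) n, ∀ j ∈ Finset.Ico (0:ℤ) n,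
      ((v i).2 < (v j).2 → (shear ε (v i)).2 < (shear ε (v j)).2) ∧
      ((shear ε (v i)).2 = (shear ε (v j)).2 → v i = v j) :=
    (Filter.eventually_all_finset _).2 fun i _ => (Filter.eventually_all_finset _).2 fun j _ => key i j
  obtain ⟨ε, hε, hε0⟩ := (hall.and self_mem_nhdsWithin).exists
  refine ⟨ε, hε0, fun i j => ?_, fun i j hij => ?_⟩
  · rw [hmod i, hmod j]
    exact (hε _ (hmem i) _ (hmem j)).1
  · beta_reduce at hij
    rw [hmod i, hmod j] at hij
    have := (hε _ (hmem i) _ (hmem j)).2 hij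
    rw [← hmod, ← hmod] at this
    exact h.dvd_of_eq this

theorem exists_lowest_locMax {n : ℕ} (hn : 3 ≤ n) {v : ℤ → Plane} (hv : ∀ i, v (i + n) = v i)
    (hg : GenericHeights n v) : ∃ k, LocMax v k ∧ ∀ j, LocMax v j → (v k).2 ≤ (v j).2 := by
  have hmem : ∀ i : ℤ, i % n ∈ Finset.Ico (0:ℤ) n := fun i =>
    Finset.mem_Ico.2 ⟨Int.emod_nonneg _ (by omega), Int.emod_lt_of_pos _ (by omega)⟩
  obtain ⟨m, -, hm⟩ := (Finset.Ico (0:ℤ) n).exists_max_image (fun i => (v i).2) ⟨_, hmem 0⟩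
  have hm' : ∀ i, (v i).2 ≤ (v m).2 := fun i => by
    rw [eq_of_dvd_sub hv (Int.dvd_self_sub_emod (x := i) (m := n))]
    exact hm _ (hmem i)
  have hmax : LocMax v m := by
    refine ⟨lt_of_le_of_ne (hm' _) fun h => ?_, lt_of_le_of_ne (hm' _) fun h => ?_⟩
    · have := Int.le_of_dvd (by omega) ((dvd_sub_comm).1 (hg _ _ h)); omega
    · have := Int.le_of_dvd (by omega) (hg _ _ h); omega
  classical
  obtain ⟨k, hk, hk'⟩ := ((Finset.Ico (0:ℤ) n).filter (LocMax v)).exists_min_image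
    (fun i => (v i).2) ⟨m % n, Finset.mem_filter.2 ⟨hmem m,
      locMax_congr hv Int.dvd_self_sub_emod hmax⟩⟩
  refine ⟨k, (Finset.mem_filter.1 hk).2, fun j hj => ?_⟩
  rw [eq_of_dvd_sub hv (Int.dvd_self_sub_emod (x := j) (m := n))]
  exact hk' _ (Finset.mem_filter.2 ⟨hmem j, locMax_congr hv Int.dvd_self_sub_emod hj⟩)

theorem GenericHeights.ne {n : ℕ} {v : ℤ → Plane} (h : GenericHeights n v) {i j : ℤ} (hij : j < i)
    (hn : i < j + n) : (v i).2 ≠ (v j).2 := fun e => by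
  have := Int.le_of_dvd (by omega) (h _ _ e); omega

namespace LowestMax
variable {n : ℕ} {v : ℤ → Plane} (H : LowestMax n v)
include H

theorem locMax_zero : LocMax v 0 := ⟨by simpa using H.lt_top, by simpa using H.lt_left.trans H.lt_top⟩

theorem interp_neg_two : v (n - 2) = v (-2) := by
  rw [← H.simple.1 (-2)]; congr 1

theorem interp_neg_one : v (n - 1) = v (-1) := by
  rw [← H.simple.1 (-1)]; congr 1

/-- Lowering the lowest local maximum removes it. -/
theorem toTriangle_of_lower {N : ℕ} (hg : GenericHeights n v) (hN : LocMaxBound n v N)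
    (hd : (v (-1)).2 < (v (-2)).2)
    (ih : ∀ (N' : ℕ) (v' : ℤ → Plane), N' < N → IsSimple n v' → GenericHeights n v' →
      LocMaxBound n v' N' → ToTriangle n v') : ToTriangle n v := by
  have hn := H.four_le
  obtain ⟨q, hq2, hq1, hs, he⟩ := H.exists_lower
  set v1 := setVertex n v q with hv1
  obtain ⟨ε, hε, h1, h2⟩ := hs.exists_shear (by omega)
  have hv1i : ∀ i : ℤ, 0 < i → i < n → v1 i = v i := fun i h h' => setVertex_of_mem _ _ h h'
  have hloc : ∀ i, LocMax (fun i => shear ε (v1 i)) i → LocMax v i ∧ ¬ (n:ℤ) ∣ i := by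
    intro i hi
    have hdvd := Int.dvd_self_sub_emod (x := i) (m := n)
    have hi' := locMax_congr (fun i => by rw [hs.1]) hdvd hi
    have hr0 := Int.emod_nonneg i (b := n) (by omega)
    have hr1 := Int.emod_lt_of_pos i (b := n) (by omega)
    suffices LocMax v (i % n) ∧ ¬ (n:ℤ) ∣ i % n from
      ⟨locMax_congr H.simple.1 ((dvd_sub_comm).1 hdvd) this.1, fun h => this.2
        (Int.dvd_of_emod_eq_zero (by rw [Int.emod_emod, Int.emod_eq_zero_of_dvd h]))⟩
    generalize i % n = r at hi' hr0 hr1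
    obtain ⟨g1, g2⟩ := hi'
    beta_reduce at g1 g2
    have c0 : r ≠ 0 := by
      rintro rfl
      rw [zero_sub, hv1, setVertex_neg_one (by omega), setVertex_zero, shear_apply, shear_apply] at g1
      simp only at g1
      nlinarith
    have c1 : r ≠ 1 := by
      rintro rfl
      have := h1 1 0 (by
        rw [hv1, setVertex_zero, setVertex_of_mem _ _ one_pos (by omega), hq2]; exact H.lt_left)
      rw [sub_self] at g1
      exact this.not_gt g1
    have c2 : r ≠ n - 1 := by
      rintro rfl
      rw [hv1i (n - 1) (by omega) (by omega), H.interp_neg_one,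
        show (n:ℤ) - 1 - 1 = n - 2 by ring, hv1i (n - 2) (by omega) (by omega),
        H.interp_neg_two] at g1
      have := h1 (n - 1) (n - 2) (by
        rwa [hv1i (n - 1) (by omega) (by omega), H.interp_neg_one,
          hv1i (n - 2) (by omega) (by omega), H.interp_neg_two])
      rw [hv1i (n - 1) (by omega) (by omega), H.interp_neg_one,
          hv1i (n - 2) (by omega) (by omega), H.interp_neg_two] at this
      exact this.not_gt g1
    have key : ∀ j : ℤ, 0 < j → j < n → (v j).2 ≠ (v r).2 → (shear ε (v1 j)).2 < (shear ε (v1 r)).2 →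
        (v j).2 < (v r).2 := by
      intro j hj hj' hne hlt
      by_contra! hc
      have := h1 r j (by
        rw [hv1i j hj hj', hv1i r (by omega) hr1]; exact lt_of_le_of_ne hc hne.symm)
      exact this.not_gt hlt
    refine ⟨⟨key (r - 1) (by omega) (by omega) (hg.ne (by omega) (by omega)).symm g1,
      key (r + 1) (by omega) (by omega) (hg.ne (by omega) (by omega)) g2⟩, fun h => ?_⟩
    have := Int.le_of_dvd (by omega) h
    omega
  obtain ⟨S, hS, hSv⟩ := hN
  obtain ⟨s₀, hs₀, hd₀⟩ := hSv 0 H.locMax_zero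
  have hcard : 0 < S.card := Finset.card_pos.2 ⟨s₀, hs₀⟩
  obtain ⟨w, hw, hw'⟩ := (ih (N - 1) _ (by omega) (hs.map (shear ε)) h2
    ⟨S.erase s₀, by rw [Finset.card_erase_of_mem hs₀]; omega, fun i hi => by
      obtain ⟨hi1, hi2⟩ := hloc i hi
      obtain ⟨s, hs, hsd⟩ := hSv i hi1
      refine ⟨s, Finset.mem_erase.2 ⟨?_, hs⟩, hsd⟩
      rintro rfl
      apply hi2
      have := dvd_sub hsd hd₀
      rwa [sub_sub_sub_cancel_right, sub_zero] at this⟩).of_map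
  exact ⟨w, hw, he.trans hw'⟩

theorem toTriangle_of_cut {N m : ℕ} (hg : GenericHeights n v) (hN : LocMaxBound n v N)
    (hm : n = m + 1) {w : ℤ → Plane} (hs : IsSimple m w)
    (he : SmoothingEquiv (poly n v) (poly m w)) (hw : ∀ i : ℤ, 0 < i → i < m → w i = v i)
    (h1 : (v 1).2 < (w 0).2) (h2 : (v (-2)).2 < (w 0).2)
    (hne : ∀ i : ℤ, 0 < i → i < m → (w 0).2 ≠ (v i).2)
    (ih : ∀ v' : ℤ → Plane, IsSimple m v' → GenericHeights m v' →
      LocMaxBound m v' N → ToTriangle m v') : ToTriangle n v := by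
  have hn := H.four_le
  have hmod : ∀ i : ℤ, w i = w (i % m) := fun i => eq_of_dvd_sub hs.1 (Int.dvd_self_sub_emod)
  have hr0 := fun i => Int.emod_nonneg i (b := m) (by omega)
  have hr1 := fun i => Int.emod_lt_of_pos i (b := m) (by omega)
  have hgen : ∀ i j : ℤ, 0 ≤ i → i < j → j < m → (w i).2 ≠ (w j).2 := by
    intro i j hi hij hj
    rw [hw j (by omega) hj]
    rcases hi.eq_or_lt with rfl | hi
    · exact hne _ hij hj
    · rw [hw i hi (by omega)]
      exact (hg.ne hij (by omega)).symm
  obtain ⟨u, hu, hu'⟩ := ih w hs (by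
    intro i j hij
    rw [hmod i, hmod j] at hij
    have : i % m = j % m := by
      by_contra hc
      rcases lt_or_gt_of_ne hc with hc | hc
      · exact hgen _ _ (hr0 i) hc (hr1 j) hij
      · exact hgen _ _ (hr0 j) hc (hr1 i) hij.symm
    exact Int.emod_eq_emod_iff_emod_sub_eq_zero.1 this |> Int.dvd_of_emod_eq_zero) (by
    obtain ⟨S, hS, hSv⟩ := hN
    refine ⟨S.image (· % (n:ℤ)), Finset.card_image_le.trans hS, fun i hi => ?_⟩
    have hdvd := Int.dvd_self_sub_emod (x := i) (m := m)
    refine ⟨i % m, ?_, hdvd⟩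
    have hi' := locMax_congr hs.1 hdvd hi
    have a0 := hr0 i
    have a1 := hr1 i
    generalize i % m = r at hi' a0 a1
    have hrn : LocMax v r := by
      rcases a0.eq_or_lt with rfl | a0
      · exact H.locMax_zero
      obtain ⟨g1, g2⟩ := hi'
      have c1 : r ≠ 1 := by
        rintro rfl
        rw [sub_self, hw 1 one_pos (by omega)] at g1
        exact h1.not_gt g1
      have c2 : r ≠ m - 1 := by
        rintro rfl
        rw [sub_add_cancel, hw (m - 1) a0 (by omega), show (m:ℤ) - 1 = n - 2 by omega,
          H.interp_neg_two, ← zero_add (m:ℤ), hs.1] at g2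
        exact h2.not_gt g2
      rw [hw r a0 a1, hw _ (by omega) (by omega)] at g1 g2
      exact ⟨g1, g2⟩
    obtain ⟨s, hs, hd⟩ := hSv r hrn
    refine Finset.mem_image.2 ⟨s, hs, ?_⟩
    have := Int.emod_eq_emod_iff_emod_sub_eq_zero.2 (Int.emod_eq_zero_of_dvd hd)
    rw [← this, Int.emod_eq_of_lt a0 (by omega)])
  exact ⟨u, hu, he.trans hu'⟩

theorem toTriangle {N : ℕ} (hg : GenericHeights n v) (hN : LocMaxBound n v N)
    (ih : ∀ (n' N' : ℕ) (v' : ℤ → Plane), n' + N' < n + N → 3 ≤ n' → IsSimple n' v' →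
      GenericHeights n' v' → LocMaxBound n' v' N' → ToTriangle n' v') : ToTriangle n v := by
  have hn := H.four_le
  rcases (hg.ne (i := -1) (j := -2) (by omega) (by omega)).lt_or_gt with hd | hd
  · exact H.toTriangle_of_lower hg hN hd fun N' v' h => ih n N' v' (by omega) (by omega)
  obtain ⟨m, rfl⟩ : ∃ m, n = m + 1 := ⟨n - 1, by omega⟩
  rcases (hg.ne (i := 1) (j := -2) (by omega) (by omega)).lt_or_gt with hc | hc
  · obtain ⟨x, ⟨hx1, hx2⟩, hx⟩ := ((Set.Ioo_infinite hd).sdiff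
      (((Finset.Ico (0:ℤ) m).image fun i => (v i).2).finite_toSet)).nonempty
    obtain ⟨u, q, rfl, hu, hue, u0, u1, hui⟩ := H.exists_cut_left hd hc hx1 hx2
    have hum : u (-1) = v (-2) := by
      rw [← hu.1, hui _ (by push_cast; omega) (by push_cast; omega), ← H.simple.1 (-2)]
      congr 1
      push_cast
      ring
    obtain ⟨w, hw, hwe, hwi⟩ := hu.exists_remove (by omega) (by rw [u0, u1, hum])
    have w0 : w 0 = q := by rw [hwi 0 le_rfl (by omega), zero_add, u1]
    refine H.toTriangle_of_cut hg hN rfl hw (hue.trans hwe) (fun i hi hi' => ?_)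
      (by rw [w0]; exact hc.trans hx1) (by rw [w0]; exact hx1) (fun i hi hi' h => hx ?_)
      fun v' => ih m N v' (by omega) (by omega)
    · rw [hwi i hi.le hi', hui _ (by omega) (by push_cast; omega), add_sub_cancel_right]
    · rw [w0] at h
      exact Finset.mem_coe.2 (Finset.mem_image.2 ⟨i, Finset.mem_Ico.2 ⟨hi.le, hi'⟩, h.symm⟩)
  · obtain ⟨hu, hue⟩ := H.exists_cut_apex hc
    obtain ⟨w, hw, hwe, hwi⟩ := hu.exists_remove (by omega) (by
      rw [setVertex_zero, setVertex_neg_one (by omega), setVertex_of_mem _ _ one_pos (by omega)])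
    have hwi' : ∀ i : ℤ, 0 ≤ i → i < m → w i = v (i + 1) := fun i h h' => by
      rw [hwi i h h', setVertex_of_mem _ _ (by omega) (by push_cast; omega)]
    have w0 : w (0 + -1) = v (-1) := by
      rw [← hw.1, hwi' _ (by omega) (by omega), ← H.simple.1 (-1)]
      congr 1
      push_cast
      ring
    refine H.toTriangle_of_cut hg hN rfl (hw.shift (-1))
      ((hue.trans hwe).trans (smoothingEquiv_shift (by omega) _ _)) (fun i hi hi' => ?_)
      (by rw [w0]; exact H.lt_left) (by rw [w0]; exact hd)
      (fun i hi hi' => ?_) fun v' => ih m N v' (by omega) (by omega)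
    · rw [hwi' _ (by omega) (by omega)]
      congr 1
      ring
    · rw [w0]
      exact (hg.ne (by omega) (by push_cast; omega)).symm

end LowestMax

theorem rt_reflect (p q z : Plane) : rt (reflect p) (reflect q) (reflect z) = -rt p q z := by
  simp only [rt, cross, reflect_apply, Prod.fst_sub, Prod.snd_sub]
  ring

theorem IsSimple.rt_ne_zero {n : ℕ} (hn : 4 ≤ n) {v : ℤ → Plane} (h : IsSimple n v)
    (h1 : (v 1).2 < (v (-1)).2) (h2 : (v (-1)).2 < (v 0).2) : rt (v 1) (v 0) (v (-1)) ≠ 0 := by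
  intro h0
  obtain ⟨τ, hτ, e⟩ := exists_lerp_of_rt (h1.trans h2) h0 h1.le h2.le
  have hx := interp_pos_part v (x := 1 - τ) (by linarith [hτ.2]) (by linarith [hτ.1])
  have hy := interp_int v (-1)
  rw [sub_sub_cancel, ← e, ← hy] at hx
  have hn' : (4:ℝ) ≤ n := by exact_mod_cast hn
  push_cast at hx
  rcases h.eq_or (by omega) (by linarith [hτ.2]) (by linarith [hτ.1]) hx.symm with h | h <;>
    linarith [hτ.1, hτ.2]

theorem IsSimple.toTriangle_of_lowest {n N : ℕ} (hn : 4 ≤ n) {v : ℤ → Plane} (h : IsSimple n v)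
    (hg : GenericHeights n v) (hN : LocMaxBound n v N) (h0 : LocMax v 0)
    (hlow : ∀ k, LocMax v k → (v 0).2 ≤ (v k).2) (h1 : (v 1).2 < (v (-1)).2)
    (ih : ∀ (n' N' : ℕ) (v' : ℤ → Plane), n' + N' < n + N → 3 ≤ n' → IsSimple n' v' →
      GenericHeights n' v' → LocMaxBound n' v' N' → ToTriangle n' v') : ToTriangle n v := by
  have h2 : (v (-1)).2 < (v 0).2 := by simpa using h0.1
  rcases (h.rt_ne_zero hn h1 h2).lt_or_gt with hr | hr
  · exact LowestMax.toTriangle ⟨hn, h, fun i => (hg.ne (by omega) (by omega)).symm, h2, h1, hlow, hr⟩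
      hg hN ih
  · refine ToTriangle.of_map reflect (LowestMax.toTriangle ⟨hn, h.map reflect,
      fun i => (hg.ne (by omega) (by omega)).symm, h2, h1, hlow, ?_⟩ hg hN ih)
    rw [rt_reflect]
    linarith

theorem ToTriangle.of_shift {n : ℕ} (hn : n ≠ 0) {v : ℤ → Plane} (j : ℤ)
    (h : ToTriangle n fun i => v (i + j)) : ToTriangle n v := by
  obtain ⟨w, h1, h2⟩ := h
  exact ⟨w, h1, (smoothingEquiv_shift hn v j).trans h2⟩

theorem ToTriangle.of_neg {n : ℕ} {v : ℤ → Plane}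
    (h : ToTriangle n fun i => v (-i)) : ToTriangle n v := by
  obtain ⟨w, h1, h2⟩ := h
  exact ⟨w, h1, (smoothingEquiv_neg v).trans h2⟩

theorem locMax_neg {v : ℤ → Plane} {i : ℤ} (h : LocMax (fun i => v (-i)) i) : LocMax v (-i) := by
  obtain ⟨h1, h2⟩ := h
  exact ⟨by rw [show -i - 1 = -(i + 1) by ring]; exact h2,
    by rw [show -i + 1 = -(i - 1) by ring]; exact h1⟩

theorem locMax_shift {v : ℤ → Plane} {i j : ℤ} :
    LocMax (fun i => v (i + j)) i ↔ LocMax v (i + j) := by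
  simp only [LocMax, sub_add_eq_add_sub, add_right_comm]

theorem LocMaxBound.neg {n N : ℕ} {v : ℤ → Plane} (h : LocMaxBound n v N) :
    LocMaxBound n (fun i => v (-i)) N := by
  obtain ⟨S, hS, h⟩ := h
  refine ⟨S.image Neg.neg, Finset.card_image_le.trans hS, fun i hi => ?_⟩
  obtain ⟨s, hs, hd⟩ := h _ (locMax_neg hi)
  refine ⟨-s, Finset.mem_image_of_mem _ hs, ?_⟩
  rwa [← dvd_neg, show -(i - -s) = -i - s by ring]

theorem LocMaxBound.shift {n N : ℕ} {v : ℤ → Plane} (h : LocMaxBound n v N) (j : ℤ) :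
    LocMaxBound n (fun i => v (i + j)) N := by
  obtain ⟨S, hS, h⟩ := h
  refine ⟨S.image (· - j), Finset.card_image_le.trans hS, fun i hi => ?_⟩
  obtain ⟨s, hs, hd⟩ := h _ (locMax_shift.1 hi)
  refine ⟨s - j, Finset.mem_image_of_mem _ hs, ?_⟩
  convert hd using 1
  ring

theorem GenericHeights.toTriangle (M : ℕ) : ∀ (n N : ℕ) (v : ℤ → Plane), n + N < M → 3 ≤ n →
    IsSimple n v → GenericHeights n v → LocMaxBound n v N → ToTriangle n v := by
  induction M with
  | zero => intro n N v h; omega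
  | succ M ih =>
    intro n N v hM hn h hg hN
    rcases hn.eq_or_lt with rfl | hn4
    · exact ⟨v, h, .refl _⟩
    obtain ⟨k, hk, hlow⟩ := exists_lowest_locMax hn h.1 hg
    refine ToTriangle.of_shift (by omega) k ?_
    have hg' : GenericHeights n fun i => v (i + k) := fun i j hij => by
      simpa using hg _ _ hij
    have h0' : LocMax (fun i => v (i + k)) 0 := locMax_shift.2 (by rwa [zero_add])
    have hlow' : ∀ j, LocMax (fun i => v (i + k)) j → (v (0 + k)).2 ≤ (v (j + k)).2 := fun j hj => by
      rw [zero_add]; exact hlow _ (locMax_shift.1 hj)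
    have ih' : ∀ (n' N' : ℕ) (v' : ℤ → Plane), n' + N' < n + N → 3 ≤ n' → IsSimple n' v' →
      GenericHeights n' v' → LocMaxBound n' v' N' → ToTriangle n' v' :=
      fun n' N' v' h => ih n' N' v' (by omega)
    rcases (hg.ne (i := 1 + k) (j := -1 + k) (by omega) (by omega)).lt_or_gt with hc | hc
    · exact (h.shift k).toTriangle_of_lowest hn4 hg' (hN.shift k) h0' hlow' hc ih'
    · refine ToTriangle.of_neg ((h.shift k).neg.toTriangle_of_lowest hn4 (fun i j hij => ?_)
        (hN.shift k).neg ?_ (fun j hj => hlow' _ (locMax_neg hj)) hc ih')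
      · have := hg' _ _ hij
        rwa [← dvd_neg, show -(-i - -j) = i - j by ring] at this
      · obtain ⟨a, b⟩ := h0'
        exact ⟨b, a⟩

theorem IsSimple.toTriangle {n : ℕ} (hn : 3 ≤ n) {v : ℤ → Plane} (h : IsSimple n v) :
    ToTriangle n v := by
  obtain ⟨ε, -, -, hg⟩ := h.exists_shear (by omega)
  refine ToTriangle.of_map (shear ε) (hg.toTriangle (n + n + 1) n n _ (by omega) hn (h.map _)
    ⟨Finset.Ico 0 n, by simp, fun i _ => ⟨i % n, ?_, Int.dvd_self_sub_emod⟩⟩)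
  exact Finset.mem_Ico.2 ⟨Int.emod_nonneg _ (by omega), Int.emod_lt_of_pos _ (by omega)⟩

theorem isSimple_three {v : ℤ → Plane} (hv : ∀ i, v (i + (3:ℕ)) = v i)
    (hc : cross (v 1 - v 0) (v 2 - v 0) ≠ 0) : IsSimple 3 v := by
  have hmod : ∀ i : ℤ, v i = v (i % (3:ℕ)) := fun i => eq_of_dvd_sub hv Int.dvd_self_sub_emod
  have hck : ∀ k : ℤ, cross (v (k + 1) - v k) (v (k + 2) - v k) ≠ 0 := by
    intro k
    have e1 := hmod k
    have e2 := hmod (k + 1)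
    have e3 := hmod (k + 2)
    simp only [cross, Prod.fst_sub, Prod.snd_sub] at hc ⊢
    have : k % 3 = 0 ∨ k % 3 = 1 ∨ k % 3 = 2 := by omega
    rcases this with h | h | h
    · rw [show k % (3:ℕ) = 0 by omega] at e1
      rw [show (k + 1) % (3:ℕ) = 1 by omega] at e2
      rw [show (k + 2) % (3:ℕ) = 2 by omega] at e3
      rw [e1, e2, e3]
      exact hc
    · rw [show k % (3:ℕ) = 1 by omega] at e1
      rw [show (k + 1) % (3:ℕ) = 2 by omega] at e2
      rw [show (k + 2) % (3:ℕ) = 0 by omega] at e3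
      rw [e1, e2, e3]
      convert hc using 1; ring
    · rw [show k % (3:ℕ) = 2 by omega] at e1
      rw [show (k + 1) % (3:ℕ) = 0 by omega] at e2
      rw [show (k + 2) % (3:ℕ) = 1 by omega] at e3
      rw [e1, e2, e3]
      convert hc using 1; ring
  have step : ∀ (k : ℤ) (f g : ℝ), f < 1 → 
      v k + f • (v (k + 1) - v k) ≠ v (k + 1) + g • (v (k + 2) - v (k + 1)) := by
    intro k f g hf e
    have h1 := congrArg Prod.fst e
    have h2 := congrArg Prod.snd e
    have hc := hck k
    simp only [cross, Prod.fst_add, Prod.snd_add, Prod.fst_sub, Prod.snd_sub, Prod.smul_fst,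
      Prod.smul_snd, smul_eq_mul] at h1 h2 hc
    have hg : g = 0 := by
      have : g * (((v (k + 1)).1 - (v k).1) * ((v (k + 2)).2 - (v k).2) -
          ((v (k + 2)).1 - (v k).1) * ((v (k + 1)).2 - (v k).2)) = 0 := by
        linear_combination ((v (k + 1)).2 - (v k).2) * h1 - ((v (k + 1)).1 - (v k).1) * h2
      rcases mul_eq_zero.1 this with h | h
      · exact h
      · exfalso; apply hc; linear_combination h
    have : (1 - f) * (((v (k + 1)).1 - (v k).1) * ((v (k + 2)).2 - (v k).2) -
          ((v (k + 2)).1 - (v k).1) * ((v (k + 1)).2 - (v k).2)) = 0 := by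
      rw [hg] at h1 h2
      linear_combination (-((v (k + 2)).2 - (v k).2)) * h1 + ((v (k + 2)).1 - (v k).1) * h2
    rcases mul_eq_zero.1 this with h | h
    · linarith
    · apply hc; linear_combination h
  refine ⟨hv, fun x y hxy => ?_⟩
  have ex := interp_eq v (Int.floor_le x) (Int.lt_floor_add_one x).le
  have ey := interp_eq v (Int.floor_le y) (Int.lt_floor_add_one y).le
  have hx1 := Int.lt_floor_add_one x
  have hy1 := Int.lt_floor_add_one y
  generalize ⌊x⌋ = k at *
  generalize ⌊y⌋ = l at *
  have form : ∀ (z : ℝ) (k : ℤ), (1 - (z - k)) • v k + (z - k) • v (k + 1) =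
      v k + (z - k) • (v (k + 1) - v k) := fun z k => by module
  rw [form] at ex ey
  rw [ex, ey] at hxy
  have : (k - l) % 3 = 0 ∨ (k - l) % 3 = 1 ∨ (k - l) % 3 = 2 := by omega
  rcases this with h | h | h
  · rw [eq_of_dvd_sub hv (i := k) (j := l) (by omega),
      eq_of_dvd_sub hv (i := k + 1) (j := l + 1) (by omega), add_right_inj] at hxy
    have hne : v (l + 1) - v l ≠ 0 := fun h0 => hck l (by rw [h0]; simp [cross])
    have := smul_left_injective ℝ hne hxy
    obtain ⟨m, hm⟩ : (3:ℤ) ∣ k - l := by omega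
    refine ⟨m, ?_⟩
    have hm' : (k:ℝ) - l = 3 * m := by exact_mod_cast hm
    push_cast
    linarith
  · refine absurd hxy.symm ?_
    rw [eq_of_dvd_sub hv (i := k) (j := l + 1) (by omega),
      eq_of_dvd_sub hv (i := k + 1) (j := l + 2) (by omega)]
    exact step l _ _ (by linarith)
  · refine absurd hxy ?_
    rw [eq_of_dvd_sub hv (i := l) (j := k + 1) (by omega),
      eq_of_dvd_sub hv (i := l + 1) (j := k + 2) (by omega)]
    exact step k _ _ (by linarith)

theorem IsSimple.cross_ne_zero {v : ℤ → Plane} (h : IsSimple 3 v) :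
    cross (v 1 - v 0) (v 2 - v 0) ≠ 0 := by
  intro hc
  obtain ⟨φ, a1, a2⟩ := h.exists_clm (by omega)
  obtain ⟨ψ, b1, b2⟩ := (h.shift 1).exists_clm (by omega)
  have e : v (-1) = v 2 := eq_of_dvd_sub h.1 (by norm_num)
  simp only [neg_add_cancel, zero_add] at b1 b2
  rw [one_add_one_eq_two] at b2
  rw [e] at a1
  have hd : v 1 - v 0 ≠ 0 := by
    intro h0
    rw [sub_eq_zero.1 h0] at a2
    exact lt_irrefl _ a2
  obtain ⟨μ, hμ⟩ : ∃ μ : ℝ, v 2 - v 0 = μ • (v 1 - v 0) := by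
    generalize v 1 - v 0 = p at hc hd
    generalize v 2 - v 0 = q at hc
    by_cases h0 : p.1 = 0
    · have h1 : p.2 ≠ 0 := fun h1 => hd (Prod.ext h0 h1)
      refine ⟨q.2 / p.2, Prod.ext ?_ ?_⟩
      · simp only [cross, h0, zero_mul, zero_sub, neg_eq_zero, mul_eq_zero, h1, false_or,
          Prod.smul_fst, smul_eq_mul, mul_zero] at hc ⊢
        exact hc
      · rw [Prod.smul_snd, smul_eq_mul, div_mul_cancel₀ _ h1]
    · refine ⟨q.1 / p.1, Prod.ext ?_ ?_⟩
      · rw [Prod.smul_fst, smul_eq_mul, div_mul_cancel₀ _ h0]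
      · simp only [cross, Prod.smul_snd, smul_eq_mul] at hc ⊢
        field_simp
        linarith
  have h1 := congrArg φ hμ
  have h2 := congrArg ψ hμ
  rw [map_smul, map_sub, map_sub, smul_eq_mul] at h1 h2
  have : μ < 0 := by
    by_contra! h'
    nlinarith
  nlinarith

/-- The triangle with vertices `a`, `a + p`, `a + q`. -/
def tri (a p q : Plane) (i : ℤ) : Plane := if i % 3 = 0 then a else if i % 3 = 1 then a + p else a + q

theorem smoothingEquiv_tri {a p q a' p' q' : Plane}
    (h : ∀ s ∈ Icc (0:ℝ) 1, cross (p + s • (p' - p)) (q + s • (q' - q)) ≠ 0) :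
    SmoothingEquiv (poly 3 (tri a p q)) (poly 3 (tri a' p' q')) := by
  have hper : ∀ a p q i, tri a p q (i + (3:ℕ)) = tri a p q i := by
    intro a p q i
    simp [tri]
  refine smoothingEquiv_of_linear (by omega) (hper _ _ _) (hper _ _ _) fun s hs =>
    isSimple_three (fun i => by rw [hper, hper]) ?_
  convert h s hs using 2
  · simp [tri]; module
  · simp [tri]; module

theorem smoothingEquiv_tri_std {a p q : Plane} (h : 0 < cross p q) :
    SmoothingEquiv (poly 3 (tri a p q)) (poly 3 (tri 0 (1, 0) (0, 1))) := by
  have left : ∀ {a a' p p' q : Plane}, 0 < cross p q → 0 < cross p' q →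
      SmoothingEquiv (poly 3 (tri a p q)) (poly 3 (tri a' p' q)) := by
    intro a a' p p' q h h'
    refine smoothingEquiv_tri fun s hs => ne_of_gt ?_
    rw [show cross (p + s • (p' - p)) (q + s • (q - q)) = (1 - s) * cross p q + s * cross p' q by
      simp only [cross, Prod.fst_add, Prod.snd_add, Prod.fst_sub, Prod.snd_sub, Prod.smul_fst,
        Prod.smul_snd, smul_eq_mul]
      ring]
    rcases hs.1.eq_or_lt with h0 | h0
    · rw [← h0]; linarith
    · have := mul_nonneg (sub_nonneg.2 hs.2) h.le
      have := mul_pos h0 h'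
      linarith
  have right : ∀ {a a' p q q' : Plane}, 0 < cross p q → 0 < cross p q' →
      SmoothingEquiv (poly 3 (tri a p q)) (poly 3 (tri a' p q')) := by
    intro a a' p q q' h h'
    refine smoothingEquiv_tri fun s hs => ne_of_gt ?_
    rw [show cross (p + s • (p - p)) (q + s • (q' - q)) = (1 - s) * cross p q + s * cross p q' by
      simp only [cross, Prod.fst_add, Prod.snd_add, Prod.fst_sub, Prod.snd_sub, Prod.smul_fst,
        Prod.smul_snd, smul_eq_mul]
      ring]
    rcases hs.1.eq_or_lt with h0 | h0
    · rw [← h0]; linarith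
    · have := mul_nonneg (sub_nonneg.2 hs.2) h.le
      have := mul_pos h0 h'
      linarith
  have main : ∀ {a p q : Plane}, 0 < cross p q → p.2 ≠ 0 →
      SmoothingEquiv (poly 3 (tri a p q)) (poly 3 (tri 0 (1, 0) (0, 1))) := by
    intro a p q h hp
    refine ((right (a' := 0) (q' := ((p.1 - 1) / p.2, 1)) h ?_).trans (left (a' := 0) (p' := (1, 0)) ?_ ?_)).trans
      (right (a' := 0) (q' := (0, 1)) ?_ ?_)
    all_goals simp only [cross]
    · field_simp; linarith
    · field_simp; linarith
    all_goals norm_num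
  by_cases hp : p.2 = 0
  · have hq : q.2 ≠ 0 := by
      intro hq
      simp [cross, hp, hq] at h
    have h' : 0 < cross (p + q) q := by
      simp only [cross, Prod.fst_add, Prod.snd_add] at h ⊢
      linarith
    exact (left (a' := 0) h h').trans (main h' (by simpa [hp] using hq))
  · exact main h hp

theorem eq_tri {v : ℤ → Plane} (hv : ∀ i, v (i + (3:ℕ)) = v i) :
    v = tri (v 0) (v 1 - v 0) (v 2 - v 0) := by
  funext i
  rw [eq_of_dvd_sub hv (i := i) (j := i % (3:ℕ)) Int.dvd_self_sub_emod, tri]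
  have : i % 3 = 0 ∨ i % 3 = 1 ∨ i % 3 = 2 := by omega
  rcases this with h | h | h <;> simp [h]

theorem IsSimple.smoothingEquiv {n m : ℕ} (hn : 3 ≤ n) (hm : 3 ≤ m) {v w : ℤ → Plane}
    (hv : IsSimple n v) (hw : IsSimple m w) : SmoothingEquiv (poly n v) (poly m w) := by
  have std : ∀ u, IsSimple 3 u → SmoothingEquiv (poly 3 u) (poly 3 (tri 0 (1, 0) (0, 1))) := by
    intro u hu
    rcases hu.cross_ne_zero.lt_or_gt with h | h
    · refine (smoothingEquiv_neg u).trans ?_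
      rw [eq_tri (v := fun i => u (-i)) hu.neg.1]
      refine smoothingEquiv_tri_std ?_
      rw [neg_zero, show u (-1) = u 2 from eq_of_dvd_sub hu.1 (by norm_num),
        show u (-2) = u 1 from eq_of_dvd_sub hu.1 (by norm_num)]
      simp only [cross] at h ⊢
      linarith
    · rw [eq_tri hu.1]
      exact smoothingEquiv_tri_std h
  obtain ⟨v', h1, h2⟩ := hv.toTriangle hn
  obtain ⟨w', h3, h4⟩ := hw.toTriangle hm
  exact (h2.trans (std _ h1)).trans (h4.trans (std _ h3)).symm

theorem uniform_continuity_of_periodic {f : ℝ → Plane} (hf : Continuous f)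
    (hper : ∀ t, f (t + 1) = f t) {ε : ℝ} (hε : 0 < ε) :
    ∃ δ > 0, ∀ x t, |x - t| ≤ δ → ‖f x - f t‖ ≤ ε := by
  have hu := (isCompact_Icc (a := (-1:ℝ)) (b := 2)).uniformContinuousOn_of_continuous hf.continuousOn
  obtain ⟨δ, hδ, h⟩ := Metric.uniformContinuousOn_iff.1 hu ε hε
  refine ⟨min (δ / 2) 1, by positivity, fun x t hxt => ?_⟩
  have h1 := hxt.trans (min_le_left _ _)
  obtain ⟨h2, h3⟩ := abs_le.1 (hxt.trans (min_le_right _ _))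
  have e : ∀ y : ℝ, f y = f (y - ⌊t⌋) := fun y => by
    have := periodic_add_int hper (y - ⌊t⌋) ⌊t⌋
    rw [← this]; congr 1; ring
  rw [e x, e t, ← dist_eq_norm]
  have := Int.floor_le t
  have := Int.lt_floor_add_one t
  refine (h _ ⟨by linarith, by linarith⟩ _ ⟨by linarith, by linarith⟩ ?_).le
  rw [Real.dist_eq, show x - ⌊t⌋ - (t - ⌊t⌋) = x - t by ring]
  linarith

theorem deriv_periodic {c : ℝ → Plane} (hper : ∀ t, c (t + 1) = c t) (t : ℝ) :
    deriv c (t + 1) = deriv c t := by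
  rw [← deriv_comp_add_const]
  simp [hper]

theorem IsSmoothEmb.exists_chord_lower {c : ℝ → Plane} (hc : IsSmoothEmb c) :
    ∃ κ > 0, (∀ t, κ ≤ ‖deriv c t‖) ∧ ∀ a b, |b - a| ≤ 1 / 2 → κ * |b - a| ≤ ‖c b - c a‖ := by
  obtain ⟨hs, hper, hd, hinj⟩ := hc
  have hds : ContDiff ℝ ∞ (deriv c) := (contDiff_infty_iff_deriv.1 hs).2
  set F : ℝ × ℝ → Plane := fun z => ∫ u in (0:ℝ)..1, deriv c (z.1 + u * z.2)
  have hF : ContDiff ℝ ∞ F := contDiff_intervalIntegral_param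
    (F := fun w : (ℝ × ℝ) × ℝ => deriv c (w.1.1 + w.2 * w.1.2)) (hds.comp (by fun_prop)) 0 1
  have hFe : ∀ a d, d • F (a, d) = c (a + d) - c a := by
    intro a d
    have h1 : ∀ u ∈ uIcc (0:ℝ) 1, HasDerivAt (fun u => c (a + u * d)) (d • deriv c (a + u * d)) u := by
      intro u _
      have h2 : HasDerivAt (fun u => a + u * d) d u := by
        simpa using ((hasDerivAt_id u).mul_const d).const_add a
      exact (hs.differentiable (by simp) _).hasDerivAt.scomp u h2
    have h3 := intervalIntegral.integral_eq_sub_of_hasDerivAt h1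
      (by apply Continuous.intervalIntegrable; have := hds.continuous; fun_prop)
    rw [intervalIntegral.integral_smul] at h3
    simpa [F] using h3
  have hF0 : ∀ a, F (a, 0) = deriv c a := fun a => by simp [F]
  have hne : ∀ z ∈ Icc (0:ℝ) 1 ×ˢ Icc (-(1/2):ℝ) (1/2), 0 < ‖F z‖ := by
    rintro ⟨a, d⟩ ⟨-, hd1, hd2⟩
    rw [norm_pos_iff]
    intro h0
    by_cases h : d = 0
    · subst h; exact hd a (by rw [← hF0, h0])
    · have := hFe a d
      rw [h0, smul_zero] at this
      obtain ⟨k, hk⟩ := hinj _ _ (sub_eq_zero.1 this.symm)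
      have hk1 : d = k := by linarith
      simp only at hd1 hd2
      rw [hk1] at hd1 hd2 h
      have h3 : (-1:ℝ) < k := by linarith
      have h4 : (k:ℝ) < 1 := by linarith
      have h5 : -1 < k := by exact_mod_cast h3
      have h6 : k < 1 := by exact_mod_cast h4
      exact h (by exact_mod_cast (by omega : k = 0))
  obtain ⟨κ, hκ, hκF⟩ := ((isCompact_Icc (a := (0:ℝ)) (b := 1)).prod
    (isCompact_Icc (a := (-(1/2):ℝ)) (b := 1/2))).exists_forall_le' hF.continuous.norm.continuousOn hne
  have key : ∀ a, ∀ d ∈ Icc (-(1/2):ℝ) (1/2), κ ≤ ‖F (a, d)‖ := by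
    intro a d hd'
    have : F (a, d) = F (Int.fract a, d) := by
      simp only [F]
      congr 1
      ext1 u
      rw [← periodic_add_int (deriv_periodic hper) (Int.fract a + u * d) ⌊a⌋]
      congr 1
      linarith [Int.floor_add_fract a]
    rw [this]
    exact hκF (_, d) ⟨⟨Int.fract_nonneg a, (Int.fract_lt_one a).le⟩, hd'⟩
  refine ⟨κ, hκ, fun t => by rw [← hF0]; exact key t 0 (by norm_num), fun a b hab => ?_⟩
  have h1 := hFe a (b - a)
  rw [add_sub_cancel] at h1
  rw [← h1, norm_smul, Real.norm_eq_abs, mul_comm]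
  exact mul_le_mul_of_nonneg_left (key a _ (abs_le.1 hab)) (abs_nonneg _)

theorem norm_dotL_le (d z : Plane) : |dotL d z| ≤ 2 * ‖d‖ * ‖z‖ := by
  rw [dotL_apply]
  have h1 := norm_fst_le d
  have h2 := norm_snd_le d
  have h3 := norm_fst_le z
  have h4 := norm_snd_le z
  rw [Real.norm_eq_abs] at h1 h2 h3 h4
  calc _ ≤ |d.1| * |z.1| + |d.2| * |z.2| := by rw [← abs_mul, ← abs_mul]; exact abs_add_le _ _
    _ ≤ ‖d‖ * ‖z‖ + ‖d‖ * ‖z‖ := by gcongr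
    _ = _ := by ring

theorem norm_sq_le_dotL_self (d : Plane) : ‖d‖ ^ 2 ≤ dotL d d := by
  rw [dotL_apply, Prod.norm_def, Real.norm_eq_abs, Real.norm_eq_abs]
  rcases max_cases |d.1| |d.2| with h | h <;> rw [h.1, sq_abs] <;>
    nlinarith [mul_self_nonneg d.1, mul_self_nonneg d.2]

theorem IsSmoothEmb.exists_tameFamily {c : ℝ → Plane} (hc : IsSmoothEmb c) :
    ∃ ε > 0, ∀ E : ℝ → Plane, (∀ t, E (t + 1) = E t) → (∀ a b, ‖E b - E a‖ ≤ ε * |b - a|) →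
      TameFamily fun s t => c t + s • E t := by
  obtain ⟨κ, hκ, hκd, hκc⟩ := hc.exists_chord_lower
  obtain ⟨hs, hper, hd, hinj⟩ := hc
  have hds : ContDiff ℝ ∞ (deriv c) := (contDiff_infty_iff_deriv.1 hs).2
  refine ⟨κ / 8, by positivity, fun E hE hL => ⟨?_, fun s t => by simp only [hE, hper], ?_, ?_⟩⟩
  · have : LipschitzWith (κ / 8).toNNReal E := LipschitzWith.of_dist_le_mul fun a b => by
      rw [dist_eq_norm, Real.dist_eq, Real.coe_toNNReal _ (by positivity)]; exact hL b a
    have h1 := this.continuous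
    have h2 := hs.continuous
    show Continuous fun z : ℝ × ℝ => c z.2 + z.1 • E z.2
    fun_prop
  · intro s hs' a b hab
    have e : ∀ x : ℝ, c (x + round (b - a)) + s • E (x + round (b - a)) = c x + s • E x := fun x => by
      rw [periodic_add_int hper, periodic_add_int hE]
    have h1 := e a
    set a' := a + round (b - a)
    have h2 := h1.trans hab
    have h3 : |b - a'| ≤ 1 / 2 := by
      rw [show b - a' = b - a - round (b - a) by simp [a']; ring]; exact abs_sub_round _
    have h4 := hκc a' b h3
    have h5 := hL a' b
    have h6 : c b - c a' = -(s • (E b - E a')) := by rw [smul_sub]; linear_combination (exp := 1) -h2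
    rw [h6, norm_neg, norm_smul, Real.norm_eq_abs, abs_of_nonneg hs'.1] at h4
    have h7 : s * ‖E b - E a'‖ ≤ 1 * (κ / 8 * |b - a'|) := by gcongr; exact hs'.2
    have h8 : |b - a'| ≤ 0 := by
      by_contra! h
      have : 0 < κ * |b - a'| := by positivity
      nlinarith
    have h9 := abs_nonpos_iff.1 h8
    refine ⟨-round (b - a), ?_⟩
    push_cast
    simp only [a'] at h9
    linarith
  · intro s₀ _ t₀
    set D := deriv c t₀
    have hD : 0 < ‖D‖ := norm_pos_iff.2 (hd t₀)
    have hev : ∀ᶠ t in 𝓝 t₀, ‖D‖ ^ 2 / 2 < dotL D (deriv c t) := by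
      have h1 : Continuous fun t => dotL D (deriv c t) := (dotL D).continuous.comp hds.continuous
      refine h1.continuousAt.eventually_const_lt ?_
      have := norm_sq_le_dotL_self D
      have : 0 < ‖D‖ ^ 2 := by positivity
      linarith
    obtain ⟨r, hr, hball⟩ := Metric.eventually_nhds_iff_ball.1 hev
    refine ⟨(4 / ‖D‖ ^ 2) • dotL D, r, hr, fun s hs' _ a b ha hb hab => ?_⟩
    have h1 : ‖D‖ ^ 2 / 2 * (b - a) ≤ dotL D (c b) - dotL D (c a) := by
      have hdiff : ∀ t, HasDerivAt (fun t => dotL D (c t)) (dotL D (deriv c t)) t := fun t =>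
        (dotL D).hasFDerivAt.comp_hasDerivAt t (hs.differentiable (by simp) t).hasDerivAt
      refine (convex_ball t₀ r).mul_sub_le_image_sub_of_le_deriv
        (f := fun t => dotL D (c t)) (fun t _ => (hdiff t).continuousAt.continuousWithinAt)
        (fun t _ => (hdiff t).differentiableAt.differentiableWithinAt) ?_ a ?_ b ?_ hab
      · intro t ht
        rw [(hdiff t).deriv]
        exact (hball t (interior_subset ht)).le
      · rwa [Metric.mem_ball, Real.dist_eq]
      · rwa [Metric.mem_ball, Real.dist_eq]
    have h2 : -(‖D‖ ^ 2 / 4 * (b - a)) ≤ s * dotL D (E b - E a) := by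
      have h3 := norm_dotL_le D (E b - E a)
      have h4 := hL a b
      rw [abs_of_nonneg (sub_nonneg.2 hab)] at h4
      have h5 : |s * dotL D (E b - E a)| ≤ ‖D‖ ^ 2 / 4 * (b - a) := by
        rw [abs_mul, abs_of_nonneg hs'.1]
        calc s * |dotL D (E b - E a)| ≤ 1 * (2 * ‖D‖ * (‖D‖ / 8 * (b - a))) := by
              refine mul_le_mul hs'.2 (h3.trans ?_) (abs_nonneg _) zero_le_one
              gcongr
              refine h4.trans ?_
              gcongr
              exact hκd t₀
          _ = _ := by ring
      exact (abs_le.1 h5).1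
    have h6 : dotL D (c b + s • E b - (c a + s • E a)) =
        dotL D (c b) - dotL D (c a) + s * dotL D (E b - E a) := by
      simp only [map_add, map_sub, map_smul, smul_eq_mul]; ring
    rw [smul_apply, h6, smul_eq_mul]
    calc b - a = 4 / ‖D‖ ^ 2 * (‖D‖ ^ 2 / 4 * (b - a)) := by field_simp
      _ ≤ _ := by gcongr; linarith

theorem IsSmoothEmb.loopEquiv_moll {c : ℝ → Plane} (hc : IsSmoothEmb c) :
    ∃ δ₀ > 0, ∀ δ ∈ Ioo 0 δ₀, LoopEquiv c (moll δ c) := by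
  obtain ⟨η, hη, h⟩ := hc.exists_isDiffeoC
  obtain ⟨hs, hper, hd, hinj⟩ := hc
  have hds : ContDiff ℝ ∞ (deriv c) := (contDiff_infty_iff_deriv.1 hs).2
  obtain ⟨δ₁, hδ₁, h1⟩ := uniform_continuity_of_periodic hs.continuous hper hη
  obtain ⟨δ₂, hδ₂, h2⟩ := uniform_continuity_of_periodic hds.continuous (deriv_periodic hper) hη
  refine ⟨min δ₁ (δ₂ / 2), by positivity, fun δ ⟨hδ, hδ'⟩ => ?_⟩
  have hl1 := hδ'.le.trans (min_le_left _ _)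
  have hl2 := hδ'.le.trans (min_le_right _ _)
  obtain ⟨Ψ, hΨ, he⟩ := h (moll δ c) (moll_contDiff hδ hs.continuous) (moll_periodic hper)
    (fun t => norm_moll_sub_self_le hδ hs.continuous fun u hu => h1 _ _ (by
      rw [show t - u - t = -u by ring, abs_neg]; linarith)) (fun t => by
    have hda := ((moll_contDiff hδ hs.continuous).differentiable (by simp) t).hasDerivAt
    have hdb := hda.sub ((hasDerivAt_id t).smul_const (deriv c t))
    rw [one_smul] at hdb
    refine hdb.le_of_lip' hη.le ?_
    filter_upwards [Metric.ball_mem_nhds t (half_pos hδ₂)] with x hx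
    rw [Metric.mem_ball, Real.dist_eq] at hx
    have e1 : moll δ c x = moll δ (fun y => c (y + (x - t))) t := by
      rw [moll_comp_add]; congr 1; ring
    have e2 : moll δ (fun y => c y + (x - t) • deriv c t) t = moll δ c t + (x - t) • deriv c t := by
      simp only [moll, smul_add]
      rw [integral_add (integrable_mollKer_smul hδ hs.continuous t)
        ((integrable_mollKer hδ).smul_const _), integral_smul_const, integral_mollKer hδ, one_smul]
    have e3 := norm_moll_sub_le hδ (P := fun y => c (y + (x - t)))
      (Q := fun y => c y + (x - t) • deriv c t) (by have := hs.continuous; fun_prop)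
      (by have := hs.continuous; fun_prop) (t := t) (η := η * |x - t|) (fun u hu => by
        have hg : ∀ y, HasDerivAt (fun y => c (t - u + y) - y • deriv c t)
            (deriv c (t - u + y) - (1:ℝ) • deriv c t) y := fun y => by
          refine HasDerivAt.sub ?_ ((hasDerivAt_id y).smul_const _)
          exact HasDerivAt.comp_const_add (t - u) y (hs.differentiable (by simp) _).hasDerivAt
        have h3 := (convex_uIcc (0:ℝ) (x - t)).norm_image_sub_le_of_norm_hasDerivWithin_le
          (C := η) (fun y _ => (hg y).hasDerivWithinAt) (fun y hy => by
            rw [one_smul]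
            apply h2
            have h4 : |y| ≤ |x - t| := by
              have := abs_sub_left_of_mem_uIcc hy
              simpa using this
            calc |t - u + y - t| = |y - u| := by congr 1; ring
              _ ≤ |y| + |u| := abs_sub _ _
              _ ≤ δ₂ := by linarith)
          (left_mem_uIcc) (right_mem_uIcc)
        rw [sub_zero, Real.norm_eq_abs] at h3
        refine le_of_eq_of_le ?_ h3
        congr 1
        simp only [add_zero, zero_smul, sub_zero]
        abel)
    rw [← e1, e2] at e3
    rw [Real.norm_eq_abs]
    refine le_of_eq_of_le ?_ e3
    congr 1
    simp only [Pi.sub_apply, sub_smul, id]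
    abel)
  exact .of_diffeo hΨ he

theorem IsSmoothEmb.exists_poly {c : ℝ → Plane} (hc : IsSmoothEmb c) :
    ∃ (n : ℕ) (v : ℤ → Plane), 3 ≤ n ∧ IsSimple n v ∧ SmoothingEquiv c (poly n v) := by
  obtain ⟨ε, hε, hT⟩ := hc.exists_tameFamily
  obtain ⟨hs, hper, hd, hinj⟩ := hc
  have hds : ContDiff ℝ ∞ (deriv c) := (contDiff_infty_iff_deriv.1 hs).2
  obtain ⟨δ, hδ, hunif⟩ := uniform_continuity_of_periodic hds.continuous (deriv_periodic hper) hε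
  obtain ⟨n₀, hn₀⟩ := exists_nat_gt (1 / δ)
  set n := n₀ + 3
  have hn0 : (0:ℝ) < n := by positivity
  have hnδ : 1 / (n:ℝ) ≤ δ := by
    have : (n₀:ℝ) ≤ n := by simp [n]
    rw [div_le_iff₀ hn0]
    rw [div_lt_iff₀ hδ] at hn₀
    nlinarith
  set v : ℤ → Plane := fun i => c (i / n)
  have hv : ∀ i, v (i + n) = v i := fun i => by
    simp only [v]
    push_cast
    rw [add_div, div_self hn0.ne', hper]
  set E : ℝ → Plane := fun t => poly n v t - c t
  have hpper : ∀ t, poly n v (t + 1) = poly n v t := fun t => by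
    rw [poly, poly, mul_add, mul_one, interp_periodic hv]
  have hEper : ∀ t, E (t + 1) = E t := fun t => by simp only [E, hpper, hper]
  have hpc := continuous_poly n v
  have hderiv : ∀ x, ∃ E', HasDerivWithinAt E E' (Ici x) x ∧ ‖E'‖ ≤ ε := by
    intro x
    set k := ⌊n * x⌋
    have hk1 : (k:ℝ) ≤ n * x := Int.floor_le _
    have hk2 : n * x < k + 1 := Int.lt_floor_add_one _
    refine ⟨(n:ℝ) • (v (k + 1) - v k) - deriv c x, ?_, ?_⟩
    · refine HasDerivWithinAt.sub ?_ (hs.differentiable (by simp) x).hasDerivAt.hasDerivWithinAt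
      have h1 : HasDerivAt (fun t : ℝ => v k + (n * t - k) • (v (k + 1) - v k))
          ((n:ℝ) • (v (k + 1) - v k)) x := by
        have h2 : HasDerivAt (fun t : ℝ => n * t - k) n x := by
          simpa using ((hasDerivAt_id x).const_mul (n:ℝ)).sub_const (k:ℝ)
        exact (h2.smul_const _).const_add _
      have e : ∀ t : ℝ, k ≤ n * t → n * t ≤ k + 1 → poly n v t = v k + (n * t - k) • (v (k + 1) - v k) := by
        intro t h2 h3
        rw [poly, interp_eq v h2 h3]
        module
      refine h1.hasDerivWithinAt.congr_of_eventuallyEq ?_ (e x hk1 hk2.le)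
      have h4 : ∀ᶠ t : ℝ in 𝓝 x, n * t < k + 1 :=
        (by fun_prop : Continuous fun t : ℝ => n * t).continuousAt.eventually_lt_const hk2
      filter_upwards [self_mem_nhdsWithin, mem_nhdsWithin_of_mem_nhds h4] with t ht1 ht2
      refine e t (hk1.trans ?_) (le_of_lt ht2)
      gcongr
      exact ht1
    · have hg : ∀ y, HasDerivAt (fun y => c y - y • deriv c x) (deriv c y - (1:ℝ) • deriv c x) y :=
        fun y => (hs.differentiable (by simp) y).hasDerivAt.sub ((hasDerivAt_id y).smul_const _)
      have hle : (k:ℝ) / n ≤ (k + 1) / n := by gcongr; linarith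
      have hx1 : (k:ℝ) / n ≤ x := by rw [div_le_iff₀ hn0]; linarith
      have hx2 : x ≤ (k + 1) / n := by rw [le_div_iff₀ hn0]; linarith
      have hgap : ((k:ℝ) + 1) / n - k / n = 1 / n := by ring
      have h3 := (convex_Icc ((k:ℝ) / n) ((k + 1) / n)).norm_image_sub_le_of_norm_hasDerivWithin_le
        (C := ε) (fun y _ => (hg y).hasDerivWithinAt) (fun y hy => by
          rw [one_smul]
          apply hunif
          rw [abs_le]
          constructor <;> linarith [hy.1, hy.2]) (left_mem_Icc.2 hle) (right_mem_Icc.2 hle)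
      rw [hgap, Real.norm_eq_abs, abs_of_pos (by positivity)] at h3
      have h5 : (n:ℝ) • (v (k + 1) - v k) - deriv c x = (n:ℝ) • (c ((k + 1) / n) - ((k + 1) / (n:ℝ)) • deriv c x -
          (c (k / n) - ((k:ℝ) / n) • deriv c x)) := by
        have h6 : deriv c x = (n:ℝ) • (((k + 1) / (n:ℝ)) • deriv c x - ((k:ℝ) / n) • deriv c x) := by
          rw [← sub_smul, hgap, smul_smul, mul_one_div_cancel hn0.ne', one_smul]
        conv_lhs => rw [h6]
        simp only [v]
        push_cast
        module
      rw [h5, norm_smul, Real.norm_eq_abs, abs_of_pos hn0]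
      calc _ ≤ n * (ε * (1 / n)) := by gcongr
        _ = ε := by field_simp
  choose E' hE' hE'n using hderiv
  have hEc : Continuous E := hpc.sub hs.continuous
  have hL : ∀ a b, a ≤ b → ‖E b - E a‖ ≤ ε * (b - a) := fun a b hab =>
    norm_image_sub_le_of_norm_deriv_right_le_segment hEc.continuousOn
      (fun x _ => hE' x) (fun x _ => hE'n x) b (right_mem_Icc.2 hab)
  have hT' := hT E hEper fun a b => by
    rcases le_total a b with h | h
    · rw [abs_of_nonneg (sub_nonneg.2 h)]; exact hL a b h
    · rw [norm_sub_rev, abs_sub_comm, abs_of_nonneg (sub_nonneg.2 h)]; exact hL b a h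
  have e1 : (fun t => c t + (1:ℝ) • E t) = poly n v := by ext1 t; simp [E]
  refine ⟨n, v, by omega, ⟨hv, fun x y hxy => ?_⟩, ?_⟩
  · have h1 := hT'.2.2.1 1 (by simp) (x / n) (y / n)
    have e2 : ∀ t, c t + (1:ℝ) • E t = poly n v t := fun t => congrFun e1 t
    beta_reduce at h1
    rw [e2, e2, poly, poly, mul_div_cancel₀ _ hn0.ne', mul_div_cancel₀ _ hn0.ne'] at h1
    obtain ⟨k, hk⟩ := h1 hxy
    refine ⟨k, ?_⟩
    field_simp at hk
    linarith
  · have h := hT'.smoothingEquiv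
    simp only [zero_smul, add_zero] at h
    rwa [e1] at h

/-- Any two smoothly embedded loops in the plane are related by a compactly supported
diffeomorphism, up to a rotation or reflection of the parameter. -/
theorem IsSmoothEmb.loopEquiv {c d : ℝ → Plane} (hc : IsSmoothEmb c) (hd : IsSmoothEmb d) :
    LoopEquiv c d := by
  obtain ⟨n, v, hn, hv, h1⟩ := hc.exists_poly
  obtain ⟨m, w, hm, hw, h2⟩ := hd.exists_poly
  obtain ⟨δ₀, hδ₀, h3⟩ := (h1.trans (hv.smoothingEquiv hn hm hw)).trans h2.symm
  obtain ⟨δ₁, hδ₁, h4⟩ := hc.loopEquiv_moll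
  obtain ⟨δ₂, hδ₂, h5⟩ := hd.loopEquiv_moll
  set δ := min δ₀ (min δ₁ δ₂) / 2
  have hm0 : 0 < min δ₀ (min δ₁ δ₂) := by positivity
  have hlt : δ < min δ₀ (min δ₁ δ₂) := by simp only [δ]; linarith
  have hpos : 0 < δ := by positivity
  exact ((h4 δ ⟨hpos, hlt.trans_le (by simp)⟩).trans (h3 δ ⟨hpos, hlt.trans_le (by simp)⟩)).trans
    (h5 δ ⟨hpos, hlt.trans_le (by simp)⟩).symm

/-- Rotation of the plane by the angle `φ`. -/
noncomputable def rot (φ : ℝ) (z : Plane) : Plane :=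
  (cos φ * z.1 - sin φ * z.2, sin φ * z.1 + cos φ * z.2)

/-- Rotation of the plane by a quarter turn. -/
def quarter (z : Plane) : Plane := (-z.2, z.1)

/-- The squared Euclidean norm. -/
def nsq (z : Plane) : ℝ := z.1 ^ 2 + z.2 ^ 2

theorem contDiff_nsq : ContDiff ℝ ∞ nsq := by unfold nsq; fun_prop

theorem contDiff_rot : ContDiff ℝ ∞ fun w : ℝ × Plane => rot w.1 w.2 := by
  unfold rot
  have h1 : ContDiff ℝ ∞ fun w : ℝ × Plane => cos w.1 := contDiff_cos.comp contDiff_fst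
  have h2 : ContDiff ℝ ∞ fun w : ℝ × Plane => sin w.1 := contDiff_sin.comp contDiff_fst
  fun_prop

theorem rot_zero (z : Plane) : rot 0 z = z := by simp [rot]

theorem rot_rot (a b : ℝ) (z : Plane) : rot a (rot b z) = rot (a + b) z := by
  ext <;> simp only [rot, cos_add, sin_add] <;> ring

theorem rot_add_two_pi (a : ℝ) (z : Plane) : rot (a + 2 * π) z = rot a z := by
  simp [rot]

theorem rot_add_int_mul_two_pi (a : ℝ) (k : ℤ) (z : Plane) : rot (a + k * (2 * π)) z = rot a z := by
  simp [rot]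

theorem nsq_rot (a : ℝ) (z : Plane) : nsq (rot a z) = nsq z := by
  simp only [rot, nsq]
  linear_combination (z.1 ^ 2 + z.2 ^ 2) * sin_sq_add_cos_sq a

theorem nsq_nonneg (z : Plane) : 0 ≤ nsq z := by unfold nsq; positivity

theorem nsq_eq_zero {z : Plane} : nsq z = 0 ↔ z = 0 := by
  refine ⟨fun h => ?_, fun h => by simp [h, nsq]⟩
  unfold nsq at h
  ext
  · simp only [Prod.fst_zero]; nlinarith [sq_nonneg z.1, sq_nonneg z.2]
  · simp only [Prod.snd_zero]; nlinarith [sq_nonneg z.1, sq_nonneg z.2]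

theorem nsq_pos {z : Plane} (hz : z ≠ 0) : 0 < nsq z :=
  (nsq_nonneg z).lt_of_ne fun h => hz (nsq_eq_zero.1 h.symm)

theorem nsq_smul (a : ℝ) (z : Plane) : nsq (a • z) = a ^ 2 * nsq z := by
  simp only [nsq, Prod.smul_fst, Prod.smul_snd, smul_eq_mul]; ring

theorem isCompact_nsq_le (r : ℝ) : IsCompact {z : Plane | nsq z ≤ r} := by
  refine Metric.isCompact_of_isClosed_isBounded (isClosed_le contDiff_nsq.continuous continuous_const) ?_
  refine (Metric.isBounded_closedBall (x := (0:Plane)) (r := |r| + 1)).subset fun z hz => ?_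
  rw [mem_closedBall_zero_iff, Prod.norm_def, Real.norm_eq_abs, Real.norm_eq_abs]
  have h : z.1 ^ 2 + z.2 ^ 2 ≤ r := hz
  have := le_abs_self r
  have h3 : ∀ x : ℝ, x ^ 2 ≤ r → |x| ≤ |r| + 1 := fun x hx =>
    abs_le_of_sq_le_sq (by nlinarith [abs_nonneg r]) (by positivity)
  exact max_le (h3 _ (by nlinarith)) (h3 _ (by nlinarith))

theorem exists_nsq_bound {K : Set Plane} (hK : IsCompact K) : ∃ r > 0, ∀ z, r ≤ nsq z → z ∉ K := by
  obtain ⟨C, hC⟩ := hK.bddAbove_image contDiff_nsq.continuous.continuousOn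
  refine ⟨|C| + 1, by positivity, fun z hz hzK => ?_⟩
  have := hC (mem_image_of_mem _ hzK)
  linarith [le_abs_self C]

theorem exists_rot (z : Plane) : ∃ φ, z = rot φ (√(nsq z), 0) := by
  set w : ℂ := ⟨z.1, z.2⟩
  refine ⟨w.arg, ?_⟩
  have h : ‖w‖ = √(nsq z) := by
    rw [Complex.norm_def, Complex.normSq_apply, nsq]
    simp only [w]
    ring_nf
  have h1 := Complex.norm_mul_cos_arg w
  have h2 := Complex.norm_mul_sin_arg w
  rw [h] at h1 h2
  ext
  · simp only [rot, mul_zero, sub_zero]; rw [mul_comm, h1]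
  · simp only [rot, mul_zero, add_zero]; rw [mul_comm, h2]

theorem exists_rot_of_nsq_eq {z w : Plane} (h : nsq z = nsq w) : ∃ φ, w = rot φ z := by
  obtain ⟨a, ha⟩ := exists_rot z
  obtain ⟨b, hb⟩ := exists_rot w
  refine ⟨b - a, ?_⟩
  rw [ha, hb, rot_rot, h, sub_add_cancel]

theorem exists_int_of_rot_eq {z : Plane} (hz : z ≠ 0) {a b : ℝ} (h : rot a z = rot b z) :
    ∃ k : ℤ, b = a + k * (2 * π) := by
  have hn := nsq_pos hz
  unfold nsq at hn
  have h1 := congrArg Prod.fst h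
  have h2 := congrArg Prod.snd h
  simp only [rot] at h1 h2
  have hc : cos b = cos a := by
    have : (z.1 ^ 2 + z.2 ^ 2) * (cos b - cos a) = 0 := by linear_combination -z.1 * h1 - z.2 * h2
    rcases mul_eq_zero.1 this with h | h <;> linarith
  have hs : sin b = sin a := by
    have : (z.1 ^ 2 + z.2 ^ 2) * (sin b - sin a) = 0 := by linear_combination z.2 * h1 - z.1 * h2
    rcases mul_eq_zero.1 this with h | h <;> linarith
  obtain ⟨k, hk⟩ := Real.Angle.angle_eq_iff_two_pi_dvd_sub.1 (Real.Angle.cos_sin_inj hc hs)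
  exact ⟨k, by linarith⟩

theorem hasDerivAt_rot (φ : ℝ) (z : Plane) :
    HasDerivAt (fun φ => rot φ z) (quarter (rot φ z)) φ := by
  have h1 := ((hasDerivAt_cos φ).mul_const z.1).sub ((hasDerivAt_sin φ).mul_const z.2)
  have h2 := ((hasDerivAt_sin φ).mul_const z.1).add ((hasDerivAt_cos φ).mul_const z.2)
  refine HasDerivAt.congr_deriv (f := fun φ => rot φ z) (h1.prodMk h2) ?_
  ext <;> simp only [quarter, rot] <;> ring

theorem clm_plane_apply (L : Plane →L[ℝ] ℝ) (z : Plane) : L z = z.1 * L (1, 0) + z.2 * L (0, 1) := by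
  have : z = z.1 • ((1, 0) : Plane) + z.2 • ((0, 1) : Plane) := by ext <;> simp
  calc L z = L (z.1 • ((1, 0) : Plane) + z.2 • ((0, 1) : Plane)) := by rw [← this]
    _ = _ := by simp only [map_add, map_smul, smul_eq_mul]

theorem det_fderiv_rot {α : Plane → ℝ} {z : Plane} (hd : DifferentiableAt ℝ α z) :
    (fderiv ℝ (fun z => rot (α z) z) z).det = 1 + fderiv ℝ α z (quarter z) := by
  have h := hd.hasFDerivAt
  have h1 : HasFDerivAt (fun z : Plane => z.1) (ContinuousLinearMap.fst ℝ ℝ ℝ) z := hasFDerivAt_fst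
  have h2 : HasFDerivAt (fun z : Plane => z.2) (ContinuousLinearMap.snd ℝ ℝ ℝ) z := hasFDerivAt_snd
  have h3 : HasFDerivAt (fun z => rot (α z) z) _ z :=
    ((h.cos.mul h1).sub (h.sin.mul h2)).prodMk ((h.sin.mul h1).add (h.cos.mul h2))
  rw [h3.fderiv, det_plane, clm_plane_apply _ (quarter z)]
  simp [quarter]
  linear_combination (1 - z.2 * fderiv ℝ α z (1, 0) + z.1 * fderiv ℝ α z (0, 1)) * sin_sq_add_cos_sq (α z)

theorem exists_isDiffeoC_scale {f : Plane → ℝ} (hf : ContDiff ℝ ∞ f) (hpos : ∀ z, 0 < f z)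
    (hrad : ∀ z, 0 < 2 * f z + fderiv ℝ f z z) (hK : ∃ K, IsCompact K ∧ ∀ z ∉ K, f z = 1) :
    ∃ Z : Plane ≃ Plane, IsDiffeoC Z ∧ (∀ z, Z z = √(f z) • z) ∧
      ∀ z, (fderiv ℝ Z z).det = f z + fderiv ℝ f z z / 2 := by
  have hd : ∀ z, HasFDerivAt f (fderiv ℝ f z) z := fun z =>
    (hf.differentiable (by simp) z).hasFDerivAt
  have hm : ContDiff ℝ ∞ fun z => √(f z) • z := (hf.sqrt fun z => (hpos z).ne').smul contDiff_id
  have hdet : ∀ z, (fderiv ℝ (fun z => √(f z) • z) z).det = f z + fderiv ℝ f z z / 2 := by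
    intro z
    have h1 := ((hd z).sqrt (hpos z).ne').smul (hasFDerivAt_id z)
    have h3 := sq_sqrt (hpos z).le
    have h4 := sqrt_pos.2 (hpos z)
    rw [HasFDerivAt.fderiv (f := fun z => √(f z) • z) h1, det_plane, clm_plane_apply _ z]
    simp
    field_simp
    linear_combination 4 * √(f z) ^ 2 * h3
  obtain ⟨Z, hZ, hZe⟩ := exists_isDiffeoC hm (fun z w hzw => by
    by_cases hw : w = 0
    · subst hw
      rw [smul_zero, smul_eq_zero] at hzw
      exact hzw.resolve_left (sqrt_pos.2 (hpos z)).ne'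
    set l := √(f w) / √(f z)
    have hz0 := sqrt_pos.2 (hpos z)
    have hw0 := sqrt_pos.2 (hpos w)
    have hl : 0 < l := by positivity
    have hz : z = l • w := by
      rw [show l = (√(f z))⁻¹ * √(f w) by simp only [l]; ring, mul_smul, ← hzw, smul_smul,
        inv_mul_cancel₀ hz0.ne', one_smul]
    have hder : ∀ t : ℝ, HasDerivAt (fun t : ℝ => t ^ 2 * f (t • w))
        (2 * t * f (t • w) + t ^ 2 * fderiv ℝ f (t • w) w) t := by
      intro t
      have h1 : HasDerivAt (fun t : ℝ => t • w) w t := by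
        simpa using (hasDerivAt_id t).smul_const w
      have h2 := (hasDerivAt_pow 2 t).mul ((hd (t • w)).comp_hasDerivAt t h1)
      refine HasDerivAt.congr_deriv (f := fun t : ℝ => t ^ 2 * f (t • w)) h2 ?_
      simp
    have hmono : StrictMonoOn (fun t : ℝ => t ^ 2 * f (t • w)) (Ioi 0) := by
      refine strictMonoOn_of_deriv_pos (convex_Ioi 0)
        (fun t _ => (hder t).continuousAt.continuousWithinAt) fun t ht => ?_
      rw [interior_Ioi] at ht
      rw [(hder t).deriv]
      have h1 := hrad (t • w)
      rw [map_smul, smul_eq_mul] at h1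
      have ht' : 0 < t := ht
      have := mul_pos ht' h1
      linarith
    have h1 : l = 1 := hmono.injOn hl (mem_Ioi.2 one_pos) (by
      rw [← hz, one_smul, one_pow, one_mul, ← sq_sqrt (hpos z).le, ← mul_pow,
        div_mul_cancel₀ _ hz0.ne', sq_sqrt (hpos w).le])
    rw [hz, h1, one_smul]) (fun z => by
      rw [hdet]
      have := hrad z
      linarith) (by
      obtain ⟨K, hK, h⟩ := hK
      exact ⟨K, hK, fun z hz => by simp [h z hz]⟩)
  exact ⟨Z, hZ, fun z => by rw [hZe], fun z => by rw [hZe, hdet]⟩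

theorem exists_isDiffeoC_twist {α : Plane → ℝ} (hα : ContDiff ℝ ∞ α)
    (hpos : ∀ z, 0 < 1 + fderiv ℝ α z (quarter z)) (hK : ∃ K, IsCompact K ∧ ∀ z ∉ K, α z = 0) :
    ∃ T : Plane ≃ Plane, IsDiffeoC T ∧ (∀ z, T z = rot (α z) z) ∧
      ∀ z, (fderiv ℝ T z).det = 1 + fderiv ℝ α z (quarter z) := by
  have hd : ∀ z, HasFDerivAt α (fderiv ℝ α z) z := fun z =>
    (hα.differentiable (by simp) z).hasFDerivAt
  have hm : ContDiff ℝ ∞ fun z => rot (α z) z :=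
    contDiff_rot.comp (f := fun z => (α z, z)) (hα.prodMk contDiff_id)
  have hdet := fun z => det_fderiv_rot (hd z).differentiableAt
  have hinj : Function.Injective fun z => rot (α z) z := by
    intro z w hzw
    beta_reduce at hzw
    have hn : nsq z = nsq w := by rw [← nsq_rot (α z), hzw, nsq_rot]
    obtain ⟨φ, hφ⟩ := exists_rot_of_nsq_eq hn
    by_cases hz : z = 0
    · subst hz
      rw [hφ]
      ext <;> simp [rot]
    have hder : ∀ t, HasDerivAt (fun t => t + α (rot t z))
        (1 + fderiv ℝ α (rot t z) (quarter (rot t z))) t := fun t =>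
      (hasDerivAt_id t).add ((hd (rot t z)).comp_hasDerivAt t (hasDerivAt_rot t z))
    have hmono : StrictMono fun t => t + α (rot t z) :=
      strictMono_of_hasDerivAt_pos hder fun t => hpos _
    rw [hφ, rot_rot] at hzw
    obtain ⟨k, hk⟩ := exists_int_of_rot_eq hz hzw
    have h1 := rot_add_int_mul_two_pi 0 k z
    rw [rot_zero, zero_add] at h1
    have h2 : φ = k * (2 * π) := hmono.injective (by
      rw [h1]; linarith)
    rw [hφ, h2, h1]
  have hsupp : ∃ K, IsCompact K ∧ ∀ z ∉ K, rot (α z) z = z := by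
    obtain ⟨K, hK, h⟩ := hK
    exact ⟨K, hK, fun z hz => by rw [h z hz, rot_zero]⟩
  obtain ⟨T, hT, hTe⟩ := exists_isDiffeoC hm hinj (fun z => by rw [hdet]; exact (hpos z).ne') hsupp
  exact ⟨T, hT, fun z => by rw [hTe], fun z => by rw [hTe, hdet]⟩

theorem hasFDerivAt_nsq (z : Plane) : HasFDerivAt nsq (2 • dotL z) z := by
  have h1 : HasFDerivAt (fun z : Plane => z.1) (ContinuousLinearMap.fst ℝ ℝ ℝ) z := hasFDerivAt_fst
  have h2 : HasFDerivAt (fun z : Plane => z.2) (ContinuousLinearMap.snd ℝ ℝ ℝ) z := hasFDerivAt_snd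
  have h3 : HasFDerivAt nsq _ z := (h1.pow 2).add (h2.pow 2)
  refine h3.congr_fderiv ?_
  ext <;> simp

theorem fderiv_nsq_self (z : Plane) : fderiv ℝ nsq z z = 2 * nsq z := by
  rw [(hasFDerivAt_nsq z).fderiv]
  simp [nsq]; ring

/-- Second order Taylor formula with integral remainder. -/
theorem taylor_two {q : Plane → ℝ} (hq : ContDiff ℝ ∞ q) (y v : Plane) :
    q (y + v) = q y + fderiv ℝ q y v +
      ∫ t in (0:ℝ)..1, (1 - t) * fderiv ℝ (fderiv ℝ q) (y + t • v) v v := by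
  have hq1 : ContDiff ℝ ∞ (fderiv ℝ q) := hq.fderiv_right (by simp)
  have hl : ∀ t : ℝ, HasDerivAt (fun t : ℝ => y + t • v) v t := fun t => by
    simpa using ((hasDerivAt_id t).smul_const v).const_add y
  have h1 : ∀ t : ℝ, HasDerivAt (fun t : ℝ => q (y + t • v)) (fderiv ℝ q (y + t • v) v) t := fun t =>
    (hq.differentiable (by simp) _).hasFDerivAt.comp_hasDerivAt t (hl t)
  have h2 : ∀ t : ℝ, HasDerivAt (fun t : ℝ => fderiv ℝ q (y + t • v) v)
      (fderiv ℝ (fderiv ℝ q) (y + t • v) v v) t := fun t => by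
    have h3 := (hq1.differentiable (by simp) (y + t • v)).hasFDerivAt.comp_hasDerivAt t (hl t)
    have h4 := h3.clm_apply (hasDerivAt_const t v)
    refine h4.congr_deriv ?_
    simp
  have h5 : ∀ t ∈ uIcc (0:ℝ) 1, HasDerivAt
      (fun t : ℝ => q (y + t • v) + (1 - t) * fderiv ℝ q (y + t • v) v)
      ((1 - t) * fderiv ℝ (fderiv ℝ q) (y + t • v) v v) t := fun t _ => by
    have h6 := (h1 t).add (((hasDerivAt_id t).const_sub 1).mul (h2 t))
    refine HasDerivAt.congr_deriv (f := fun t : ℝ => q (y + t • v) + (1 - t) * fderiv ℝ q (y + t • v) v) h6 ?_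
    simp
  rw [intervalIntegral.integral_eq_sub_of_hasDerivAt h5]
  · simp
  · apply Continuous.intervalIntegrable
    have hq2 : Continuous (fderiv ℝ (fderiv ℝ q)) := hq1.continuous_fderiv (by simp)
    have : Continuous fun t : ℝ => fderiv ℝ (fderiv ℝ q) (y + t • v) v v :=
      ((hq2.comp (by fun_prop : Continuous fun t : ℝ => y + t • v)).clm_apply continuous_const).clm_apply
        continuous_const
    fun_prop

theorem contDiff_taylor_remainder {q : Plane → ℝ} (hq : ContDiff ℝ ∞ q) :
    ContDiff ℝ ∞ fun w : Plane × Plane × Plane =>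
      ∫ t in (0:ℝ)..1, (1 - t) * fderiv ℝ (fderiv ℝ q) (w.1 + t • w.2.1) w.2.2 w.2.2 := by
  have hq1 : ContDiff ℝ ∞ (fderiv ℝ q) := hq.fderiv_right (by simp)
  have hq2 : ContDiff ℝ ∞ (fderiv ℝ (fderiv ℝ q)) := hq1.fderiv_right (by simp)
  refine contDiff_intervalIntegral_param (F := fun w : (Plane × Plane × Plane) × ℝ =>
      (1 - w.2) * fderiv ℝ (fderiv ℝ q) (w.1.1 + w.2 • w.1.2.1) w.1.2.2 w.1.2.2) ?_ 0 1
  have h1 : ContDiff ℝ ∞ fun w : (Plane × Plane × Plane) × ℝ =>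
      fderiv ℝ (fderiv ℝ q) (w.1.1 + w.2 • w.1.2.1) := hq2.comp (by fun_prop)
  have h2 := (h1.clm_apply (g := fun w => w.1.2.2) (by fun_prop)).clm_apply (g := fun w => w.1.2.2) (by fun_prop)
  have h3 : ContDiff ℝ ∞ fun w : (Plane × Plane × Plane) × ℝ => 1 - w.2 := by fun_prop
  exact h3.mul h2

/-- Division of a function with a critical circle of minima by the square of `nsq - R`. -/
theorem exists_quotient {q : Plane → ℝ} (hq : ContDiff ℝ ∞ q) {R b₀ : ℝ} (hR : 0 < R)
    (hval : ∀ y, nsq y = R → q y = b₀) (hcrit : ∀ y, nsq y = R → fderiv ℝ q y = 0) :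
    ∃ W : Plane → ℝ, ContDiffOn ℝ ∞ W {0}ᶜ ∧ (∀ z ≠ 0, q z = b₀ + (nsq z - R) ^ 2 * W z) ∧
      ∀ y, nsq y = R → W y = 1 / (8 * R ^ 2) * fderiv ℝ (fderiv ℝ q) y y y := by
  set T : Plane × Plane × Plane → ℝ := fun w =>
      ∫ t in (0:ℝ)..1, (1 - t) * fderiv ℝ (fderiv ℝ q) (w.1 + t • w.2.1) w.2.2 w.2.2 with hT
  have hTs : ContDiff ℝ ∞ T := contDiff_taylor_remainder hq
  have hns : ContDiffOn ℝ ∞ (fun z => √(nsq z)) {0}ᶜ :=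
    contDiff_nsq.contDiffOn.sqrt fun z hz => (nsq_pos hz).ne'
  have hsR := sqrt_pos.2 hR
  refine ⟨fun z => 1 / (√(nsq z) * (√(nsq z) + √R)) ^ 2 *
    T ((√R / √(nsq z)) • z, (1 - √R / √(nsq z)) • z, z), ?_, fun z hz => ?_, fun y hy => ?_⟩
  · have h1 : ContDiffOn ℝ ∞ (fun z => √R / √(nsq z)) {0}ᶜ :=
      contDiffOn_const.div hns fun z hz => (sqrt_pos.2 (nsq_pos hz)).ne'
    refine ContDiffOn.mul ?_ (hTs.comp_contDiffOn ?_)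
    · refine contDiffOn_const.div ((hns.mul (hns.add contDiffOn_const)).pow 2) fun z hz => ?_
      have := sqrt_pos.2 (nsq_pos hz)
      positivity
    · exact (h1.smul contDiffOn_id).prodMk (((contDiffOn_const.sub h1).smul contDiffOn_id).prodMk contDiffOn_id)
  · have hs := sqrt_pos.2 (nsq_pos hz)
    have hss := sq_sqrt (nsq_nonneg z)
    have hRR := sq_sqrt hR.le
    set s := √(nsq z)
    have hy : nsq ((√R / s) • z) = R := by
      rw [nsq_smul, ← hss, div_pow, div_mul_cancel₀ _ (by positivity), hRR]
    have h1 := taylor_two hq ((√R / s) • z) ((1 - √R / s) • z)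
    rw [← add_smul, add_sub_cancel, one_smul, hval _ hy, hcrit _ hy] at h1
    have h2 : (∫ t in (0:ℝ)..1, (1 - t) * fderiv ℝ (fderiv ℝ q) ((√R / s) • z + t • ((1 - √R / s) • z))
        ((1 - √R / s) • z) ((1 - √R / s) • z)) = (1 - √R / s) ^ 2 * T ((√R / s) • z, (1 - √R / s) • z, z) := by
      rw [hT, ← intervalIntegral.integral_const_mul]
      congr 1
      ext1 t
      simp only [map_smul, smul_apply, smul_eq_mul]
      ring
    rw [h2, zero_apply, add_zero] at h1
    change q z = b₀ + (nsq z - R) ^ 2 * (1 / (s * (s + √R)) ^ 2 * T ((√R / s) • z, (1 - √R / s) • z, z))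
    have h3 : nsq z - R = (s - √R) * (s + √R) := by rw [← hss]; linear_combination hRR
    rw [h1, h3]
    generalize T ((√R / s) • z, (1 - √R / s) • z, z) = X
    field_simp
  · have hs : √R / √R = 1 := div_self hsR.ne'
    have hRR := sq_sqrt hR.le
    simp only [hy, hs, one_smul, sub_self, zero_smul, hT, smul_zero, add_zero]
    rw [intervalIntegral.integral_mul_const]
    have : ∫ t in (0:ℝ)..1, (1 - t) = 1 / 2 := by
      rw [intervalIntegral.integral_sub (by simp) (by simp)]
      norm_num
    rw [this, show √R * (√R + √R) = 2 * √R ^ 2 by ring, hRR]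
    field_simp
    ring

theorem exists_annulus_subset {U : Set Plane} (hU : IsOpen U) {R : ℝ} (h : ∀ y, nsq y = R → y ∈ U) :
    ∃ δ > 0, ∀ z, |nsq z - R| ≤ δ → z ∈ U := by
  have hK : IsCompact ({z | nsq z ≤ R + 1} \ U) := (isCompact_nsq_le _).diff hU
  have hc : ContinuousOn (fun z => |nsq z - R|) ({z | nsq z ≤ R + 1} \ U) :=
    ((contDiff_nsq.continuous.sub continuous_const).abs).continuousOn
  obtain ⟨d, hd, hdm⟩ := hK.exists_forall_le' hc (a := 0) fun z hz =>
    abs_pos.2 fun h0 => hz.2 (h z (by linarith))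
  refine ⟨min (d / 2) 1, by positivity, fun z hz => ?_⟩
  by_contra hzU
  have h1 := hz.trans (min_le_left _ _)
  have h2 := (abs_le.1 (hz.trans (min_le_right _ _))).2
  have h3 := hdm z ⟨by simp only [mem_ofPred_eq]; linarith, hzU⟩
  linarith

theorem exists_radial_normalisation {q : Plane → ℝ} (hq : ContDiff ℝ ∞ q) {R b₀ : ℝ} (hR : 0 < R)
    (hval : ∀ y, nsq y = R → q y = b₀) {Ω : Set Plane} (hΩ : IsOpen Ω)
    (hsub : ∀ y, nsq y = R → y ∈ Ω) (hmin : ∀ y ∈ Ω, nsq y ≠ R → b₀ < q y)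
    (hnd : ∀ y, nsq y = R → fderiv ℝ (fderiv ℝ q) y y y ≠ 0) :
    ∃ (Φ : Plane ≃ Plane) (μ ε : ℝ), IsDiffeoC Φ ∧ 0 < μ ∧ 0 < ε ∧ (∀ y, nsq y = R → Φ y = y) ∧
      ∀ z, |nsq z - R| < ε → q (Φ.symm z) = b₀ + ((nsq z - R) / μ) ^ 2 := by
  have hcrit : ∀ y, nsq y = R → fderiv ℝ q y = 0 := fun y hy => by
    apply IsLocalMin.fderiv_eq_zero
    filter_upwards [hΩ.mem_nhds (hsub y hy)] with z hz
    rw [hval y hy]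
    by_cases h : nsq z = R
    · rw [hval z h]
    · exact (hmin z hz h).le
  have hS0 : ∀ y, nsq y = R → y ≠ 0 := fun y hy h0 => by
    rw [nsq_eq_zero.2 h0] at hy; linarith
  obtain ⟨W, hWs, hqW, hWS⟩ := exists_quotient hq hR hval hcrit
  have hopen0 : IsOpen ({0}ᶜ : Set Plane) := isOpen_compl_singleton
  have hWpos : ∀ y, nsq y = R → 0 < W y := by
    intro y hy
    have hne : W y ≠ 0 := by
      rw [hWS y hy]
      exact mul_ne_zero (by positivity) (hnd y hy)
    refine lt_of_le_of_ne ?_ hne.symm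
    by_contra! hneg
    have hWc : ContinuousAt W y := hWs.continuousOn.continuousAt (hopen0.mem_nhds (hS0 y hy))
    have hev : ∀ᶠ z in 𝓝 y, W z < 0 ∧ z ∈ Ω ∧ z ∈ ({0}ᶜ : Set Plane) :=
      by
      filter_upwards [hWc.eventually_lt_const hneg, hΩ.mem_nhds (hsub y hy),
        hopen0.mem_nhds (hS0 y hy)] with z h1 h2 h3 using ⟨h1, h2, h3⟩
    have hl : Tendsto (fun l : ℝ => l • y) (𝓝[>] 1) (𝓝 y) := by
      have : Tendsto (fun l : ℝ => l • y) (𝓝 1) (𝓝 ((1:ℝ) • y)) :=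
        (by fun_prop : Continuous fun l : ℝ => l • y).continuousAt
      rw [one_smul] at this
      exact this.mono_left nhdsWithin_le_nhds
    obtain ⟨l, ⟨h1, h2, h3⟩, hl1⟩ := ((hl.eventually hev).and self_mem_nhdsWithin).exists
    have hl1' : 1 < l := hl1
    have h4 : nsq (l • y) ≠ R := by
      rw [nsq_smul, hy]
      have : R < l ^ 2 * R := lt_mul_of_one_lt_left hR (by nlinarith)
      exact this.ne'
    have h5 := hmin _ h2 h4
    rw [hqW _ h3] at h5
    nlinarith [sq_nonneg (nsq (l • y) - R)]
  set V : Plane → ℝ := fun z => √(W z)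
  have hU1 : IsOpen {z : Plane | z ∈ ({0}ᶜ : Set Plane) ∧ 0 < W z} := by
    have := hWs.continuousOn.isOpen_inter_preimage hopen0 (isOpen_Ioi (a := (0:ℝ)))
    exact this
  set U1 := {z : Plane | z ∈ ({0}ᶜ : Set Plane) ∧ 0 < W z}
  have hVs : ContDiffOn ℝ ∞ V U1 := (hWs.mono fun z hz => hz.1).sqrt fun z hz => hz.2.ne'
  set P : Plane → ℝ := fun z => 2 * nsq z * V z + (nsq z - R) * fderiv ℝ V z z
  have hnc := contDiff_nsq.continuous
  have hPc : ContinuousOn P U1 := by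
    have h1 := (hVs.continuousOn_fderiv_of_isOpen hU1 (by simp)).clm_apply (continuousOn_id)
    have h2 := hVs.continuousOn
    have h3 := hnc.continuousOn (s := U1)
    exact ((continuousOn_const.mul h3).mul h2).add ((h3.sub continuousOn_const).mul h1)
  have hU2 : IsOpen (U1 ∩ P ⁻¹' Ioi 0) := hPc.isOpen_inter_preimage hU1 isOpen_Ioi
  have hV0 : ∀ z ∈ U1, 0 < V z := fun z hz => sqrt_pos.2 hz.2
  obtain ⟨δ, hδ, hδU⟩ := exists_annulus_subset hU2 (R := R) fun y hy => by
    have h1 : y ∈ U1 := ⟨hS0 y hy, hWpos y hy⟩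
    refine ⟨h1, ?_⟩
    have := hV0 y h1
    simp only [P, mem_preimage, mem_Ioi, hy, sub_self, zero_mul, add_zero]
    positivity
  have hKc : IsCompact {z : Plane | |nsq z - R| ≤ δ} := by
    refine (isCompact_nsq_le (R + δ)).of_isClosed_subset
      (isClosed_le ((hnc.sub continuous_const).abs) continuous_const) fun z hz => ?_
    have := (abs_le.1 (show |nsq z - R| ≤ δ from hz)).2
    simp only [mem_ofPred_eq]; linarith
  obtain ⟨C, hC⟩ := hKc.bddAbove_image (hVs.continuousOn.mono fun z hz => (hδU z hz).1)
  set μ := 1 / (|C| + 1)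
  have hμ : 0 < μ := by positivity
  have hμV : ∀ z, |nsq z - R| ≤ δ → μ * V z ≤ 1 := fun z hz => by
    have h1 : V z ≤ C := hC (mem_image_of_mem _ hz)
    have h2 := le_abs_self C
    simp only [μ]
    rw [one_div, inv_mul_le_one₀ (by positivity)]
    linarith
  set X : Plane → ℝ := fun z => smoothTransition (2 - 4 * (nsq z - R) ^ 2 * (δ ^ 2)⁻¹)
  have hXs : ContDiff ℝ ∞ X := by
    have h1 : ContDiff ℝ ∞ smoothTransition := smoothTransition.contDiff
    have h2 := contDiff_nsq
    exact h1.comp (by fun_prop)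
  have hX0 : ∀ z, 0 ≤ X z := fun z => smoothTransition.nonneg _
  have hX1 : ∀ z, X z ≤ 1 := fun z => smoothTransition.le_one _
  have hXfar : ∀ z, δ ^ 2 / 2 ≤ (nsq z - R) ^ 2 → X z = 0 := fun z hz => by
    apply smoothTransition.zero_of_nonpos
    rw [sub_nonpos, ← div_eq_mul_inv, le_div_iff₀ (by positivity)]
    linarith
  have hXnear : ∀ z, |nsq z - R| ≤ δ / 2 → X z = 1 := fun z hz => by
    apply smoothTransition.one_of_one_le
    have : (nsq z - R) ^ 2 ≤ (δ / 2) ^ 2 := sq_le_sq.2 (by rwa [abs_of_pos (half_pos hδ)])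
    rw [le_sub_comm, ← div_eq_mul_inv, div_le_iff₀ (by positivity)]
    linarith
  have hDX : ∀ z, (nsq z - R) * fderiv ℝ X z z ≤ 0 := by
    intro z
    have h1 : HasFDerivAt (fun z => 2 - 4 * (nsq z - R) ^ 2 * (δ ^ 2)⁻¹) _ z :=
      (((((hasFDerivAt_nsq z).sub_const R).pow 2).const_mul 4).mul_const (δ ^ 2)⁻¹).const_sub 2
    have hsd : HasDerivAt smoothTransition (deriv smoothTransition (2 - 4 * (nsq z - R) ^ 2 * (δ ^ 2)⁻¹))
        (2 - 4 * (nsq z - R) ^ 2 * (δ ^ 2)⁻¹) :=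
      ((smoothTransition.contDiff (n := 1)).differentiable (by simp) _).hasDerivAt
    have h2 := hsd.comp_hasFDerivAt z h1
    change HasFDerivAt X _ z at h2
    have h3 : 0 ≤ deriv smoothTransition (2 - 4 * (nsq z - R) ^ 2 * (δ ^ 2)⁻¹) :=
      smoothTransition.monotone.deriv_nonneg
    have h4 := nsq_nonneg z
    rw [h2.fderiv]
    generalize deriv smoothTransition (2 - 4 * (nsq z - R) ^ 2 * (δ ^ 2)⁻¹) = s at h3
    have h5 : dotL z z = nsq z := by simp [nsq]; ring
    simp only [neg_apply, smul_apply, h5, smul_eq_mul, nsmul_eq_mul]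
    have h6 : 0 ≤ (nsq z - R) ^ 2 / δ ^ 2 * nsq z * s := by positivity
    calc _ = -16 * ((nsq z - R) ^ 2 / δ ^ 2 * nsq z * s) := by
          simp; field_simp; ring
      _ ≤ 0 := by linarith
  set f : Plane → ℝ := fun z => 1 + X z * (nsq z - R) * (μ * V z - 1) / nsq z
  have hfar : ∀ z, δ < |nsq z - R| ∨ |nsq z - R| = δ → f =ᶠ[𝓝 z] fun _ => 1 := by
    intro z hz
    have h1 : δ ^ 2 / 2 < (nsq z - R) ^ 2 := by
      rw [← sq_abs (nsq z - R)]
      rcases hz with h | h <;> nlinarith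
    have h2 : Continuous fun z => (nsq z - R) ^ 2 := by fun_prop
    filter_upwards [h2.continuousAt.eventually_const_lt h1] with w hw
    simp only [f]
    rw [hXfar w hw.le]
    simp
  have hcase : ∀ z, |nsq z - R| < δ ∨ (δ < |nsq z - R| ∨ |nsq z - R| = δ) := fun z => by
    rcases lt_trichotomy |nsq z - R| δ with h | h | h <;> simp [h]
  have hVat : ∀ z, |nsq z - R| < δ → ContDiffAt ℝ ∞ V z := fun z hz =>
    hVs.contDiffAt (hU1.mem_nhds (hδU z hz.le).1)
  have hfs : ContDiff ℝ ∞ f := by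
    rw [contDiff_iff_contDiffAt]
    intro z
    rcases hcase z with h | h
    · have hn : nsq z ≠ 0 := (nsq_pos (hδU z h.le).1.1).ne'
      have h1 := hXs.contDiffAt (x := z)
      have h2 := contDiff_nsq.contDiffAt (x := z)
      exact contDiffAt_const.add (((h1.mul (h2.sub contDiffAt_const)).mul
        ((contDiffAt_const.mul (hVat z h)).sub contDiffAt_const)).div h2 hn)
    · exact contDiffAt_const.congr_of_eventuallyEq (hfar z h)
  have hfn : ∀ z, z ≠ 0 → nsq z * f z = nsq z + X z * (nsq z - R) * (μ * V z - 1) := fun z hz => by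
    have := (nsq_pos hz).ne'
    simp only [f]
    field_simp
  have hfpos : ∀ z, 0 < f z := by
    intro z
    rcases hcase z with h | h
    · have hU := (hδU z h.le).1
      have hn := nsq_pos hU.1
      refine pos_of_mul_pos_right ?_ hn.le
      rw [hfn z hU.1]
      have h1 := mul_pos hμ (hV0 z hU)
      have h2 := hμV z h.le
      have h3 : 0 ≤ X z * (1 - μ * V z) := mul_nonneg (hX0 z) (by linarith)
      have h4 : X z * (1 - μ * V z) ≤ 1 := mul_le_one₀ (hX1 z) (by linarith) (by linarith)
      rcases le_total 0 (nsq z - R) with h5 | h5 <;> nlinarith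
    · rw [(hfar z h).eq_of_nhds]; exact one_pos
  have hfrad : ∀ z, 0 < 2 * f z + fderiv ℝ f z z := by
    intro z
    rcases hcase z with h | h
    · obtain ⟨hU, hP⟩ := hδU z h.le
      have hP' : 0 < 2 * nsq z * V z + (nsq z - R) * fderiv ℝ V z z := hP
      have hn := nsq_pos hU.1
      refine pos_of_mul_pos_right ?_ hn.le
      have e1 : HasFDerivAt (fun z => nsq z * f z) _ z :=
        ((contDiff_nsq.differentiable (by simp) z).hasFDerivAt).mul
          (hfs.differentiable (by simp) z).hasFDerivAt
      have e2 : HasFDerivAt (fun z => nsq z + X z * (nsq z - R) * (μ * V z - 1)) _ z :=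
        (contDiff_nsq.differentiable (by simp) z).hasFDerivAt.add
          (((hXs.differentiable (by simp) z).hasFDerivAt.mul
            ((contDiff_nsq.differentiable (by simp) z).hasFDerivAt.sub_const R)).mul
            ((((hVat z h).differentiableAt (by simp)).hasFDerivAt.const_mul μ).sub_const 1))
      have e3 := (e2.congr_of_eventuallyEq (by
        filter_upwards [hopen0.mem_nhds hU.1] with w hw using hfn w hw)).unique e1
      have e4 := congrArg (fun L : Plane →L[ℝ] ℝ => L z) e3
      simp only [add_apply, smul_apply, smul_eq_mul, fderiv_nsq_self, Pi.mul_apply] at e4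
      have e5 : nsq z * (2 * f z + fderiv ℝ f z z) = 2 * nsq z * (1 - X z) +
          (1 - μ * V z) * -((nsq z - R) * fderiv ℝ X z z) +
          μ * (X z * (2 * nsq z * V z + (nsq z - R) * fderiv ℝ V z z)) := by
        linear_combination -e4
      rw [e5]
      have h2 := hμV z h.le
      have h3 : 0 ≤ (1 - μ * V z) * -((nsq z - R) * fderiv ℝ X z z) :=
        mul_nonneg (by linarith) (by linarith [hDX z])
      have h4 : 0 ≤ 2 * nsq z * (1 - X z) := mul_nonneg (by positivity) (by linarith [hX1 z])
      rcases (hX0 z).lt_or_eq with hx | hx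
      · have : 0 < μ * (X z * (2 * nsq z * V z + (nsq z - R) * fderiv ℝ V z z)) := by positivity
        linarith
      · rw [← hx]
        have : 0 < 2 * nsq z := by positivity
        linarith
    · rw [(hfar z h).fderiv_eq, (hfar z h).eq_of_nhds]
      simp
  obtain ⟨Φ, hΦ, hΦe, -⟩ := exists_isDiffeoC_scale hfs hfpos hfrad
    ⟨_, hKc, fun z hz => (hfar z (Or.inl (not_le.1 hz))).eq_of_nhds⟩
  have hnΦ : ∀ z, nsq (Φ z) = f z * nsq z := fun z => by
    rw [hΦe, nsq_smul, sq_sqrt (hfpos z).le]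
  have hfix : ∀ y, nsq y = R → Φ y = y := fun y hy => by
    rw [hΦe]
    simp [f, hy]
  have hopen : IsOpen (Φ '' {z | |nsq z - R| < δ / 2}) := by
    rw [Equiv.image_eq_preimage_symm]
    exact (isOpen_lt ((hnc.sub continuous_const).abs) continuous_const).preimage hΦ.2.1.continuous
  obtain ⟨ε, hε, hεU⟩ := exists_annulus_subset hopen (R := R) fun y hy =>
    ⟨y, by simp [hy, hδ], hfix y hy⟩
  refine ⟨Φ, μ, ε, hΦ, hμ, hε, hfix, fun z hz => ?_⟩
  obtain ⟨y, hy, rfl⟩ := hεU z hz.le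
  have hy' : |nsq y - R| < δ / 2 := hy
  have hU := (hδU y (by linarith)).1
  rw [Equiv.symm_apply_apply, hnΦ, mul_comm, hfn y hU.1, hXnear y hy'.le, hqW y hU.1,
    ← sq_sqrt hU.2.le]
  change b₀ + _ * V y ^ 2 = _
  field_simp
  ring

theorem contDiff_comp_rot {f : Plane → ℝ} (hf : ContDiff ℝ ∞ f) :
    ContDiff ℝ ∞ fun w : Plane × ℝ => f (rot w.2 w.1) :=
  hf.comp (f := fun w : Plane × ℝ => rot w.2 w.1)
    (contDiff_rot.comp (f := fun w : Plane × ℝ => (w.2, w.1)) (contDiff_snd.prodMk contDiff_fst))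

theorem rot_add (φ : ℝ) (z w : Plane) : rot φ (z + w) = rot φ z + rot φ w := by
  ext <;> simp [rot] <;> ring

theorem rot_smul (φ a : ℝ) (z : Plane) : rot φ (a • z) = a • rot φ z := by
  ext <;> simp [rot] <;> ring

theorem contDiff_angularIntegral {f : Plane → ℝ} (hf : ContDiff ℝ ∞ f) :
    ContDiff ℝ ∞ fun z => ∫ θ in (0:ℝ)..(2 * π), f (rot θ z) :=
  contDiff_intervalIntegral_param (contDiff_comp_rot hf) _ _

theorem fderiv_angularIntegral {f : Plane → ℝ} (hf : ContDiff ℝ ∞ f) (z v : Plane) :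
    fderiv ℝ (fun z => ∫ θ in (0:ℝ)..(2 * π), f (rot θ z)) z v =
      ∫ θ in (0:ℝ)..(2 * π), fderiv ℝ f (rot θ z) (rot θ v) := by
  have hF := contDiff_comp_rot hf
  rw [(hasFDerivAt_intervalIntegral_param (hF.of_le (by simp)) 0 (2 * π) z).fderiv,
    ContinuousLinearMap.intervalIntegral_apply]
  · refine intervalIntegral.integral_congr fun θ _ => ?_
    have h1 : HasDerivAt (fun s : ℝ => (z + s • v, θ)) (v, (0:ℝ)) 0 := by
      have : HasDerivAt (fun s : ℝ => z + s • v) v 0 := by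
        simpa using ((hasDerivAt_id (0:ℝ)).smul_const v).const_add z
      exact this.prodMk (hasDerivAt_const 0 θ)
    have h2 : HasDerivAt (fun s : ℝ => rot θ (z + s • v)) (rot θ v) 0 := by
      simp only [rot_add, rot_smul]
      simpa using ((hasDerivAt_id (0:ℝ)).smul_const (rot θ v)).const_add (rot θ z)
    have h3 : HasFDerivAt (fun w : Plane × ℝ => f (rot w.2 w.1))
        (fderiv ℝ (fun w : Plane × ℝ => f (rot w.2 w.1)) (z, θ)) (z + (0:ℝ) • v, θ) := by
      simpa using (hF.differentiable (by simp) (z, θ)).hasFDerivAt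
    have h4 : HasFDerivAt f (fderiv ℝ f (rot θ z)) (rot θ (z + (0:ℝ) • v)) := by
      simpa using (hf.differentiable (by simp) (rot θ z)).hasFDerivAt
    have h5 : HasDerivAt (fun s : ℝ => f (rot θ (z + s • v)))
        (fderiv ℝ (fun w : Plane × ℝ => f (rot w.2 w.1)) (z, θ) (v, 0)) 0 :=
      h3.comp_hasDerivAt (f := fun s : ℝ => (z + s • v, θ)) (0:ℝ) h1
    have h6 : HasDerivAt (fun s : ℝ => f (rot θ (z + s • v)))
        (fderiv ℝ f (rot θ z) (rot θ v)) 0 :=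
      h4.comp_hasDerivAt (f := fun s : ℝ => rot θ (z + s • v)) (0:ℝ) h2
    simpa using h5.unique h6
  · apply Continuous.intervalIntegrable
    exact ((hF.continuous_fderiv (by simp)).comp (by fun_prop)).clm_comp continuous_const

theorem integral_fderiv_quarter {f : Plane → ℝ} (hf : ContDiff ℝ ∞ f) (z : Plane) :
    ∫ θ in (0:ℝ)..(2 * π), fderiv ℝ f (rot θ z) (quarter (rot θ z)) = 0 := by
  have hr : Continuous fun θ => rot θ z :=
    contDiff_rot.continuous.comp (by fun_prop : Continuous fun θ : ℝ => (θ, z))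
  have hq : Continuous quarter := by unfold quarter; fun_prop
  rw [intervalIntegral.integral_eq_sub_of_hasDerivAt (f := fun θ => f (rot θ z))]
  · have := rot_add_two_pi 0 z
    rw [zero_add] at this
    rw [this, sub_self]
  · intro θ _
    exact (hf.differentiable (by simp) _).hasFDerivAt.comp_hasDerivAt θ (hasDerivAt_rot θ z)
  · exact (((hf.continuous_fderiv (by simp)).comp hr).clm_apply (hq.comp hr)).intervalIntegrable _ _

/-- The Jacobian of the pair `(P, Q)`. -/
noncomputable def jac (P Q : Plane → ℝ) (z : Plane) : ℝ :=
  fderiv ℝ P z (1, 0) * fderiv ℝ Q z (0, 1) - fderiv ℝ P z (0, 1) * fderiv ℝ Q z (1, 0)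

theorem contDiff_fderiv_apply {f : Plane → ℝ} (hf : ContDiff ℝ ∞ f) {v : Plane → Plane}
    (hv : ContDiff ℝ ∞ v) : ContDiff ℝ ∞ fun z => fderiv ℝ f z (v z) :=
  (hf.fderiv_right (m := ∞) (by simp)).clm_apply hv

theorem contDiff_quarter : ContDiff ℝ ∞ quarter := by unfold quarter; fun_prop

theorem contDiff_jac {P Q : Plane → ℝ} (hP : ContDiff ℝ ∞ P) (hQ : ContDiff ℝ ∞ Q) :
    ContDiff ℝ ∞ (jac P Q) :=
  ((contDiff_fderiv_apply hP contDiff_const).mul (contDiff_fderiv_apply hQ contDiff_const)).sub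
    ((contDiff_fderiv_apply hP contDiff_const).mul (contDiff_fderiv_apply hQ contDiff_const))

theorem fderiv_quarter_sub {P Q : Plane → ℝ} (hP : ContDiff ℝ ∞ P) (hQ : ContDiff ℝ ∞ Q)
    (z : Plane) :
    fderiv ℝ (fun z => P z * fderiv ℝ Q z (quarter z)) z z -
      fderiv ℝ (fun z => P z * fderiv ℝ Q z z) z (quarter z) = nsq z * jac P Q z := by
  have hP1 := (hP.differentiable (by simp) z).hasFDerivAt
  have hQ2 := ((hQ.fderiv_right (m := ∞) (by simp)).differentiable (by simp) z).hasFDerivAt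
  have hJ : HasFDerivAt quarter (((-ContinuousLinearMap.snd ℝ ℝ ℝ).prod
      (ContinuousLinearMap.fst ℝ ℝ ℝ)) : Plane →L[ℝ] Plane) z :=
    ((-ContinuousLinearMap.snd ℝ ℝ ℝ).prod (ContinuousLinearMap.fst ℝ ℝ ℝ)).hasFDerivAt
  have e1 := hP1.mul (hQ2.clm_apply hJ)
  have e2 := hP1.mul (hQ2.clm_apply (hasFDerivAt_id z))
  have hs : fderiv ℝ (fderiv ℝ Q) z z (quarter z) = fderiv ℝ (fderiv ℝ Q) z (quarter z) z :=
    (hQ.contDiffAt (x := z)).isSymmSndFDerivAt (by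
      rw [minSmoothness_of_isRCLikeNormedField]; exact ENat.LEInfty.out) z (quarter z)
  change HasFDerivAt (fun z => P z * fderiv ℝ Q z (quarter z)) _ z at e1
  change HasFDerivAt (fun z => P z * fderiv ℝ Q z z) _ z at e2
  rw [e1.fderiv, e2.fderiv]
  have hj : (((-ContinuousLinearMap.snd ℝ ℝ ℝ).prod
      (ContinuousLinearMap.fst ℝ ℝ ℝ)) : Plane →L[ℝ] Plane) z = quarter z := rfl
  simp only [add_apply, smul_apply, smul_eq_mul, ContinuousLinearMap.comp_apply,
    ContinuousLinearMap.flip_apply, ContinuousLinearMap.id_apply, id, hj, hs]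
  have a1 := clm_plane_apply (fderiv ℝ P z) z
  have a2 := clm_plane_apply (fderiv ℝ P z) (quarter z)
  have a3 := clm_plane_apply (fderiv ℝ Q z) z
  have a4 := clm_plane_apply (fderiv ℝ Q z) (quarter z)
  simp only [quarter] at a2 a4
  simp only [quarter, jac, nsq]
  rw [a1, a2, a3, a4]
  ring

/-- Green's theorem on a disc in polar coordinates. -/
theorem integral_angular_form {P Q : Plane → ℝ} (hP : ContDiff ℝ ∞ P) (hQ : ContDiff ℝ ∞ Q)
    (z : Plane) :
    ∫ θ in (0:ℝ)..(2 * π), P (rot θ z) * fderiv ℝ Q (rot θ z) (quarter (rot θ z)) =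
      nsq z * ∫ u in (0:ℝ)..1, u * ∫ θ in (0:ℝ)..(2 * π), jac P Q (rot θ (u • z)) := by
  set f : Plane → ℝ := fun z => P z * fderiv ℝ Q z (quarter z) with hf
  set h : Plane → ℝ := fun z => P z * fderiv ℝ Q z z with hh
  have hfs : ContDiff ℝ ∞ f := hP.mul (contDiff_fderiv_apply hQ contDiff_quarter)
  have hhs : ContDiff ℝ ∞ h := hP.mul (contDiff_fderiv_apply hQ contDiff_id)
  set J : Plane → ℝ := fun z => ∫ θ in (0:ℝ)..(2 * π), f (rot θ z) with hJ
  set N : Plane → ℝ := fun z => ∫ θ in (0:ℝ)..(2 * π), jac P Q (rot θ z) with hN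
  have hJs : ContDiff ℝ ∞ J := contDiff_angularIntegral hfs
  have hNs : ContDiff ℝ ∞ N := contDiff_angularIntegral (contDiff_jac hP hQ)
  have hr : ∀ z : Plane, Continuous fun θ => rot θ z := fun z =>
    contDiff_rot.continuous.comp (by fun_prop : Continuous fun θ : ℝ => (θ, z))
  have hEuler : ∀ z, fderiv ℝ J z z = nsq z * N z := by
    intro z
    rw [fderiv_angularIntegral hfs, ← intervalIntegral.integral_const_mul]
    refine (sub_zero _).symm.trans ?_
    refine (congrArg (_ - ·) (integral_fderiv_quarter hhs z).symm).trans ?_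
    rw [← intervalIntegral.integral_sub]
    · refine intervalIntegral.integral_congr fun θ _ => ?_
      rw [fderiv_quarter_sub hP hQ, nsq_rot]
    · exact (((contDiff_fderiv_apply hfs contDiff_id).continuous).comp (hr z)).intervalIntegrable _ _
    · exact (((contDiff_fderiv_apply hhs contDiff_quarter).continuous).comp (hr z)).intervalIntegrable _ _
  have h0 : J ((0:ℝ) • z) = 0 := by
    simp only [hJ, hf, zero_smul]
    have : ∀ θ, rot θ (0 : Plane) = 0 := fun θ => by ext <;> simp [rot]
    have h' : quarter 0 = 0 := by ext <;> simp [quarter]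
    simp [this, h']
  have hc : Continuous fun u : ℝ => u • z := by fun_prop
  have key : ∫ u in (0:ℝ)..1, nsq z * (u * N (u • z)) = J ((1:ℝ) • z) - J ((0:ℝ) • z) := by
    refine intervalIntegral.integral_eq_sub_of_hasDerivAt_of_le zero_le_one
      (f := fun u : ℝ => J (u • z)) ((hJs.continuous.comp hc).continuousOn) ?_ ?_
    · intro u hu
      have h1 : HasDerivAt (fun u : ℝ => J (u • z)) (fderiv ℝ J (u • z) z) u := by
        have : HasDerivAt (fun u : ℝ => u • z) z u := by
          simpa using (hasDerivAt_id u).smul_const z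
        exact (hJs.differentiable (by simp) _).hasFDerivAt.comp_hasDerivAt u this
      refine h1.congr_deriv ?_
      have h2 := hEuler (u • z)
      rw [map_smul, nsq_smul, smul_eq_mul] at h2
      have := hu.1.ne'
      apply mul_left_cancel₀ this
      rw [h2]; ring
    · have := hNs.continuous.comp hc
      exact (continuous_const.mul (continuous_id.mul this)).intervalIntegrable _ _
  rw [intervalIntegral.integral_const_mul, h0, one_smul, sub_zero] at key
  exact key.symm

theorem hasDerivAt_integral_sawtooth {k : ℝ → ℝ} (hk : Continuous k)
    (hper : ∀ x, k (x + 2 * π) = k x) (h0 : ∫ x in (0:ℝ)..(2 * π), k x = 0) (φ : ℝ) :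
    HasDerivAt (fun φ => ∫ u in (0:ℝ)..(2 * π), k (u + φ) * (u - π)) (2 * π * k φ) φ := by
  set S : ℝ → ℝ := fun x => ∫ u in (0:ℝ)..x, u * k u with hS
  have hSd : ∀ x, HasDerivAt S (x * k x) x := fun x =>
    (continuous_id.mul hk).integral_hasStrictDerivAt 0 x |>.hasDerivAt
  have hSi : Continuous fun u => u * k u := continuous_id.mul hk
  have heq : ∀ φ, ∫ u in (0:ℝ)..(2 * π), k (u + φ) * (u - π) = S (φ + 2 * π) - S φ := fun φ => by
    have h1 := intervalIntegral.integral_comp_add_right (a := 0) (b := 2 * π)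
      (fun v => v * k v - (φ + π) * k v) φ
    have h2 : ∫ v in φ..(φ + 2 * π), k v = 0 := by
      rw [← h0, (show Function.Periodic k (2 * π) from hper).intervalIntegral_add_eq φ 0, zero_add]
    rw [zero_add, add_comm (2 * π) φ, intervalIntegral.integral_sub (hSi.intervalIntegrable _ _)
      ((by fun_prop : Continuous fun v => (φ + π) * k v).intervalIntegrable _ _), intervalIntegral.integral_const_mul, h2,
      mul_zero, sub_zero] at h1
    rw [hS, intervalIntegral.integral_interval_sub_left (hSi.intervalIntegrable _ _)
      (hSi.intervalIntegrable _ _), ← h1]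
    exact intervalIntegral.integral_congr fun u _ => by ring
  simp only [heq]
  refine (((hSd (φ + 2 * π)).comp_add_const φ (2 * π)).sub (hSd φ)).congr_deriv ?_
  rw [hper]; ring

theorem continuous_rot_left (z : Plane) : Continuous fun θ => rot θ z :=
  contDiff_rot.continuous.comp (by fun_prop : Continuous fun θ : ℝ => (θ, z))

theorem integral_rot_rot {ρ : Plane → ℝ} (a : ℝ) (z : Plane) :
    ∫ θ in (0:ℝ)..(2 * π), ρ (rot θ (rot a z)) = ∫ θ in (0:ℝ)..(2 * π), ρ (rot θ z) := by
  simp only [rot_rot]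
  have hp : Function.Periodic (fun θ => ρ (rot θ z)) (2 * π) := fun θ => by
    simp only [rot_add_two_pi]
  have h1 := hp.intervalIntegral_add_eq a 0
  rw [intervalIntegral.integral_comp_add_right (fun θ => ρ (rot θ z)) a, zero_add, add_comm (2 * π),
    h1, zero_add]

/-- A function with zero mean on all circles around the origin is an angular derivative. -/
theorem exists_angular_primitive {h : Plane → ℝ} (hh : ContDiff ℝ ∞ h)
    (h0 : ∀ z, ∫ θ in (0:ℝ)..(2 * π), h (rot θ z) = 0) :
    ∃ α : Plane → ℝ, ContDiff ℝ ∞ α ∧ (∀ z, fderiv ℝ α z (quarter z) = h z) ∧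
      ∀ z, (∀ θ, h (rot θ z) = 0) → α z = 0 := by
  set α : Plane → ℝ := fun z => (2 * π)⁻¹ * ∫ u in (0:ℝ)..(2 * π), h (rot u z) * (u - π) with hα
  have hs : ContDiff ℝ ∞ α := contDiff_const.mul (contDiff_intervalIntegral_param
    (F := fun w : Plane × ℝ => h (rot w.2 w.1) * (w.2 - π))
    ((contDiff_comp_rot hh).mul (by fun_prop)) _ _)
  refine ⟨α, hs, fun z => ?_, fun z hz => by simp [hα, hz]⟩
  have h1 : HasDerivAt (fun φ => α (rot φ z)) (fderiv ℝ α z (quarter z)) 0 := by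
    have h2 := hasDerivAt_rot 0 z
    rw [rot_zero] at h2
    refine HasFDerivAt.comp_hasDerivAt (l := α) (f := fun φ => rot φ z) 0 ?_ h2
    rw [rot_zero]
    exact (hs.differentiable (by simp) z).hasFDerivAt
  have h3 := (hasDerivAt_integral_sawtooth (k := fun θ => h (rot θ z))
    (hh.continuous.comp (continuous_rot_left z)) (fun x => by simp only [rot_add_two_pi]) (h0 z)
    0).const_mul (2 * π)⁻¹
  have h4 : (fun φ => α (rot φ z)) = fun φ =>
      (2 * π)⁻¹ * ∫ u in (0:ℝ)..(2 * π), h (rot (u + φ) z) * (u - π) := by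
    simp only [hα, rot_rot]
  rw [h4] at h1
  rw [h1.unique h3, rot_zero]
  have := pi_pos.ne'
  field_simp

theorem radial_mean_euler {m : Plane → ℝ} (hm : ContDiff ℝ ∞ m) :
    ContDiff ℝ ∞ (fun z => ∫ u in (0:ℝ)..1, 2 * u * m (u • z)) ∧
    ∀ z, (∫ u in (0:ℝ)..1, 2 * u * m (u • z)) +
      fderiv ℝ (fun z => ∫ u in (0:ℝ)..1, 2 * u * m (u • z)) z z / 2 = m z := by
  set B : Plane → ℝ := fun z => ∫ u in (0:ℝ)..1, 2 * u * m (u • z) with hB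
  have hBs : ContDiff ℝ ∞ B := contDiff_intervalIntegral_param
    (F := fun w : Plane × ℝ => 2 * w.2 * m (w.2 • w.1)) (by
      have := hm.comp (f := fun w : Plane × ℝ => w.2 • w.1) (by fun_prop)
      exact (contDiff_const.mul contDiff_snd).mul this) _ _
  refine ⟨hBs, fun z => ?_⟩
  have hmz : Continuous fun v : ℝ => 2 * v * m (v • z) :=
    (by fun_prop : Continuous fun v : ℝ => 2 * v).mul (hm.continuous.comp (by fun_prop))
  have h1 : ∀ l : ℝ, l ^ 2 * B (l • z) = ∫ v in (0:ℝ)..l, 2 * v * m (v • z) := fun l => by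
    have h2 := intervalIntegral.mul_integral_comp_mul_right (a := 0) (b := 1)
      (f := fun v => 2 * v * m (v • z)) l
    rw [zero_mul, one_mul] at h2
    rw [← h2, hB, pow_two, mul_assoc]
    congr 1
    beta_reduce
    rw [← intervalIntegral.integral_const_mul]
    refine intervalIntegral.integral_congr fun u _ => ?_
    rw [smul_smul]; ring
  have h3 : HasDerivAt (fun l : ℝ => l ^ 2 * B (l • z)) (2 * 1 * m ((1:ℝ) • z)) 1 := by
    simp only [h1]
    exact (hmz.integral_hasStrictDerivAt 0 1).hasDerivAt
  have h4 : HasDerivAt (fun l : ℝ => B (l • z)) (fderiv ℝ B z z) 1 := by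
    have h5 : HasDerivAt (fun l : ℝ => l • z) z 1 := by
      simpa using (hasDerivAt_id (1:ℝ)).smul_const z
    refine HasFDerivAt.comp_hasDerivAt (l := B) (f := fun l : ℝ => l • z) 1 ?_ h5
    rw [one_smul]
    exact (hBs.differentiable (by simp) z).hasFDerivAt
  have h6 := h3.unique ((hasDerivAt_pow 2 (1:ℝ)).mul h4)
  simp at h6
  change B z + _ = _
  linarith

theorem IsDiffeoC.det_ne_zero {Ψ : Plane ≃ Plane} (h : IsDiffeoC Ψ) (z : Plane) :
    (fderiv ℝ Ψ z).det ≠ 0 := by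
  apply det_ne_zero_of_injective
  intro v hv
  have h1 := (h.2.1.differentiable (by simp) (Ψ z)).hasFDerivAt.comp z
    (h.1.differentiable (by simp) z).hasFDerivAt
  have h2 : Ψ.symm ∘ Ψ = id := by ext z : 1; simp
  rw [h2] at h1
  have h3 := congrArg (fun L : Plane →L[ℝ] Plane => L v) (h1.unique (hasFDerivAt_id z))
  simpa [hv] using h3.symm

theorem IsDiffeoC.eventually_id {Ψ : Plane ≃ Plane} (h : IsDiffeoC Ψ) :
    ∃ r > 0, ∀ z, r ≤ nsq z → ∀ᶠ w in 𝓝 z, Ψ w = w := by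
  obtain ⟨-, -, K, hK, h3⟩ := h
  obtain ⟨r, hr, hrK⟩ := exists_nsq_bound hK
  refine ⟨r, hr, fun z hz => ?_⟩
  filter_upwards [hK.isClosed.isOpen_compl.mem_nhds (hrK z hz)] with w hw using h3 w hw

theorem IsDiffeoC.det_pos {Ψ : Plane ≃ Plane} (h : IsDiffeoC Ψ) (z : Plane) :
    0 < (fderiv ℝ Ψ z).det := by
  by_contra! hneg
  have hc : Continuous fun z => (fderiv ℝ Ψ z).det := by
    have : Continuous (fderiv ℝ Ψ) := h.1.continuous_fderiv (by simp)
    simp only [det_plane]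
    fun_prop
  obtain ⟨r, hr, hid⟩ := h.eventually_id
  have h1 : (fderiv ℝ Ψ (√r, 0)).det = 1 := by
    have h2 : Ψ =ᶠ[𝓝 ((√r, 0) : Plane)] id := hid (√r, 0) (by simp [nsq, sq_sqrt hr.le])
    rw [h2.fderiv_eq, fderiv_id, det_plane]
    simp
  obtain ⟨w, hw⟩ := mem_range_of_exists_le_of_exists_ge hc ⟨z, hneg⟩ ⟨(√r, 0), by rw [h1]; simp⟩
  exact h.det_ne_zero w hw

theorem IsDiffeoC.jac_eq_det {Ψ : Plane ≃ Plane} (h : IsDiffeoC Ψ) (z : Plane) :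
    jac (fun z => (Ψ z).1) (fun z => (Ψ z).2) z = (fderiv ℝ Ψ z).det := by
  have h1 := (h.1.differentiable (by simp) z).hasFDerivAt
  rw [jac, h1.fst.fderiv, h1.snd.fderiv, det_plane]
  simp

theorem nsq_sqrt {s : ℝ} (hs : 0 ≤ s) : nsq (√s, 0) = s := by simp [nsq, sq_sqrt hs]

theorem integral_angular_form_eq_of_id {Ψ : Plane ≃ Plane} {z : Plane}
    (h : ∀ θ, ∀ᶠ w in 𝓝 (rot θ z), Ψ w = w) :
    ∫ θ in (0:ℝ)..(2 * π), (Ψ (rot θ z)).1 *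
      fderiv ℝ (fun w => (Ψ w).2) (rot θ z) (quarter (rot θ z)) = π * nsq z := by
  have h1 : ∀ w : Plane, jac (fun w => w.1) (fun w => w.2) w = 1 := fun w => by
    simp [jac, fderiv_fst, fderiv_snd]
  have h2 := integral_angular_form (P := fun w => w.1) (Q := fun w => w.2) contDiff_fst contDiff_snd z
  simp only [h1] at h2
  calc _ = _ := intervalIntegral.integral_congr fun θ _ => by
        have h3 : (fun w => (Ψ w).2) =ᶠ[𝓝 (rot θ z)] fun w => w.2 := by
          filter_upwards [h θ] with w hw using by rw [hw]
        rw [(h θ).self_of_nhds, h3.fderiv_eq]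
    _ = _ := h2
    _ = _ := by
      rw [intervalIntegral.integral_mul_const]
      simp
      ring

/-- A compactly supported diffeomorphism with prescribed Jacobian which permutes the circles around
the origin. -/
theorem IsDiffeoC.exists_det_eq {Ψ : Plane ≃ Plane} (hΨ : IsDiffeoC Ψ) :
    ∃ Φ : Plane ≃ Plane, IsDiffeoC Φ ∧ (∀ z, (fderiv ℝ Φ z).det = (fderiv ℝ Ψ z).det) ∧
      (∀ z w, nsq (Φ z) = nsq (Φ w) ↔ nsq z = nsq w) ∧
      ∀ z, ∫ θ in (0:ℝ)..(2 * π), (Ψ (rot θ z)).1 *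
        fderiv ℝ (fun w => (Ψ w).2) (rot θ z) (quarter (rot θ z)) = π * nsq (Φ z) := by
  have hπ := pi_pos
  set ρ : Plane → ℝ := jac (fun z => (Ψ z).1) (fun z => (Ψ z).2) with hρ
  have hP : ContDiff ℝ ∞ fun z => (Ψ z).1 := contDiff_fst.comp hΨ.1
  have hQ : ContDiff ℝ ∞ fun z => (Ψ z).2 := contDiff_snd.comp hΨ.1
  have hρs : ContDiff ℝ ∞ ρ := contDiff_jac hP hQ
  have hρpos : ∀ z, 0 < ρ z := fun z => by rw [hρ, hΨ.jac_eq_det]; exact hΨ.det_pos z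
  obtain ⟨r, hr, hid⟩ := hΨ.eventually_id
  have hρ1 : ∀ z, r ≤ nsq z → ρ z = 1 := fun z hz => by
    have h2 : Ψ =ᶠ[𝓝 z] id := hid z hz
    rw [hρ, hΨ.jac_eq_det, h2.fderiv_eq, fderiv_id, det_plane]
    simp
  set M : Plane → ℝ := fun z => (2 * π)⁻¹ * ∫ θ in (0:ℝ)..(2 * π), ρ (rot θ z) with hM
  have hMs : ContDiff ℝ ∞ M := contDiff_const.mul (contDiff_angularIntegral hρs)
  have hMpos : ∀ z, 0 < M z := fun z => mul_pos (by positivity)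
    (intervalIntegral.intervalIntegral_pos_of_pos
      ((hρs.continuous.comp (continuous_rot_left z)).intervalIntegrable _ _)
      (fun θ => hρpos _) (by positivity))
  have hMrot : ∀ a z, M (rot a z) = M z := fun a z => by simp only [hM, integral_rot_rot]
  have hM1 : ∀ z, r ≤ nsq z → M z = 1 := fun z hz => by
    have : ∀ θ, ρ (rot θ z) = 1 := fun θ => hρ1 _ (by rwa [nsq_rot])
    simp only [hM, this]
    simp
    field_simp
  obtain ⟨hBs, hBe⟩ := radial_mean_euler hMs
  set B : Plane → ℝ := fun z => ∫ u in (0:ℝ)..1, 2 * u * M (u • z) with hB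
  have hBpos : ∀ z, 0 < B z := fun z => by
    refine intervalIntegral.intervalIntegral_pos_of_pos_on (Continuous.intervalIntegrable ?_ _ _)
      (fun u hu => mul_pos (by linarith [hu.1]) (hMpos _)) one_pos
    have := hMs.continuous.comp (by fun_prop : Continuous fun u : ℝ => u • z)
    exact (by fun_prop : Continuous fun u : ℝ => 2 * u).mul this
  have hBrot : ∀ a z, B (rot a z) = B z := fun a z => by
    simp only [hB, ← rot_smul, hMrot]
  have harea : ∀ z, ∫ θ in (0:ℝ)..(2 * π), (Ψ (rot θ z)).1 *
      fderiv ℝ (fun w => (Ψ w).2) (rot θ z) (quarter (rot θ z)) = π * (B z * nsq z) := fun z => by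
    rw [integral_angular_form hP hQ z, hB, mul_comm (∫ _ in _.._, _), mul_left_comm]
    congr 1
    rw [← intervalIntegral.integral_const_mul]
    refine intervalIntegral.integral_congr fun u _ => ?_
    simp only [hM]
    field_simp
    rfl
  have hB1 : ∀ z, r ≤ nsq z → B z = 1 := fun z hz => by
    have h1 := harea z
    rw [integral_angular_form_eq_of_id fun θ => hid _ (by rwa [nsq_rot])] at h1
    have h2 : nsq z ≠ 0 := by linarith
    have h3 : π * nsq z ≠ 0 := mul_ne_zero hπ.ne' h2
    exact mul_left_cancel₀ h3 (by linarith)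
  have hcpt : ∀ z ∉ {z : Plane | nsq z ≤ r}, r ≤ nsq z := fun z hz =>
    (not_le.1 (show ¬ nsq z ≤ r from hz)).le
  obtain ⟨Z, hZ, hZe, hZd⟩ := exists_isDiffeoC_scale hBs hBpos
    (fun z => by linarith [hBe z, hMpos z]) ⟨_, isCompact_nsq_le r, fun z hz => hB1 z (hcpt z hz)⟩
  have hnZ : ∀ z, nsq (Z z) = B z * nsq z := fun z => by
    rw [hZe, nsq_smul, sq_sqrt (hBpos z).le]
  obtain ⟨α, hαs, hαd, hα0⟩ := exists_angular_primitive (h := fun z => ρ z / M z - 1)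
    ((hρs.div hMs fun z => (hMpos z).ne').sub contDiff_const) (fun z => by
      have hi : Continuous fun θ => ρ (rot θ z) := hρs.continuous.comp (continuous_rot_left z)
      simp only [hMrot]
      rw [intervalIntegral.integral_sub ((hi.div_const _).intervalIntegrable _ _)
        (by simp), intervalIntegral.integral_div]
      have h1 : ∫ θ in (0:ℝ)..(2 * π), ρ (rot θ z) = 2 * π * M z := by
        simp only [hM]; field_simp
      rw [h1]
      have := (hMpos z).ne'
      simp
      field_simp
      ring)
  obtain ⟨T, hT, hTe, hTd⟩ := exists_isDiffeoC_twist hαs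
    (fun z => by rw [hαd]; have := div_pos (hρpos z) (hMpos z); linarith)
    ⟨_, isCompact_nsq_le r, fun z hz => hα0 z fun θ => by
      have : r ≤ nsq (rot θ z) := by rw [nsq_rot]; exact hcpt z hz
      rw [hρ1 _ this, hM1 _ this]; simp⟩
  have hBT : ∀ z, B (T z) = B z := fun z => by rw [hTe, hBrot]
  have hnT : ∀ z, nsq (T z) = nsq z := fun z => by rw [hTe, nsq_rot]
  have hnΦ : ∀ z, nsq (T.trans Z z) = B z * nsq z := fun z => by
    rw [Equiv.trans_apply, hnZ, hBT, hnT]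
  have hBrad : ∀ z w, nsq z = nsq w → B z = B w := fun z w h => by
    obtain ⟨φ, rfl⟩ := exists_rot_of_nsq_eq h
    rw [hBrot]
  refine ⟨T.trans Z, hT.trans hZ, fun z => ?_, fun z w => ⟨fun h => ?_, fun h => ?_⟩, fun z => ?_⟩
  · have h1 := (hZ.1.differentiable (by simp) (T z)).hasFDerivAt.comp z
      (hT.1.differentiable (by simp) z).hasFDerivAt
    rw [Equiv.coe_trans, h1.fderiv, ← hΨ.jac_eq_det]
    have h2 : ((fderiv ℝ Z (T z)).comp (fderiv ℝ T z)).det =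
        (fderiv ℝ Z (T z)).det * (fderiv ℝ T z).det := LinearMap.det_comp _ _
    rw [h2, hZd, hBe, hTd, hαd, hTe, hMrot]
    have := (hMpos z).ne'
    field_simp
    ring
  · rw [hnΦ, hnΦ, hBrad z (√(nsq z), 0) (nsq_sqrt (nsq_nonneg z)).symm,
      hBrad w (√(nsq w), 0) (nsq_sqrt (nsq_nonneg w)).symm] at h
    have h1 : Z (√(nsq z), 0) = Z (√(nsq w), 0) := by
      rw [hZe, hZe]
      ext
      · simp only [Prod.smul_mk, smul_eq_mul]
        rw [← sqrt_mul (hBpos _).le, ← sqrt_mul (hBpos _).le, h]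
      · simp
    have h2 := congrArg Prod.fst (Z.injective h1)
    exact (sqrt_inj (nsq_nonneg z) (nsq_nonneg w)).1 h2
  · rw [hnΦ, hnΦ, hBrad z w h, h]
  · rw [harea, hnΦ]

theorem isSmoothEmb_rot {z : Plane} (hz : z ≠ 0) : IsSmoothEmb fun t => rot (2 * π * t) z := by
  have hd : ∀ t : ℝ, HasDerivAt (fun t => rot (2 * π * t) z) ((2 * π) • quarter (rot (2 * π * t) z)) t :=
    fun t => (hasDerivAt_rot (2 * π * t) z).scomp t (by
      simpa using (hasDerivAt_id t).const_mul (2 * π))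
  refine ⟨?_, fun t => ?_, fun t h => ?_, fun s t h => ?_⟩
  · exact contDiff_rot.comp (f := fun t : ℝ => (2 * π * t, z)) (by fun_prop)
  · beta_reduce
    rw [mul_add, mul_one, rot_add_two_pi]
  · rw [(hd t).deriv] at h
    have h1 := (smul_eq_zero.1 h).resolve_left (by positivity)
    apply hz
    rw [← nsq_eq_zero, ← nsq_rot (2 * π * t), nsq_eq_zero]
    have h2 := congrArg Prod.fst h1
    have h3 := congrArg Prod.snd h1
    simp only [quarter, Prod.fst_zero, Prod.snd_zero, neg_eq_zero] at h2 h3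
    exact Prod.ext h3 h2
  · obtain ⟨k, hk⟩ := exists_int_of_rot_eq hz h
    refine ⟨-k, ?_⟩
    have h1 : 2 * π * (s - (t - k)) = 0 := by linear_combination -hk
    have h2 := (mul_eq_zero.1 h1).resolve_left (by positivity)
    push_cast
    linarith

theorem isSmoothEmb_of_injOn {c : ℝ → Plane} (hs : ContDiff ℝ ∞ c) (hper : ∀ t, c (t + 2 * π) = c t)
    (hd : ∀ t, deriv c t ≠ 0) (hinj : InjOn c (Ico 0 (2 * π))) :
    IsSmoothEmb fun t => c (2 * π * t) := by
  have hder : ∀ t : ℝ, HasDerivAt (fun t => c (2 * π * t)) ((2 * π) • deriv c (2 * π * t)) t :=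
    fun t => (hs.differentiable (by simp) (2 * π * t)).hasDerivAt.scomp t (by
      simpa using (hasDerivAt_id t).const_mul (2 * π))
  refine ⟨hs.comp (by fun_prop), fun t => ?_, fun t h => ?_, fun s t h => ?_⟩
  · beta_reduce
    rw [mul_add, mul_one, hper]
  · rw [(hder t).deriv] at h
    exact hd _ ((smul_eq_zero.1 h).resolve_left (by positivity))
  · have hpos : (0:ℝ) < 2 * π := by positivity
    have hmod : ∀ x, c (toIcoMod hpos 0 x) = c x := fun x => by
      have := (show Function.Periodic c (2 * π) from hper).sub_zsmul_eq (x := x) (toIcoDiv hpos 0 x)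
      exact this
    have hmem : ∀ x, toIcoMod hpos 0 x ∈ Ico 0 (2 * π) := fun x => by
      simpa using toIcoMod_mem_Ico hpos 0 x
    have h1 := hinj (hmem (2 * π * s)) (hmem (2 * π * t)) (by rw [hmod, hmod]; exact h)
    refine ⟨toIcoDiv hpos 0 (2 * π * s) - toIcoDiv hpos 0 (2 * π * t), ?_⟩
    simp only [toIcoMod, zsmul_eq_mul] at h1
    push_cast
    apply mul_left_cancel₀ hpos.ne'
    linear_combination h1

theorem exists_circle_parametrisation {c : ℝ → Plane} (hs : ContDiff ℝ ∞ c)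
    (hper : ∀ t, c (t + 2 * π) = c t) (hd : ∀ t, deriv c t ≠ 0) (hinj : InjOn c (Ico 0 (2 * π)))
    {e : Plane} (he : e ≠ 0) :
    ∃ Ψ : Plane ≃ Plane, IsDiffeoC Ψ ∧ ∃ ε : ℝ, (ε = 1 ∨ ε = -1) ∧ ∃ s, ∀ x,
      c x = Ψ (rot (ε * x + s) e) := by
  obtain ⟨Ψ, hΨ, ε, hε, s, h⟩ := (isSmoothEmb_rot he).loopEquiv (isSmoothEmb_of_injOn hs hper hd hinj)
  refine ⟨Ψ, hΨ, ε, hε, 2 * π * s, fun x => ?_⟩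
  have h1 := h (x / (2 * π))
  beta_reduce at h1
  have hpi := pi_pos.ne'
  rw [show 2 * π * (x / (2 * π)) = x by field_simp,
    show 2 * π * (ε * (x / (2 * π)) + s) = ε * x + 2 * π * s by field_simp] at h1
  exact h1

theorem fderiv_fderiv_comp_of_critical {p : Plane → ℝ} (hp : ContDiff ℝ ∞ p) {Ψ : Plane → Plane}
    (hΨ : ContDiff ℝ ∞ Ψ) {y : Plane} (hcrit : fderiv ℝ p (Ψ y) = 0) (v w : Plane) :
    fderiv ℝ (fderiv ℝ fun z => p (Ψ z)) y v w =
      fderiv ℝ (fderiv ℝ p) (Ψ y) (fderiv ℝ Ψ y v) (fderiv ℝ Ψ y w) := by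
  have hΨd : ∀ z, HasFDerivAt Ψ (fderiv ℝ Ψ z) z := fun z =>
    (hΨ.differentiable (by simp) z).hasFDerivAt
  have h1 : (fderiv ℝ fun z => p (Ψ z)) = fun z => (fderiv ℝ p (Ψ z)).comp (fderiv ℝ Ψ z) := by
    ext1 z
    exact ((hp.differentiable (by simp) (Ψ z)).hasFDerivAt.comp z (hΨd z)).fderiv
  have h2 := ((hp.fderiv_right (m := ∞) (by simp)).differentiable (by simp) (Ψ y)).hasFDerivAt.comp y (hΨd y)
  have h3 := ((hΨ.fderiv_right (m := ∞) (by simp)).differentiable (by simp) y).hasFDerivAt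
  have h4 := h2.clm_comp h3
  change HasFDerivAt (fun z => (fderiv ℝ p (Ψ z)).comp (fderiv ℝ Ψ z)) _ y at h4
  rw [h1, h4.fderiv]
  simp [hcrit]

/-- A well along a circle whose Hessian is non-degenerate in some direction is non-degenerate in
the radial direction. -/
theorem radial_hessian_ne_zero {q : Plane → ℝ} (hq : ContDiff ℝ ∞ q) {y : Plane} (hy : y ≠ 0)
    (hcrit : ∀ θ, fderiv ℝ q (rot θ y) = 0) {η : Plane} (hη : fderiv ℝ (fderiv ℝ q) y η η ≠ 0) :
    fderiv ℝ (fderiv ℝ q) y y y ≠ 0 := by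
  intro h0
  have hn := (nsq_pos hy).ne'
  have hd := ((hq.fderiv_right (m := ∞) (by simp)).differentiable (by simp) y).hasFDerivAt
  have h1 : fderiv ℝ (fderiv ℝ q) y (quarter y) = 0 := by
    have h2 := hasDerivAt_rot 0 y
    rw [rot_zero] at h2
    have h3 : HasDerivAt (fun θ => fderiv ℝ q (rot θ y)) (fderiv ℝ (fderiv ℝ q) y (quarter y)) 0 := by
      refine HasFDerivAt.comp_hasDerivAt (l := fderiv ℝ q) (f := fun θ => rot θ y) 0 ?_ h2
      rw [rot_zero]
      exact hd
    simp only [hcrit] at h3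
    exact h3.unique (hasDerivAt_const 0 _)
  have hs : fderiv ℝ (fderiv ℝ q) y y (quarter y) = fderiv ℝ (fderiv ℝ q) y (quarter y) y :=
    (hq.contDiffAt (x := y)).isSymmSndFDerivAt (by
      rw [minSmoothness_of_isRCLikeNormedField]; exact ENat.LEInfty.out) y (quarter y)
  rw [h1] at hs
  have h2 : η = ((y.1 * η.1 + y.2 * η.2) / nsq y) • y + ((y.1 * η.2 - y.2 * η.1) / nsq y) • quarter y := by
    ext
    · simp only [quarter, Prod.fst_add, Prod.smul_fst, smul_eq_mul]
      field_simp
      simp only [nsq]; ring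
    · simp only [quarter, Prod.snd_add, Prod.smul_snd, smul_eq_mul]
      field_simp
      simp only [nsq]; ring
  apply hη
  rw [h2]
  generalize (y.1 * η.1 + y.2 * η.2) / nsq y = a
  generalize (y.1 * η.2 - y.2 * η.1) / nsq y = b
  simp [h0, h1, hs]

theorem exists_radial_model {p : Plane → ℝ} {c : ℝ → Plane} {b₀ : ℝ}
    (hwell : NondegenerateWell p c b₀) {R : ℝ} (hR : 0 < R) :
    ∃ Ψ : Plane ≃ Plane, IsDiffeoC Ψ ∧ (∃ ε : ℝ, (ε = 1 ∨ ε = -1) ∧ ∃ s, ∀ x,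
      c x = Ψ (rot (ε * x + s) (√R, 0))) ∧ ∃ μ δ : ℝ, 0 < μ ∧ 0 < δ ∧
      ∀ z, |nsq z - R| < δ → p (Ψ z) = b₀ + ((nsq z - R) / μ) ^ 2 := by
  obtain ⟨hp, hc, hper, hd, hinj, ⟨Ω, hΩ, hΩr, hΩ0, hΩ1⟩, hnd⟩ := hwell
  set e : Plane := (√R, 0) with he
  have hne : nsq e = R := nsq_sqrt hR.le
  have he0 : e ≠ 0 := fun h => by rw [nsq_eq_zero.2 h] at hne; linarith
  obtain ⟨Ψ, hΨ, ε, hε, s, h⟩ := exists_circle_parametrisation hc hper hd hinj he0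
  have hcirc : ∀ y, nsq y = R → ∃ x, c x = Ψ y := fun y hy => by
    obtain ⟨φ, rfl⟩ := exists_rot_of_nsq_eq (hne.trans hy.symm)
    refine ⟨ε * (φ - s), ?_⟩
    rw [h]
    congr 2
    rcases hε with rfl | rfl <;> ring
  have hpcrit : ∀ x, fderiv ℝ p (c x) = 0 := fun x => by
    apply IsLocalMin.fderiv_eq_zero
    filter_upwards [hΩ.mem_nhds (hΩr (mem_range_self x))] with z hz
    rw [hΩ0 _ (mem_range_self x)]
    by_cases h : z ∈ range c
    · rw [hΩ0 z h]
    · exact (hΩ1 z ⟨hz, h⟩).le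
  have hq : ContDiff ℝ ∞ fun z => p (Ψ z) := hp.comp hΨ.1
  obtain ⟨Φ, μ, δ, hΦ, hμ, hδ, hfix, hnorm⟩ := exists_radial_normalisation hq hR (b₀ := b₀)
    (fun y hy => by obtain ⟨x, hx⟩ := hcirc y hy; rw [← hx]; exact hΩ0 _ (mem_range_self x))
    (hΩ.preimage hΨ.1.continuous)
    (fun y hy => by obtain ⟨x, hx⟩ := hcirc y hy; rw [mem_preimage, ← hx]; exact hΩr (mem_range_self x))
    (fun y hy hyR => by
      refine hΩ1 _ ⟨hy, ?_⟩
      rintro ⟨x, hx⟩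
      rw [h] at hx
      apply hyR
      rw [← Ψ.injective hx, nsq_rot, hne])
    (fun y hy => by
      obtain ⟨x, hx⟩ := hcirc y hy
      have hy0 : y ≠ 0 := fun h => by rw [nsq_eq_zero.2 h] at hy; linarith
      set ν : Plane := quarter (deriv c x) with hν
      have hν0 : ν ≠ 0 := fun h0 => hd x (by
        have h2 := congrArg Prod.fst h0
        have h3 := congrArg Prod.snd h0
        simp only [hν, quarter, Prod.fst_zero, Prod.snd_zero, neg_eq_zero] at h2 h3
        exact Prod.ext h3 h2)
      have h1 := hnd x ν hν0 (by simp [hν, quarter]; ring)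
      rw [iteratedFDeriv_two_apply] at h1
      simp only [Matrix.cons_val_zero, Matrix.cons_val_one] at h1
      rw [hx] at h1
      set A := ((fderiv ℝ Ψ y).toContinuousLinearEquivOfDetNeZero (hΨ.det_ne_zero y) :
        Plane ≃L[ℝ] Plane) with hA
      have hAe : ∀ v, fderiv ℝ Ψ y v = A v := fun v => by
        rw [hA]; simp
      have hcr : fderiv ℝ p (Ψ y) = 0 := by rw [← hx, hpcrit]
      refine radial_hessian_ne_zero hq hy0 (fun θ => ?_) (η := A.symm ν) ?_
      · obtain ⟨x', hx'⟩ := hcirc (rot θ y) (by rw [nsq_rot, hy])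
        have h2 := (hp.differentiable (by simp) (Ψ (rot θ y))).hasFDerivAt.comp (rot θ y)
          (hΨ.1.differentiable (by simp) (rot θ y)).hasFDerivAt
        rw [← hx', hpcrit, ContinuousLinearMap.zero_comp] at h2
        exact h2.fderiv
      · rw [fderiv_fderiv_comp_of_critical hp hΨ.1 hcr, hAe, A.apply_symm_apply]
        exact h1)
  refine ⟨Φ.symm.trans Ψ, hΦ.symm.trans hΨ, ⟨ε, hε, s, fun x => ?_⟩, μ, δ, hμ, hδ, hnorm⟩
  have h1 : nsq (rot (ε * x + s) e) = R := by rw [nsq_rot, hne]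
  rw [h, Equiv.trans_apply, (Equiv.symm_apply_eq Φ).2 (hfix _ h1).symm]

theorem integral_area_form {c : ℝ → Plane} {Ψ : Plane ≃ Plane} (hΨ : IsDiffeoC Ψ) {ε s : ℝ}
    (hε : ε = 1 ∨ ε = -1) {e : Plane} (h : ∀ x, c x = Ψ (rot (ε * x + s) e)) :
    ∫ x in (0:ℝ)..(2 * π), (c x).1 * (deriv c x).2 =
      ε * ∫ θ in (0:ℝ)..(2 * π), (Ψ (rot θ e)).1 *
        fderiv ℝ (fun w => (Ψ w).2) (rot θ e) (quarter (rot θ e)) := by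
  set f : ℝ → ℝ := fun θ => (Ψ (rot θ e)).1 *
        fderiv ℝ (fun w => (Ψ w).2) (rot θ e) (quarter (rot θ e)) with hf
  have hp : Function.Periodic f (2 * π) := fun θ => by simp only [hf, rot_add_two_pi]
  have h1 : ∀ x, (c x).1 * (deriv c x).2 = ε * f (ε * x + s) := fun x => by
    have h2 : HasDerivAt (fun x => rot (ε * x + s) e) (ε • quarter (rot (ε * x + s) e)) x :=
      (hasDerivAt_rot (ε * x + s) e).scomp (h := fun x => ε * x + s) x (by
        simpa using ((hasDerivAt_id x).const_mul ε).add_const s)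
    have h3 := hΨ.1.differentiable (by simp) (rot (ε * x + s) e)
    have h4 : HasDerivAt c (fderiv ℝ Ψ (rot (ε * x + s) e) (ε • quarter (rot (ε * x + s) e))) x := by
      rw [show c = fun x => Ψ (rot (ε * x + s) e) from funext h]
      exact h3.hasFDerivAt.comp_hasDerivAt (f := fun x => rot (ε * x + s) e) x h2
    rw [h4.deriv, h x, hf]
    beta_reduce
    rw [h3.hasFDerivAt.snd.fderiv]
    simp only [map_smul, Prod.smul_snd, smul_eq_mul, ContinuousLinearMap.comp_apply,
      ContinuousLinearMap.coe_snd']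
    ring
  simp only [h1]
  rw [intervalIntegral.integral_const_mul]
  congr 1
  have h5 := hp.intervalIntegral_add_eq s 0
  have h6 := hp.intervalIntegral_add_eq (s - 2 * π) 0
  rw [zero_add] at h5 h6
  rcases hε with rfl | rfl
  · simp only [one_mul]
    rw [intervalIntegral.integral_comp_add_right f s, zero_add, add_comm, h5]
  · simp only [neg_one_mul, neg_add_eq_sub]
    rw [intervalIntegral.integral_comp_sub_left f s, sub_zero, ← h6, sub_add_cancel]

/-- The squared radius of a circle-preserving diffeomorphism as a function of the squared radius. -/
theorem exists_radial_profile {Φ : Plane ≃ Plane} (hΦ : IsDiffeoC Φ)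
    (hiff : ∀ z w, nsq (Φ z) = nsq (Φ w) ↔ nsq z = nsq w) {R : ℝ} (hR : 0 < R)
    (hfix : nsq (Φ (√R, 0)) = R) :
    ∃ k : ℝ → ℝ, ContDiffOn ℝ ∞ k (Ioi 0) ∧ k R = R ∧ deriv k R ≠ 0 ∧
      ∀ w, nsq (Φ.symm w) = k (nsq w) := by
  have hsm : ∀ Θ : Plane ≃ Plane, IsDiffeoC Θ →
      ContDiffOn ℝ ∞ (fun s => nsq (Θ (√s, 0))) (Ioi 0) := fun Θ hΘ => by
    have h1 : ContDiffOn ℝ ∞ (fun s : ℝ => ((√s, 0) : Plane)) (Ioi 0) :=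
      (contDiffOn_id.sqrt fun s hs => (show (0:ℝ) < s from hs).ne').prodMk contDiffOn_const
    exact (contDiff_nsq.comp hΘ.1).comp_contDiffOn h1
  set k : ℝ → ℝ := fun s => nsq (Φ.symm (√s, 0)) with hk
  have hkey : ∀ w, nsq (Φ.symm w) = k (nsq w) := fun w => by
    rw [hk, ← hiff, Φ.apply_symm_apply, Φ.apply_symm_apply, nsq_sqrt (nsq_nonneg w)]
  set b : ℝ → ℝ := fun s => nsq (Φ (√s, 0)) with hb
  have hkb : ∀ s, 0 ≤ s → k (b s) = s := fun s hs => by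
    rw [hb, ← hkey, Φ.symm_apply_apply, nsq_sqrt hs]
  have hbR : b R = R := hfix
  have hkR : k R = R := by
    have := hkb R hR.le
    rwa [hbR] at this
  have hmem : Ioi (0:ℝ) ∈ 𝓝 R := isOpen_Ioi.mem_nhds hR
  refine ⟨k, hsm _ hΦ.symm, hkR, fun h0 => ?_, hkey⟩
  have h1 : HasDerivAt k (deriv k R) (b R) := by
    rw [hbR]
    exact (((hsm _ hΦ.symm).contDiffAt hmem).differentiableAt (by simp)).hasDerivAt
  have h2 := (((hsm _ hΦ).contDiffAt hmem).differentiableAt (by simp)).hasDerivAt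
  have h3 := h1.comp R h2
  have h4 : (k ∘ b) =ᶠ[𝓝 R] id := by
    filter_upwards [hmem] with s hs using hkb s (le_of_lt hs)
  have h5 := (h3.congr_of_eventuallyEq h4.symm).unique (hasDerivAt_id R)
  rw [h0, zero_mul] at h5
  exact zero_ne_one h5

theorem IsDiffeoC.det_trans_symm {Φ Ψ : Plane ≃ Plane} (hΦ : IsDiffeoC Φ) (hΨ : IsDiffeoC Ψ)
    (h : ∀ z, (fderiv ℝ Φ z).det = (fderiv ℝ Ψ z).det) (z : Plane) :
    (fderiv ℝ (Φ.symm.trans Ψ) z).det = 1 := by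
  obtain ⟨w, rfl⟩ := Φ.surjective z
  have hσ := hΦ.symm.trans hΨ
  have h1 := (hσ.1.differentiable (by simp) (Φ w)).hasFDerivAt.comp w
    (hΦ.1.differentiable (by simp) w).hasFDerivAt
  have h2 : (Φ.symm.trans Ψ) ∘ Φ = Ψ := by ext z : 1; simp
  rw [h2] at h1
  have h3 : ((fderiv ℝ (Φ.symm.trans Ψ) (Φ w)).comp (fderiv ℝ Φ w)).det =
      (fderiv ℝ (Φ.symm.trans Ψ) (Φ w)).det * (fderiv ℝ Φ w).det := LinearMap.det_comp _ _
  rw [← h1.fderiv, h w] at h3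
  exact mul_right_cancel₀ (hΨ.det_ne_zero w) (by linarith)

end NormalForm

open NormalForm

/-- Semiglobal Hamiltonian normal form on `ℝ²`: there is a compactly supported
symplectomorphism `σ` of `ℝ²` such that `p ∘ σ = b₀ + g(x² + ξ² − 2I₀)²` on an annulus
around `{x² + ξ² = 2I₀}`, where `2πI₀` is the signed area enclosed by `γ`. -/
theorem semiglobal_hamiltonian_normal_form_R2
    (p : ℝ × ℝ → ℝ) (c : ℝ → ℝ × ℝ) (b₀ : ℝ)
    (hwell : NondegenerateWell p c b₀)
    (I₀ : ℝ)
    (hI₀ : I₀ = (1 / (2 * π)) * ∫ t in (0:ℝ)..(2 * π), (c t).1 * (deriv c t).2)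
    (hI₀pos : 0 < I₀) :
    ∃ (ε : ℝ) (g : ℝ → ℝ) (σ τ : ℝ × ℝ → ℝ × ℝ),
      0 < ε ∧
      ContDiffOn ℝ (⊤ : ℕ∞) g (Set.Ioo (-ε) ε) ∧ g 0 = 0 ∧ deriv g 0 ≠ 0 ∧
      Function.Bijective σ ∧
      ContDiff ℝ (⊤ : ℕ∞) σ ∧ ContDiff ℝ (⊤ : ℕ∞) τ ∧
      (∀ z, τ (σ z) = z) ∧ (∀ z, σ (τ z) = z) ∧
      (∀ z, (fderiv ℝ σ z).det = 1) ∧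
      (∃ K : Set (ℝ × ℝ), IsCompact K ∧ ∀ z ∉ K, σ z = z) ∧
      (∀ x ξ : ℝ, x ^ 2 + ξ ^ 2 ∈ Set.Ioo (2 * I₀ - ε) (2 * I₀ + ε) →
        p (σ (x, ξ)) = b₀ + (g (x ^ 2 + ξ ^ 2 - 2 * I₀)) ^ 2) := by
  have hR : 0 < 2 * I₀ := by linarith
  obtain ⟨Ψ, hΨ, ⟨s, hs, θ₀, hc⟩, μ, δ, hμ, hδ, hnorm⟩ := exists_radial_model hwell hR
  obtain ⟨Φ, hΦ, hdet, hiff, harea⟩ := hΨ.exists_det_eq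
  have hπ := pi_pos
  have hfix : nsq (Φ (√(2 * I₀), 0)) = 2 * I₀ := by
    rw [integral_area_form hΨ hs hc, harea] at hI₀
    have h1 : 2 * I₀ = s * nsq (Φ (√(2 * I₀), 0)) := by
      generalize nsq (Φ (√(2 * I₀), 0)) = a at hI₀ ⊢
      rw [hI₀]
      field_simp
    have h2 := nsq_nonneg (Φ (√(2 * I₀), 0))
    rcases hs with rfl | rfl <;> linarith
  obtain ⟨k, hks, hkR, hkd, hk⟩ := exists_radial_profile hΦ hiff hR hfix
  have hkc : ContinuousAt k (2 * I₀) := hks.continuousOn.continuousAt (isOpen_Ioi.mem_nhds hR)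
  obtain ⟨η, hη, hηk⟩ := Metric.continuousAt_iff.1 hkc δ hδ
  have hσ := hΦ.symm.trans hΨ
  refine ⟨min (2 * I₀) η, fun x => (k (2 * I₀ + x) - 2 * I₀) / μ, Φ.symm.trans Ψ,
    (Φ.symm.trans Ψ).symm, lt_min hR hη, ?_, by simp [hkR], ?_, Equiv.bijective _, hσ.1, hσ.2.1,
    fun z => by simp, fun z => by simp, hΦ.det_trans_symm hΨ hdet, hσ.2.2, fun x ξ hx => ?_⟩
  · refine ((hks.comp (by fun_prop) fun x hx => ?_).sub contDiffOn_const).div_const μ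
    have h1 := min_le_left (2 * I₀) η
    have h2 := hx.1
    simp only [mem_Ioi]
    linarith
  · have h1 : HasDerivAt k (deriv k (2 * I₀)) (2 * I₀ + 0) := by
      rw [add_zero]
      exact ((hks.contDiffAt (isOpen_Ioi.mem_nhds hR)).differentiableAt (by simp)).hasDerivAt
    rw [((h1.comp_const_add (2 * I₀) 0).sub_const (2 * I₀) |>.div_const μ).deriv]
    exact div_ne_zero hkd hμ.ne'
  · have h1 := min_le_right (2 * I₀) η
    have h2 : nsq (x, ξ) = x ^ 2 + ξ ^ 2 := rfl
    have h3 : |x ^ 2 + ξ ^ 2 - 2 * I₀| < η := abs_lt.2 ⟨by linarith [hx.1], by linarith [hx.2]⟩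
    have h4 : |nsq (Φ.symm (x, ξ)) - 2 * I₀| < δ := by
      rw [hk, h2]
      simpa [Real.dist_eq, hkR] using hηk (by rwa [Real.dist_eq])
    rw [Equiv.trans_apply, hnorm _ h4, hk, h2]
    beta_reduce
    rw [add_sub_cancel]
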